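/- Assume (β,h) satisfy the AT condition. Then there exists c = c_{β,h} > 0, independent of N, such that for k large enough, with probability tending to one as N → ∞, the matrix inequality D_{m^(k)} + β²(1−q) − (2β²/N) m^(k) ⊗ m^(k) − β G ≥ c holds in the sense of quadratic forms, where m^(k) is Bolthausen's iterative TAP solution at step k and D_{m^(k)} ∈ ℝ^{N×N} is diagonal with entries (D_{m^(k)})_{ij} = δ_{ij}/(1 − (m_i^(k))²). -/

import Mathlib

open MeasureTheory ProbabilityTheory Real Filter

noncomputable section

namespace SK

/-- The spin value `±1` encoded by a Boolean. -/
def spin (b : Bool) : ℝ := if b then 1 else -1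

/-- SK Hamiltonian with coupling matrix `g`, inverse temperature `β` and external
field vector `hv`:  `H(σ) = β ∑_{i<j} g_{ij} σ_i σ_j + ∑_i hv_i σ_i`. -/
def hamiltonian (N : ℕ) (β : ℝ) (g : Fin N → Fin N → ℝ) (hv : Fin N → ℝ)
    (σ : Fin N → ℝ) : ℝ :=
  β * ∑ i : Fin N, ∑ j : Fin N, (if i < j then g i j * σ i * σ j else 0)
    + ∑ i : Fin N, hv i * σ i

/-- Partition function `Z_N`. -/
def partitionZ (N : ℕ) (β : ℝ) (g : Fin N → Fin N → ℝ) (hv : Fin N → ℝ) : ℝ :=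
  ∑ s : Fin N → Bool, Real.exp (hamiltonian N β g hv (fun i => spin (s i)))

/-- Gibbs expectation `⟨f⟩`. -/
def gibbs (N : ℕ) (β : ℝ) (g : Fin N → Fin N → ℝ) (hv : Fin N → ℝ)
    (f : (Fin N → ℝ) → ℝ) : ℝ :=
  (∑ s : Fin N → Bool, f (fun i => spin (s i)) *
      Real.exp (hamiltonian N β g hv (fun i => spin (s i)))) / partitionZ N β g hv

/-- Magnetization `m_i = ⟨σ_i⟩`. -/
def mag (N : ℕ) (β : ℝ) (g : Fin N → Fin N → ℝ) (hv : Fin N → ℝ) (i : Fin N) : ℝ :=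
  gibbs N β g hv (fun σ => σ i)

/-- Two point correlation `m_{ij} = ⟨σ_i σ_j⟩ - ⟨σ_i⟩⟨σ_j⟩`. -/
def corr (N : ℕ) (β : ℝ) (g : Fin N → Fin N → ℝ) (hv : Fin N → ℝ) (i j : Fin N) : ℝ :=
  gibbs N β g hv (fun σ => σ i * σ j) - mag N β g hv i * mag N β g hv j

/-- Operator (ℓ²→ℓ²) norm of an `N×N` real matrix. -/
def opNorm (N : ℕ) (A : Fin N → Fin N → ℝ) : ℝ :=
  sSup {x : ℝ | ∃ u : Fin N → ℝ, (∑ i, u i ^ 2) = 1 ∧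
    x = Real.sqrt (∑ i, (∑ j, A i j * u j) ^ 2)}

/-- `q ↦ E tanh²(h + β √q Z)`, `Z` standard Gaussian. -/
def qtanh (β h q : ℝ) : ℝ :=
  ∫ z, Real.tanh (h + β * Real.sqrt q * z) ^ 2 ∂(gaussianReal 0 1)

/-- `q` is the (unique) solution in `(0,1)` of `q = E tanh²(h + β √q Z)`. -/
def isFixedq (β h q : ℝ) : Prop := 0 < q ∧ q < 1 ∧ q = qtanh β h q

/-- The de Almeida–Thouless condition `β² E sech⁴(h + β √q Z) < 1`. -/
def ATcond (β h q : ℝ) : Prop :=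
  β ^ 2 * ∫ z, (Real.cosh (h + β * Real.sqrt q * z))⁻¹ ^ 4 ∂(gaussianReal 0 1) < 1

/-- The functional `Φ(m, q')` from condition (AT+). -/
def Phi (β h q m q' : ℝ) : ℝ :=
  Real.log 2 + β ^ 2 / 4 * (1 - q') ^ 2 - β ^ 2 / 4 * m * (q' ^ 2 - q ^ 2)
    + (1 / m) * ∫ z, Real.log (∫ z', Real.cosh (h + β * Real.sqrt q * z
        + β * Real.sqrt (q' - q) * z') ^ m ∂(gaussianReal 0 1)) ∂(gaussianReal 0 1)

/-- Condition (AT+): `(∂_m Φ)(m, q')|_{m=1} < 0` for all `q < q' ≤ 1`. -/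
def ATplus (β h q : ℝ) : Prop :=
  ∀ q' : ℝ, q < q' → q' ≤ 1 → deriv (fun m => Phi β h q m q') 1 < 0

/-- `G` is a GOE random matrix: symmetric, zero diagonal, and the entries above the
diagonal are i.i.d. centered Gaussians of variance `1/N`. -/
def IsGOE (N : ℕ) {Ω : Type*} [MeasurableSpace Ω] (P : Measure Ω)
    (G : Ω → Fin N → Fin N → ℝ) : Prop :=
  (∀ ω i j, G ω i j = G ω j i) ∧ (∀ ω i, G ω i i = 0) ∧
  iIndepFun (m := fun _ : {p : Fin N × Fin N // p.1 < p.2} => (inferInstance : MeasurableSpace ℝ))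
    (fun p ω => G ω p.1.1 p.1.2) P ∧
  ∀ p : {p : Fin N × Fin N // p.1 < p.2},
    Measure.map (fun ω => G ω p.1.1 p.1.2) P = gaussianReal 0 (N : NNReal)⁻¹


/-! ### Bolthausen's iterative TAP solution -/

/-- Euclidean inner product on `ℝ^N`. -/
def dotp (N : ℕ) (u v : Fin N → ℝ) : ℝ := ∑ i, u i * v i

/-- Matrix-vector multiplication. -/
def mulVec (N : ℕ) (A : Fin N → Fin N → ℝ) (u : Fin N → ℝ) : Fin N → ℝ :=
  fun i => ∑ j, A i j * u j

/-- Symmetrization `(W + Wᵀ)/√2`. -/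
def symmG (N : ℕ) (W : Fin N → Fin N → ℝ) : Fin N → Fin N → ℝ :=
  fun i j => (W i j + W j i) / Real.sqrt 2

/-- `γ₁ = E tanh (h + β √q Z)`. -/
def gamma1 (β h q : ℝ) : ℝ :=
  ∫ z, Real.tanh (h + β * Real.sqrt q * z) ∂(gaussianReal 0 1)

/-- `ψ(t) = E tanh(h + β√t Z + β√(q-t) Z') tanh(h + β√t Z + β√(q-t) Z'')` for independent
standard Gaussians `Z, Z', Z''`. -/
def psiFun (β h q t : ℝ) : ℝ :=
  ∫ z, ∫ z', ∫ z'',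
      Real.tanh (h + β * Real.sqrt t * z + β * Real.sqrt (q - t) * z')
        * Real.tanh (h + β * Real.sqrt t * z + β * Real.sqrt (q - t) * z'')
    ∂(gaussianReal 0 1) ∂(gaussianReal 0 1) ∂(gaussianReal 0 1)

/-- The triple `(α_k, γ_k, Γ_k²)` of Bolthausen's recursion; the natural index `k`
corresponds to the step `k + 1` (so `boltSeq _ _ _ 0 = (α₁, γ₁, Γ₁²)`). -/
def boltSeq (β h q : ℝ) : ℕ → ℝ × ℝ × ℝ
  | 0 => (Real.sqrt q * gamma1 β h q, gamma1 β h q, gamma1 β h q ^ 2)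
  | k + 1 =>
      let p := boltSeq β h q k
      let a := psiFun β h q p.1
      let g := (a - p.2.2) / Real.sqrt (q - p.2.2)
      (a, g, p.2.2 + g ^ 2)

/-- `α_k` (for `k ≥ 1`). -/
def alphaSeq (β h q : ℝ) (k : ℕ) : ℝ := (boltSeq β h q (k - 1)).1

/-- `γ_k` (for `k ≥ 1`). -/
def gammaSeq (β h q : ℝ) (k : ℕ) : ℝ := (boltSeq β h q (k - 1)).2.1

/-- `Γ_k²` (for `k ≥ 1`), with the convention `Γ₀² = 0`. -/
def GammaSq (β h q : ℝ) (k : ℕ) : ℝ :=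
  if k = 0 then 0 else (boltSeq β h q (k - 1)).2.2

/-- State of Bolthausen's TAP iteration after step `k`: the matrix `W^{(k)}`, the
orthonormal vectors `φ^{(s)}` and the cavity vectors `ζ^{(s)}` for `1 ≤ s ≤ k`, and the
iterate `m^{(k)}`. -/
structure TapState (N : ℕ) where
  W : Fin N → Fin N → ℝ
  phi : ℕ → Fin N → ℝ
  zeta : ℕ → Fin N → ℝ
  m : Fin N → ℝ

/-- Initial state (step `1`): `W^{(1)} = W`, `φ^{(1)} = N^{-1/2} 𝟏`, `m^{(1)} = √q 𝟏`,
`ζ^{(1)} = G^{(1)} N^{1/2} φ^{(1)}`. -/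
def tapInit (N : ℕ) (q : ℝ) (W0 : Fin N → Fin N → ℝ) : TapState N :=
  let φ1 : Fin N → ℝ := fun _ => (Real.sqrt N)⁻¹
  { W := W0
    phi := fun s => if s = 1 then φ1 else 0
    zeta := fun s =>
      if s = 1 then mulVec N (symmG N W0) (fun i => Real.sqrt N * φ1 i) else 0
    m := fun _ => Real.sqrt q }

/-- One step of the TAP iteration: from the state after step `k` (with `k ≥ 1`) to the
state after step `k+1`. -/
def tapStep (N : ℕ) (β h q : ℝ) (k : ℕ) (st : TapState N) : TapState N :=
  -- the cavity field z^{(k+1)} = ∑_{s=1}^{k-1} γ_s ζ^{(s)} + √(q - Γ_{k-1}²) ζ^{(k)}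
  let z : Fin N → ℝ := fun i =>
    (∑ s ∈ Finset.Icc 1 (k - 1), gammaSeq β h q s * st.zeta s i)
      + Real.sqrt (q - GammaSq β h q (k - 1)) * st.zeta k i
  -- m^{(k+1)} = tanh (h 𝟏 + β z^{(k+1)})
  let m' : Fin N → ℝ := fun i => Real.tanh (h + β * z i)
  -- Gram–Schmidt: φ^{(k+1)}
  let v : Fin N → ℝ := fun i =>
    m' i - ∑ s ∈ Finset.Icc 1 k, dotp N m' (st.phi s) * st.phi s i
  let φ' : Fin N → ℝ := fun i => v i / Real.sqrt (dotp N v v)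
  -- W^{(k+1)} = W^{(k)} - ρ^{(k)}
  let Wφ := mulVec N st.W (st.phi k)
  let WTφ := mulVec N (fun i j => st.W j i) (st.phi k)
  let W' : Fin N → Fin N → ℝ := fun i j =>
    st.W i j - (Wφ i * st.phi k j + st.phi k i * WTφ j
      - dotp N Wφ (st.phi k) * st.phi k i * st.phi k j)
  -- ζ^{(k+1)} = G^{(k+1)} N^{1/2} φ^{(k+1)}
  let ζ' : Fin N → ℝ := mulVec N (symmG N W') (fun i => Real.sqrt N * φ' i)
  { W := W'
    phi := Function.update st.phi (k + 1) φ'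
    zeta := Function.update st.zeta (k + 1) ζ'
    m := m' }

/-- The state after step `k+1` (natural index `k`). -/
def tapState (N : ℕ) (β h q : ℝ) (W0 : Fin N → Fin N → ℝ) : ℕ → TapState N
  | 0 => tapInit N q W0
  | k + 1 => tapStep N β h q (k + 1) (tapState N β h q W0 k)

/-- Bolthausen's iterative TAP solution `m^{(k)}` (for `k ≥ 1`). -/
def mTAP (N : ℕ) (β h q : ℝ) (W0 : Fin N → Fin N → ℝ) (k : ℕ) : Fin N → ℝ :=
  (tapState N β h q W0 (k - 1)).m

/-- `W` is a random matrix with zero diagonal whose off-diagonal entries are i.i.d.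
centered Gaussians of variance `1/N` (no symmetry constraint). -/
def IsWGauss (N : ℕ) {Ω : Type*} [MeasurableSpace Ω] (P : Measure Ω)
    (W : Ω → Fin N → Fin N → ℝ) : Prop :=
  (∀ ω i, W ω i i = 0) ∧
  iIndepFun (m := fun _ : {p : Fin N × Fin N // p.1 ≠ p.2} => (inferInstance : MeasurableSpace ℝ))
    (fun p ω => W ω p.1.1 p.1.2) P ∧
  ∀ p : {p : Fin N × Fin N // p.1 ≠ p.2},
    Measure.map (fun ω => W ω p.1.1 p.1.2) P = gaussianReal 0 (N : NNReal)⁻¹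


/-- standard Gaussian measure on `ι → ℝ` -/
def gm (ι : Type*) [Fintype ι] : Measure (ι → ℝ) := Measure.pi (fun _ : ι => gaussianReal 0 1)

instance gm_prob (ι : Type*) [Fintype ι] : IsProbabilityMeasure (gm ι) := by
  unfold gm; infer_instance

theorem ibp1 (f f' : ℝ → ℝ) (hd : ∀ x, HasDerivAt f (f' x) x)
    (h1 : Integrable f (gaussianReal 0 1)) (h2 : Integrable (fun x => x * f x) (gaussianReal 0 1))
    (h3 : Integrable f' (gaussianReal 0 1)) :
    ∫ x, x * f x ∂(gaussianReal 0 1) = ∫ x, f' x ∂(gaussianReal 0 1) := by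
  have key : ∀ g : ℝ → ℝ, Integrable g (gaussianReal 0 1) →
      Integrable (fun x => g x * gaussianPDFReal 0 1 x) := by
    intro g hg
    rw [gaussianReal_of_var_ne_zero 0 one_ne_zero] at hg
    rw [integrable_withDensity_iff (measurable_gaussianPDF 0 1)
      (ae_of_all _ fun _ ↦ gaussianPDF_lt_top)] at hg
    simpa [toReal_gaussianPDF] using hg
  have hp : ∀ x, HasDerivAt (gaussianPDFReal 0 1) (-x * gaussianPDFReal 0 1 x) x := by
    intro x
    have : HasDerivAt (fun x : ℝ => (√(2 * π * (1:NNReal)))⁻¹ * rexp (-(x - 0) ^ 2 / (2 * (1:NNReal))))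
        ((√(2 * π * (1:NNReal)))⁻¹ * (rexp (-(x - 0) ^ 2 / (2 * (1:NNReal))) * (-(2 * (x-0)) / (2 * (1:NNReal))))) x := by
      apply HasDerivAt.const_mul
      apply HasDerivAt.exp
      apply HasDerivAt.div_const
      have := (((hasDerivAt_id x).sub_const (0:ℝ)).fun_pow 2).fun_neg
      simpa using this
    rw [gaussianPDFReal_def]
    convert this using 1
    simp; ring
  rw [integral_gaussianReal_eq_integral_smul one_ne_zero,
    integral_gaussianReal_eq_integral_smul one_ne_zero]
  have h := integral_mul_deriv_eq_deriv_mul_of_integrable (u := f) (u' := f')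
    (v := gaussianPDFReal 0 1) (v' := fun x => -x * gaussianPDFReal 0 1 x)
    (fun x _ => hd x) (fun x _ => hp x) ?_ (key f' h3) (key f h1)
  · have e1 : ∀ x, gaussianPDFReal 0 1 x • (x * f x) = - (f x * (-x * gaussianPDFReal 0 1 x)) := by
      intro x; simp; ring
    have e2 : ∀ x, gaussianPDFReal 0 1 x • f' x = f' x * gaussianPDFReal 0 1 x := by
      intro x; simp; ring
    simp_rw [e1, e2]
    rw [integral_neg, h]; simp
  · have := (key _ h2).neg
    refine this.congr (ae_of_all _ fun x => ?_)
    simp; ring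

theorem mp_update {ι : Type*} [Fintype ι] [DecidableEq ι] (i : ι) :
    MeasurePreserving (fun p : (ι → ℝ) × ℝ => Function.update p.1 i p.2)
      ((gm ι).prod (gaussianReal 0 1)) (gm ι) := by
  have hm : Measurable (fun p : (ι → ℝ) × ℝ => Function.update p.1 i p.2) := by
    rw [measurable_pi_iff]
    intro j
    by_cases h : j = i
    · subst h; simpa using measurable_snd
    · simp only [Function.update_of_ne h]; fun_prop
  refine ⟨hm, ?_⟩
  unfold gm
  symm
  apply Measure.pi_eq
  intro s hs
  rw [Measure.map_apply hm (MeasurableSet.univ_pi hs)]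
  have : (fun p : (ι → ℝ) × ℝ => Function.update p.1 i p.2) ⁻¹' (Set.univ.pi s)
      = (Set.univ.pi (Function.update s i Set.univ)) ×ˢ (s i) := by
    ext p
    simp only [Set.mem_preimage, Set.mem_pi, Set.mem_univ, forall_true_left, Set.mem_prod]
    constructor
    · intro h
      refine ⟨fun j => ?_, by simpa using h i⟩
      by_cases hj : j = i
      · subst hj; simp
      · simpa [hj] using h j
    · rintro ⟨h1, h2⟩ j
      by_cases hj : j = i
      · subst hj; simpa
      · simpa [hj] using h1 j
  rw [this, Measure.prod_prod, Measure.pi_pi]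
  rw [← Finset.mul_prod_erase _ _ (Finset.mem_univ i), ← Finset.mul_prod_erase _ _ (Finset.mem_univ i)]
  simp only [Function.update_self, measure_univ, one_mul]
  rw [mul_comm]
  congr 1
  apply Finset.prod_congr rfl
  intro j hj
  rw [Function.update_of_ne (Finset.ne_of_mem_erase hj)]

theorem ibp {ι : Type*} [Fintype ι] [DecidableEq ι] (i : ι) (F F' : (ι → ℝ) → ℝ)
    (hd : ∀ x, HasDerivAt (fun t => F (Function.update x i t)) (F' x) (x i))
    (h1 : Integrable F (gm ι)) (h2 : Integrable (fun x => x i * F x) (gm ι))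
    (h3 : Integrable F' (gm ι)) :
    ∫ x, x i * F x ∂(gm ι) = ∫ x, F' x ∂(gm ι) := by
  have mp := mp_update (ι := ι) i
  have tr : ∀ G : (ι → ℝ) → ℝ, Integrable G (gm ι) →
      Integrable (fun p : (ι → ℝ) × ℝ => G (Function.update p.1 i p.2))
        ((gm ι).prod (gaussianReal 0 1)) ∧
      ∫ x, G x ∂(gm ι) = ∫ x, ∫ t, G (Function.update x i t) ∂(gaussianReal 0 1) ∂(gm ι) := by
    intro G hG
    have hi : Integrable (fun p : (ι → ℝ) × ℝ => G (Function.update p.1 i p.2))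
        ((gm ι).prod (gaussianReal 0 1)) := mp.integrable_comp_of_integrable hG
    refine ⟨hi, ?_⟩
    rw [← integral_prod _ hi]
    conv_lhs => rw [← mp.map_eq]
    rw [integral_map mp.measurable.aemeasurable]
    rw [mp.map_eq]; exact hG.aestronglyMeasurable
  obtain ⟨i1, e1⟩ := tr _ h1
  obtain ⟨i2, e2⟩ := tr _ h2
  obtain ⟨i3, e3⟩ := tr _ h3
  rw [e2, e3]
  apply integral_congr_ae
  filter_upwards [i1.prod_right_ae, i2.prod_right_ae, i3.prod_right_ae] with x j1 j2 j3
  simp only [Function.update_self] at j2 ⊢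
  apply ibp1 _ _ _ j1 j2 j3
  intro t
  have := hd (Function.update x i t)
  simpa using this

theorem mp_eval {ι : Type*} [Fintype ι] (i : ι) :
    MeasurePreserving (fun x : ι → ℝ => x i) (gm ι) (gaussianReal 0 1) := by
  unfold gm
  exact measurePreserving_eval _ i

theorem coord_memLp {ι : Type*} [Fintype ι] (i : ι) (p : ENNReal) (hp : p ≠ ⊤) :
    MemLp (fun x : ι → ℝ => x i) p (gm ι) := by
  have := memLp_id_gaussianReal' (μ := 0) (v := 1) p hp
  exact this.comp_measurePreserving (mp_eval i)

theorem coord_integrable {ι : Type*} [Fintype ι] (i : ι) :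
    Integrable (fun x : ι → ℝ => x i) (gm ι) :=
  (coord_memLp i 1 (by simp)).integrable le_rfl

theorem bdd_integrable {ι : Type*} [Fintype ι] (F : (ι → ℝ) → ℝ) (hF : Continuous F) (C : ℝ)
    (hC : ∀ x, |F x| ≤ C) : Integrable F (gm ι) :=
  Integrable.of_bound hF.aestronglyMeasurable C (ae_of_all _ fun x => by simpa using hC x)

theorem coord_bdd_integrable {ι : Type*} [Fintype ι] (i : ι) (F : (ι → ℝ) → ℝ) (hF : Continuous F)
    (C : ℝ) (hC : ∀ x, |F x| ≤ C) : Integrable (fun x => x i * F x) (gm ι) := by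
  refine (coord_integrable i).mul_bdd (c := C) hF.aestronglyMeasurable (ae_of_all _ fun x => by simpa using hC x)

set_option linter.unusedSectionVars false

/-- linear functional with coefficients `a` -/
def lin {κ : Type*} [Fintype κ] (a : κ → ℝ) (x : κ → ℝ) : ℝ := ∑ k, a k * x k

theorem lin_cont {κ : Type*} [Fintype κ] (a : κ → ℝ) : Continuous (lin a) := by
  unfold lin; fun_prop

theorem lin_update {κ : Type*} [Fintype κ] [DecidableEq κ] (a : κ → ℝ) (x : κ → ℝ) (k : κ) :
    HasDerivAt (fun t => lin a (Function.update x k t)) (a k) (x k) := by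
  unfold lin
  have : ∀ j ∈ (Finset.univ : Finset κ), HasDerivAt (fun t => a j * Function.update x k t j)
      (if j = k then a k else 0) (x k) := by
    intro j _
    by_cases h : j = k
    · subst h
      simpa using (hasDerivAt_id (x j)).const_mul (a j)
    · simpa [h] using hasDerivAt_const (x k) (a j * x j)
  have := HasDerivAt.fun_sum this
  simpa using this

section interp
variable {T κ : Type*} [Fintype T] [DecidableEq T] [Fintype κ] [DecidableEq κ]

/-- interpolating coefficients -/
def Uc (A B : T → κ → ℝ) (θ : ℝ) (u : T) (k : κ) : ℝ := cos θ * B u k + sin θ * A u k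
def Vc (A B : T → κ → ℝ) (θ : ℝ) (u : T) (k : κ) : ℝ := -sin θ * B u k + cos θ * A u k

theorem prod_abs_le_one (s : Finset T) (g : T → ℝ) (h : ∀ u, |g u| ≤ 1) : |∏ u ∈ s, g u| ≤ 1 := by
  rw [Finset.abs_prod]
  exact Finset.prod_le_one (fun i _ => abs_nonneg _) (fun i _ => h i)

theorem UV_cov (A B : T → κ → ℝ) (hAB : ∀ u v, ∑ k, A u k * B v k = 0) (θ : ℝ) (u v : T) :
    ∑ k, Vc A B θ u k * Uc A B θ v k
      = sin θ * cos θ * (∑ k, A u k * A v k - ∑ k, B u k * B v k) := by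
  have h1 := hAB u v
  have h2 := hAB v u
  have : ∀ k, Vc A B θ u k * Uc A B θ v k = sin θ * cos θ * (A u k * A v k)
     - sin θ * cos θ * (B u k * B v k) + cos θ ^ 2 * (A u k * B v k)
      - sin θ ^ 2 * (A v k * B u k) := by
    intro k; unfold Vc Uc; ring
  simp_rw [this, Finset.sum_sub_distrib, Finset.sum_add_distrib, Finset.sum_sub_distrib,
    ← Finset.mul_sum, h1, h2]
  ring

theorem interp_deriv (A B : T → κ → ℝ) (hAB : ∀ u v, ∑ k, A u k * B v k = 0)
    (hdiag : ∀ u, ∑ k, A u k * A u k = ∑ k, B u k * B u k)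
    (f f' f'' : T → ℝ → ℝ) (C : ℝ)
    (hf : ∀ u x, HasDerivAt (f u) (f' u x) x) (hf' : ∀ u x, HasDerivAt (f' u) (f'' u x) x)
    (hc : ∀ u, Continuous (f'' u)) (b0 : ∀ u x, |f u x| ≤ 1) (b1 : ∀ u x, |f' u x| ≤ C)
    (b2 : ∀ u x, |f'' u x| ≤ C) (θ : ℝ) :
    HasDerivAt (fun θ => ∫ x, ∏ u, f u (lin (Uc A B θ u) x) ∂(gm κ))
      (sin θ * cos θ * ∑ u, ∑ v ∈ Finset.univ.erase u,
        (∑ k, A u k * A v k - ∑ k, B u k * B v k) *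
          ∫ x, f' u (lin (Uc A B θ u) x) * f' v (lin (Uc A B θ v) x) *
            ∏ w ∈ (Finset.univ.erase u).erase v, f w (lin (Uc A B θ w) x) ∂(gm κ)) θ := by
  have cf : ∀ u, Continuous (f u) := fun u => continuous_iff_continuousAt.2 fun x => (hf u x).continuousAt
  have cf' : ∀ u, Continuous (f' u) := fun u => continuous_iff_continuousAt.2 fun x => (hf' u x).continuousAt
  have cl : ∀ θ u, Continuous (fun x : κ → ℝ => lin (Uc A B θ u) x) := fun θ u => lin_cont _
  have cv : ∀ θ u, Continuous (fun x : κ → ℝ => lin (Vc A B θ u) x) := fun θ u => lin_cont _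
  -- derivative in θ of U
  have dU : ∀ u x θ, HasDerivAt (fun θ => lin (Uc A B θ u) x) (lin (Vc A B θ u) x) θ := by
    intro u x θ
    unfold lin Uc Vc
    apply HasDerivAt.fun_sum
    intro k _
    have := (((hasDerivAt_cos θ).mul_const (B u k)).add ((hasDerivAt_sin θ).mul_const (A u k))).mul_const (x k)
    exact this
  by_cases hT : IsEmpty T
  · simp only [Finset.univ_eq_empty, Finset.prod_empty, Finset.sum_empty, mul_zero]
    exact hasDerivAt_const _ _
  have hC : 0 ≤ C := by
    rw [not_isEmpty_iff] at hT
    exact (abs_nonneg _).trans (b1 hT.some 0)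
  -- step 1
  have s1 := hasDerivAt_integral_of_dominated_loc_of_deriv_le (μ := gm κ) (x₀ := θ) (s := Set.univ)
    (F := fun θ x => ∏ u, f u (lin (Uc A B θ u) x))
    (F' := fun θ x => ∑ u, (∏ v ∈ Finset.univ.erase u, f v (lin (Uc A B θ v) x)) •
        (f' u (lin (Uc A B θ u) x) * lin (Vc A B θ u) x))
    (bound := fun x => ∑ u, C * ∑ k, (|B u k| + |A u k|) * |x k|) Filter.univ_mem ?_ ?_ ?_ ?_ ?_ ?_
  rotate_left
  · exact Eventually.of_forall fun θ => Continuous.aestronglyMeasurable (by fun_prop)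
  · apply bdd_integrable _ (by fun_prop) 1
    intro x; exact prod_abs_le_one _ _ (fun u => b0 u _)
  · exact Continuous.aestronglyMeasurable (by fun_prop)
  · refine ae_of_all _ fun x θ _ => ?_
    refine (norm_sum_le _ _).trans (Finset.sum_le_sum fun u _ => ?_)
    simp only [smul_eq_mul, norm_mul, Real.norm_eq_abs]
    have e1 := prod_abs_le_one (Finset.univ.erase u) (fun v => f v (lin (Uc A B θ v) x)) (fun v => b0 v _)
    have e2 : |lin (Vc A B θ u) x| ≤ ∑ k, (|B u k| + |A u k|) * |x k| := by
      unfold lin Vc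
      refine (Finset.abs_sum_le_sum_abs _ _).trans (Finset.sum_le_sum fun k _ => ?_)
      rw [abs_mul]
      apply mul_le_mul_of_nonneg_right _ (abs_nonneg _)
      refine (abs_add_le _ _).trans ?_
      rw [abs_mul, abs_mul, abs_neg]
      apply add_le_add
      · exact mul_le_of_le_one_left (abs_nonneg _) (abs_sin_le_one θ)
      · exact mul_le_of_le_one_left (abs_nonneg _) (abs_cos_le_one θ)
    calc _ ≤ 1 * (C * ∑ k, (|B u k| + |A u k|) * |x k|) := by
            apply mul_le_mul e1 _ (by positivity) (by norm_num)
            exact mul_le_mul (b1 u _) e2 (abs_nonneg _) hC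
      _ = _ := one_mul _
  · apply integrable_finsetSum; intro u _
    apply Integrable.const_mul
    apply integrable_finsetSum; intro k _
    apply Integrable.const_mul
    exact (coord_integrable k).abs
  · refine ae_of_all _ fun x θ _ => ?_
    have := HasDerivAt.fun_finsetProd (u := Finset.univ) (f := fun u θ => f u (lin (Uc A B θ u) x))
      (f' := fun u => f' u (lin (Uc A B θ u) x) * lin (Vc A B θ u) x) (x := θ) ?_
    · exact this
    · intro u _
      exact (hf u _).comp θ (dU u x θ)
  refine s1.2.congr_deriv ?_
  symm
  have c2 : ∀ u k, Integrable (fun x : κ → ℝ => x k * (f' u (lin (Uc A B θ u) x) *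
      ∏ v ∈ Finset.univ.erase u, f v (lin (Uc A B θ v) x))) (gm κ) := by
    intro u k
    apply coord_bdd_integrable k _ (by fun_prop) (C * 1)
    intro x
    rw [abs_mul]
    exact mul_le_mul (b1 u _) (prod_abs_le_one _ _ (fun v => b0 v _)) (abs_nonneg _) hC
  have c3 : ∀ u v, Integrable (fun x : κ → ℝ => f' u (lin (Uc A B θ u) x) * f' v (lin (Uc A B θ v) x) *
            ∏ w ∈ (Finset.univ.erase u).erase v, f w (lin (Uc A B θ w) x)) (gm κ) := by
    intro u v
    apply bdd_integrable _ (by fun_prop) (C * C * 1)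
    intro x
    rw [abs_mul, abs_mul]
    exact mul_le_mul (mul_le_mul (b1 u _) (b1 v _) (abs_nonneg _) hC)
      (prod_abs_le_one _ _ (fun v => b0 v _)) (abs_nonneg _) (by positivity)
  have c4 : ∀ u, Integrable (fun x : κ → ℝ => f'' u (lin (Uc A B θ u) x) *
      ∏ v ∈ Finset.univ.erase u, f v (lin (Uc A B θ v) x)) (gm κ) := by
    intro u
    apply bdd_integrable _ (by fun_prop) (C * 1)
    intro x
    rw [abs_mul]
    exact mul_le_mul (b2 u _) (prod_abs_le_one _ _ (fun v => b0 v _)) (abs_nonneg _) hC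
  have key : ∀ u k, ∫ x : κ → ℝ, x k * (f' u (lin (Uc A B θ u) x) *
      ∏ v ∈ Finset.univ.erase u, f v (lin (Uc A B θ v) x)) ∂(gm κ)
      = Uc A B θ u k * ∫ x, f'' u (lin (Uc A B θ u) x) *
          ∏ v ∈ Finset.univ.erase u, f v (lin (Uc A B θ v) x) ∂(gm κ)
        + ∑ v ∈ Finset.univ.erase u, Uc A B θ v k *
          ∫ x, f' u (lin (Uc A B θ u) x) * f' v (lin (Uc A B θ v) x) *
            ∏ w ∈ (Finset.univ.erase u).erase v, f w (lin (Uc A B θ w) x) ∂(gm κ) := by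
    intro u k
    rw [ibp k _ (fun x => Uc A B θ u k * (f'' u (lin (Uc A B θ u) x) *
          ∏ v ∈ Finset.univ.erase u, f v (lin (Uc A B θ v) x))
        + ∑ v ∈ Finset.univ.erase u, Uc A B θ v k *
          (f' u (lin (Uc A B θ u) x) * f' v (lin (Uc A B θ v) x) *
            ∏ w ∈ (Finset.univ.erase u).erase v, f w (lin (Uc A B θ w) x))) _ _ (c2 u k)]
    · rw [integral_add ((c4 u).const_mul _) (integrable_finsetSum _ fun v _ => (c3 u v).const_mul _),
        integral_finsetSum _ (fun v _ => (c3 u v).const_mul _), integral_const_mul]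
      simp_rw [integral_const_mul]
    · exact ((c4 u).const_mul _).add (integrable_finsetSum _ fun v _ => (c3 u v).const_mul _)
    · intro x
      have d1 : HasDerivAt (fun t => f' u (lin (Uc A B θ u) (Function.update x k t)))
          (f'' u (lin (Uc A B θ u) x) * Uc A B θ u k) (x k) := by
        have := (hf' u (lin (Uc A B θ u) (Function.update x k (x k)))).comp (x k)
          (lin_update (Uc A B θ u) x k)
        simp only [Function.update_eq_self] at this
        exact this
      have d2 : HasDerivAt (fun t => ∏ v ∈ Finset.univ.erase u, f v (lin (Uc A B θ v) (Function.update x k t)))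
          (∑ v ∈ Finset.univ.erase u, (∏ w ∈ (Finset.univ.erase u).erase v, f w (lin (Uc A B θ w) x)) •
             (f' v (lin (Uc A B θ v) x) * Uc A B θ v k)) (x k) := by
        have := HasDerivAt.fun_finsetProd (u := Finset.univ.erase u)
          (f := fun v t => f v (lin (Uc A B θ v) (Function.update x k t)))
          (f' := fun v => f' v (lin (Uc A B θ v) x) * Uc A B θ v k) (x := x k) ?_
        · simpa using this
        · intro v _
          have := (hf v (lin (Uc A B θ v) (Function.update x k (x k)))).comp (x k)
            (lin_update (Uc A B θ v) x k)
          simp only [Function.update_eq_self] at this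
          exact this
      have := d1.fun_mul d2
      simp only [Function.update_eq_self] at this
      refine this.congr_deriv ?_
      symm
      rw [Finset.mul_sum]
      congr 1
      · ring
      · apply Finset.sum_congr rfl; intro v _; simp only [smul_eq_mul]; ring
    · apply bdd_integrable _ (by fun_prop) (C * 1)
      intro x
      rw [abs_mul]
      exact mul_le_mul (b1 u _) (prod_abs_le_one _ _ (fun v => b0 v _)) (abs_nonneg _) hC
  have e0 : ∀ u, ∀ x : κ → ℝ, (∏ v ∈ Finset.univ.erase u, f v (lin (Uc A B θ v) x)) •
        (f' u (lin (Uc A B θ u) x) * lin (Vc A B θ u) x) = ∑ k, Vc A B θ u k *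
          (x k * (f' u (lin (Uc A B θ u) x) * ∏ v ∈ Finset.univ.erase u, f v (lin (Uc A B θ v) x))) := by
    intro u x
    simp only [smul_eq_mul]
    rw [show lin (Vc A B θ u) x = ∑ k, Vc A B θ u k * x k from rfl, Finset.mul_sum, Finset.mul_sum]
    apply Finset.sum_congr rfl; intro k _; ring
  have e1 : ∫ x, (∑ u, (∏ v ∈ Finset.univ.erase u, f v (lin (Uc A B θ v) x)) •
        (f' u (lin (Uc A B θ u) x) * lin (Vc A B θ u) x)) ∂(gm κ) = ∫ x, (∑ u, ∑ k, Vc A B θ u k *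
          (x k * (f' u (lin (Uc A B θ u) x) * ∏ v ∈ Finset.univ.erase u, f v (lin (Uc A B θ v) x)))) ∂(gm κ) :=
    integral_congr_ae (ae_of_all _ fun x => Finset.sum_congr rfl fun u _ => e0 u x)
  refine Eq.trans ?_ e1.symm
  rw [integral_finsetSum _ (fun u _ => integrable_finsetSum _ fun k _ => (c2 u k).const_mul _)]
  rw [Finset.mul_sum]
  apply Finset.sum_congr rfl
  intro u _
  rw [integral_finsetSum _ (fun k _ => (c2 u k).const_mul _)]
  simp_rw [integral_const_mul, key, mul_add, Finset.sum_add_distrib]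
  have z : ∑ k, Vc A B θ u k * (Uc A B θ u k * ∫ x, f'' u (lin (Uc A B θ u) x) *
          ∏ v ∈ Finset.univ.erase u, f v (lin (Uc A B θ v) x) ∂(gm κ)) = 0 := by
    simp_rw [← mul_assoc]
    rw [← Finset.sum_mul, UV_cov A B hAB, hdiag]; simp
  rw [z, zero_add]
  simp_rw [Finset.mul_sum]
  rw [Finset.sum_comm]
  apply Finset.sum_congr rfl
  intro v _
  simp_rw [← mul_assoc]
  rw [← Finset.sum_mul]
  rw [UV_cov A B hAB]

end interp


theorem mp_comp_inj {ι κ : Type*} [Fintype ι] [Fintype κ] (e : ι → κ) (he : Function.Injective e) :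
    MeasurePreserving (fun (x : κ → ℝ) (i : ι) => x (e i)) (gm κ) (gm ι) := by
  refine ⟨by fun_prop, ?_⟩
  have h1 : iIndepFun (fun (j : κ) (x : κ → ℝ) => x j) (gm κ) := by
    have := iIndepFun_pi (ι := κ) (μ := fun _ : κ => gaussianReal 0 1) (X := fun _ x => x)
      (fun i => aemeasurable_id)
    exact this
  have h2 := h1.precomp he
  have h3 := (iIndepFun_iff_map_fun_eq_pi_map (fun i => (measurable_pi_apply (e i)).aemeasurable)).1 h2
  rw [h3]
  unfold gm
  congr 1
  funext i
  exact (mp_eval (e i)).map_eq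

section
set_option linter.unusedSectionVars false
variable {T ι κ : Type} [Fintype T] [DecidableEq T] [Fintype κ] [DecidableEq κ] [Fintype ι] [DecidableEq ι]

theorem lin_elim_inl (a : ι → ℝ) (x : ι ⊕ κ → ℝ) :
    lin (Sum.elim a 0) x = lin a (fun i => x (Sum.inl i)) := by
  simp [lin, Fintype.sum_sum_type]

theorem lin_elim_inr (a : κ → ℝ) (x : ι ⊕ κ → ℝ) :
    lin (Sum.elim 0 a) x = lin a (fun i => x (Sum.inr i)) := by
  simp [lin, Fintype.sum_sum_type]

theorem slepian_smooth (A : T → ι → ℝ) (B : T → κ → ℝ)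
    (hd : ∀ u, ∑ k, A u k * A u k = ∑ k, B u k * B u k)
    (f f' f'' : T → ℝ → ℝ) (C : ℝ)
    (hf : ∀ u x, HasDerivAt (f u) (f' u x) x) (hf' : ∀ u x, HasDerivAt (f' u) (f'' u x) x)
    (hc : ∀ u, Continuous (f'' u)) (b0 : ∀ u x, |f u x| ≤ 1) (b1 : ∀ u x, |f' u x| ≤ C)
    (b2 : ∀ u x, |f'' u x| ≤ C)
    (pos : ∀ u v, u ≠ v → ∀ g : T → ℝ, 0 ≤ (∑ k, A u k * A v k - ∑ k, B u k * B v k) *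
      (f' u (g u) * f' v (g v) * ∏ w ∈ (Finset.univ.erase u).erase v, f w (g w))) :
    ∫ y, ∏ u, f u (lin (B u) y) ∂(gm κ) ≤ ∫ x, ∏ u, f u (lin (A u) x) ∂(gm ι) := by
  have cf : ∀ u, Continuous (f u) := fun u => continuous_iff_continuousAt.2 fun x => (hf u x).continuousAt
  set A' : T → ι ⊕ κ → ℝ := fun u => Sum.elim (A u) 0
  set B' : T → ι ⊕ κ → ℝ := fun u => Sum.elim 0 (B u)
  have hA : ∀ u v, ∑ k, A' u k * A' v k = ∑ k, A u k * A v k := by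
    intro u v; simp [A', Fintype.sum_sum_type]
  have hB : ∀ u v, ∑ k, B' u k * B' v k = ∑ k, B u k * B v k := by
    intro u v; simp [B', Fintype.sum_sum_type]
  have key := interp_deriv A' B' (by intro u v; simp [A', B', Fintype.sum_sum_type])
    (by intro u; rw [hA, hB]; exact hd u) f f' f'' C hf hf' hc b0 b1 b2
  have mono : MonotoneOn (fun θ => ∫ x, ∏ u, f u (lin (Uc A' B' θ u) x) ∂(gm (ι ⊕ κ))) (Set.Icc 0 (π/2)) := by
    apply monotoneOn_of_deriv_nonneg (convex_Icc _ _)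
    · exact fun θ _ => (key θ).continuousAt.continuousWithinAt
    · exact fun θ _ => (key θ).differentiableAt.differentiableWithinAt
    · intro θ hθ
      rw [interior_Icc] at hθ
      rw [(key θ).deriv]
      have h1 := sin_nonneg_of_nonneg_of_le_pi hθ.1.le (by linarith [hθ.2, pi_pos])
      have h2 := cos_nonneg_of_neg_pi_div_two_le_of_le (by linarith [hθ.1, pi_pos]) hθ.2.le
      apply mul_nonneg (mul_nonneg h1 h2)
      refine Finset.sum_nonneg fun u _ => Finset.sum_nonneg fun v hv => ?_
      rw [← integral_const_mul]
      apply integral_nonneg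
      intro x
      rw [hA, hB]
      exact pos u v (Finset.ne_of_mem_erase hv).symm (fun w => lin (Uc A' B' θ w) x)
  have := mono (Set.left_mem_Icc.2 (by positivity)) (Set.right_mem_Icc.2 (by positivity)) (by positivity)
  have e0 : ∀ u, Uc A' B' 0 u = B' u := by intro u; funext k; simp [Uc]
  have e1 : ∀ u, Uc A' B' (π/2) u = A' u := by intro u; funext k; simp [Uc]
  simp only [e0, e1, A', B', lin_elim_inl, lin_elim_inr] at this
  have m1 := mp_comp_inj (Sum.inl : ι → ι ⊕ κ) Sum.inl_injective
  have m2 := mp_comp_inj (Sum.inr : κ → ι ⊕ κ) Sum.inr_injective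
  have cl : ∀ u, Continuous (fun x => lin (A u) x) := fun u => lin_cont _
  have cl' : ∀ u, Continuous (fun x => lin (B u) x) := fun u => lin_cont _
  rw [← m1.map_eq, ← m2.map_eq, integral_map m1.measurable.aemeasurable, integral_map m2.measurable.aemeasurable]
  · exact this
  · exact Continuous.aestronglyMeasurable (by fun_prop)
  · exact Continuous.aestronglyMeasurable (by fun_prop)

theorem sig_bd (x : ℝ) : 0 ≤ sigmoid x ∧ sigmoid x ≤ 1 := ⟨(sigmoid_pos x).le, (sigmoid_lt_one x).le⟩

theorem hasDerivAt_sig (x : ℝ) : HasDerivAt sigmoid (sigmoid x * (1 - sigmoid x)) x := by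
  exact hasDerivAt_sigmoid x

theorem slepian (A : T → ι → ℝ) (B : T → κ → ℝ)
    (hd : ∀ u, ∑ k, A u k * A u k = ∑ k, B u k * B u k)
    (hc : ∀ u v, ∑ k, B u k * B v k ≤ ∑ k, A u k * A v k) (t : T → ℝ) :
    gm κ {y | ∀ u, lin (B u) y ≤ t u} ≤ gm ι {x | ∀ u, lin (A u) x ≤ t u} := by
  set f : ℕ → T → ℝ → ℝ := fun n u x => sigmoid ((n:ℝ)^2 * (t u - x) + n)
  have df : ∀ (n : ℕ) u x, HasDerivAt (fun x => (n:ℝ)^2 * (t u - x) + n) (-(n:ℝ)^2) x := by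
    intro n u x
    have := (((hasDerivAt_id x).const_sub (t u)).const_mul ((n:ℝ)^2)).add_const (n:ℝ)
    simpa using this
  have d1 : ∀ n u x, HasDerivAt (f n u) (-(n:ℝ)^2 * (f n u x * (1 - f n u x))) x := by
    intro n u x
    have := (hasDerivAt_sig ((n:ℝ)^2 * (t u - x) + n)).comp x (df n u x)
    refine HasDerivAt.congr_deriv this ?_
    simp only [f]; ring
  have d2 : ∀ (n : ℕ) u x, HasDerivAt (fun x => -(n:ℝ)^2 * (f n u x * (1 - f n u x)))
      ((n:ℝ)^4 * (f n u x * (1 - f n u x) * (1 - 2 * f n u x))) x := by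
    intro n u x
    have := ((d1 n u x).fun_mul ((d1 n u x).const_sub 1)).const_mul (-(n:ℝ)^2)
    refine HasDerivAt.congr_deriv this ?_
    ring
  have cf : ∀ n u, Continuous (f n u) := fun n u => continuous_iff_continuousAt.2 fun x => (d1 n u x).continuousAt
  have fb : ∀ n u x, 0 ≤ f n u x ∧ f n u x ≤ 1 := fun n u x => sig_bd _
  have fa : ∀ n u x, |f n u x| ≤ 1 := by
    intro n u x; rw [abs_of_nonneg (fb n u x).1]; exact (fb n u x).2
  have step : ∀ n, ∫ y, ∏ u, f n u (lin (B u) y) ∂(gm κ) ≤ ∫ x, ∏ u, f n u (lin (A u) x) ∂(gm ι) := by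
    intro n
    apply slepian_smooth A B hd (f n) _ _ ((n:ℝ)^2 + (n:ℝ)^4) (d1 n) (d2 n)
    · intro u; have := cf n u; fun_prop
    · exact fa n
    · intro u x
      obtain ⟨h0, h1⟩ := fb n u x
      rw [abs_mul, abs_neg, abs_of_nonneg (by positivity), abs_of_nonneg (mul_nonneg h0 (by linarith))]
      have : f n u x * (1 - f n u x) ≤ 1 := by nlinarith
      have h2 : 0 ≤ (n:ℝ)^2 := by positivity
      have h4 : 0 ≤ (n:ℝ)^4 := by positivity
      nlinarith
    · intro u x
      obtain ⟨h0, h1⟩ := fb n u x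
      rw [abs_mul, abs_of_nonneg (by positivity : (0:ℝ) ≤ (n:ℝ)^4)]
      have : |f n u x * (1 - f n u x) * (1 - 2 * f n u x)| ≤ 1 := by
        rw [abs_mul, abs_mul]
        have a1 := fa n u x
        have a2 : |1 - f n u x| ≤ 1 := by rw [abs_le]; constructor <;> linarith
        have a3 : |1 - 2 * f n u x| ≤ 1 := by rw [abs_le]; constructor <;> linarith
        exact mul_le_one₀ (mul_le_one₀ a1 (abs_nonneg _) a2) (abs_nonneg _) a3
      have h2 : 0 ≤ (n:ℝ)^2 := by positivity
      have h4 : 0 ≤ (n:ℝ)^4 := by positivity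
      nlinarith
    · intro u v _ g
      apply mul_nonneg
      · linarith [hc u v]
      · apply mul_nonneg
        · have : ∀ u x, -(n:ℝ)^2 * (f n u x * (1 - f n u x)) ≤ 0 := by
            intro u x
            obtain ⟨h0, h1⟩ := fb n u x
            have : 0 ≤ (n:ℝ)^2 * (f n u x * (1 - f n u x)) := mul_nonneg (by positivity) (mul_nonneg h0 (by linarith))
            linarith
          exact mul_nonneg_of_nonpos_of_nonpos (this _ _) (this _ _)
        · exact Finset.prod_nonneg fun w _ => (fb n w _).1
  have lim1 : ∀ u x, Tendsto (fun n : ℕ => f n u x) atTop (nhds (if x ≤ t u then 1 else 0)) := by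
    intro u x
    split_ifs with h
    · apply tendsto_sigmoid_atTop.comp
      apply tendsto_atTop_mono _ tendsto_natCast_atTop_atTop
      intro n
      have : 0 ≤ (n:ℝ)^2 * (t u - x) := mul_nonneg (by positivity) (by linarith)
      linarith
    · apply tendsto_sigmoid_atBot.comp
      push Not at h
      have e : ∀ n : ℕ, (n:ℝ)^2 * (t u - x) + n = -((n:ℝ) * ((n:ℝ) * (x - t u) - 1)) := by intro n; ring
      simp_rw [e]
      apply tendsto_neg_atTop_atBot.comp
      apply Tendsto.atTop_mul_atTop₀ tendsto_natCast_atTop_atTop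
      apply tendsto_atTop_add_const_right
      exact (tendsto_natCast_atTop_atTop).atTop_mul_const (by linarith)
  have lim2 : ∀ {μ : Type} [Fintype μ] (D : T → μ → ℝ), Tendsto (fun n : ℕ => ∫ y, ∏ u, f n u (lin (D u) y) ∂(gm μ)) atTop
      (nhds ((gm μ {y | ∀ u, lin (D u) y ≤ t u}).toReal)) := by
    intro μ _ D
    have cl : ∀ u, Continuous (fun x => lin (D u) x) := fun u => lin_cont _
    have hm : MeasurableSet {y : μ → ℝ | ∀ u, lin (D u) y ≤ t u} := by
      rw [Set.ofPred_forall]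
      exact MeasurableSet.iInter fun u => measurableSet_le (cl u).measurable measurable_const
    have e : (gm μ {y | ∀ u, lin (D u) y ≤ t u}).toReal
       = ∫ y, (∏ u, if lin (D u) y ≤ t u then (1:ℝ) else 0) ∂(gm μ) := by
      rw [← Measure.real, ← integral_indicator_one hm]
      congr 1
      funext y
      by_cases h : ∀ u, lin (D u) y ≤ t u
      · simp [Set.indicator, h]
      · simp only [Set.indicator, Set.mem_ofPred_eq, h, if_false]
        push Not at h
        obtain ⟨u, hu⟩ := h
        symm
        apply Finset.prod_eq_zero (Finset.mem_univ u)
        simp [hu]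
    rw [e]
    apply tendsto_integral_of_dominated_convergence (fun _ => 1)
    · intro n; exact Continuous.aestronglyMeasurable (by have := cf n; fun_prop)
    · exact integrable_const _
    · intro n; exact ae_of_all _ fun y => prod_abs_le_one _ _ (fun u => fa n u _)
    · exact ae_of_all _ fun y => tendsto_finsetProd _ fun u _ => lim1 u _
  have := le_of_tendsto_of_tendsto' (lim2 B) (lim2 A) step
  exact (ENNReal.toReal_le_toReal (measure_ne_top _ _) (measure_ne_top _ _)).1 this
end


theorem charlin {κ : Type*} [Fintype κ] (c : κ → ℝ) :
    ∫ x, Complex.exp ((lin c x : ℝ) * Complex.I) ∂(gm κ) = Complex.exp (-((∑ k, c k * c k : ℝ) : ℂ) / 2) := by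
  have e : ∀ x : κ → ℝ, Complex.exp ((lin c x : ℝ) * Complex.I) = ∏ k, Complex.exp ((c k : ℂ) * (x k : ℂ) * Complex.I) := by
    intro x
    rw [← Complex.exp_sum, lin]
    push_cast
    rw [Finset.sum_mul]
  simp_rw [e]
  unfold gm
  rw [integral_fintype_prod_eq_prod (f := fun k (t : ℝ) => Complex.exp ((c k : ℂ) * (t : ℂ) * Complex.I))]
  have e2 : ∀ k, ∫ t : ℝ, Complex.exp ((c k : ℂ) * (t : ℂ) * Complex.I) ∂(gaussianReal 0 1)
      = Complex.exp (-((c k * c k : ℝ) : ℂ) / 2) := by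
    intro k
    rw [← charFun_apply_real, charFun_gaussianReal]
    congr 1
    push_cast; ring_nf
  simp_rw [e2]
  rw [← Complex.exp_sum]
  congr 1
  push_cast
  rw [← Finset.sum_div, Finset.sum_neg_distrib]

theorem gram_law {T : Type*} [Fintype T] [DecidableEq T] {ι κ : Type*} [Fintype ι] [Fintype κ]
    (a : T → ι → ℝ) (b : T → κ → ℝ) (hab : ∀ u v, ∑ k, a u k * a v k = ∑ k, b u k * b v k) :
    (gm ι).map (fun x u => lin (a u) x) = (gm κ).map (fun y u => lin (b u) y) := by
  have ma : Measurable (fun (x : ι → ℝ) u => lin (a u) x) :=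
    measurable_pi_iff.2 fun u => (lin_cont _).measurable
  have mb : Measurable (fun (x : κ → ℝ) u => lin (b u) x) :=
    measurable_pi_iff.2 fun u => (lin_cont _).measurable
  have : IsProbabilityMeasure ((gm ι).map (fun x u => lin (a u) x)) :=
    Measure.isProbabilityMeasure_map ma.aemeasurable
  have : IsProbabilityMeasure ((gm κ).map (fun x u => lin (b u) x)) :=
    Measure.isProbabilityMeasure_map mb.aemeasurable
  apply Measure.ext_of_charFunDual
  funext L
  have key : ∀ {μ : Type _} [Fintype μ] (d : T → μ → ℝ) (x : μ → ℝ), L (fun u => lin (d u) x)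
      = lin (fun k => ∑ u, L (Pi.single u 1) * d u k) x := by
    intro μ _ d x
    have : (fun u => lin (d u) x) = ∑ u, (lin (d u) x) • (Pi.single u 1 : T → ℝ) := by
      funext v
      simp [Finset.sum_apply, Pi.single_apply]
    rw [this, map_sum]
    simp only [map_smul, smul_eq_mul, lin, Finset.sum_mul]
    rw [Finset.sum_comm]
    apply Finset.sum_congr rfl; intro k _
    apply Finset.sum_congr rfl; intro u _
    ring
  have key' : ∀ (x : ι → ℝ), L (fun u => lin (a u) x)
      = lin (fun k => ∑ u, L (Pi.single u 1) * a u k) x := key a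
  have key'' : ∀ (x : κ → ℝ), L (fun u => lin (b u) x)
      = lin (fun k => ∑ u, L (Pi.single u 1) * b u k) x := by
    intro x
    have : (fun u => lin (b u) x) = ∑ u, (lin (b u) x) • (Pi.single u 1 : T → ℝ) := by
      funext v
      simp [Finset.sum_apply, Pi.single_apply]
    rw [this, map_sum]
    simp only [map_smul, smul_eq_mul, lin, Finset.sum_mul]
    rw [Finset.sum_comm]
    apply Finset.sum_congr rfl; intro k _
    apply Finset.sum_congr rfl; intro u _
    ring
  rw [charFunDual_apply, charFunDual_apply, integral_map ma.aemeasurable, integral_map mb.aemeasurable]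
  · simp_rw [key', key'', charlin]
    have q2 : ∀ {μ : Type _} [Fintype μ] (d : T → μ → ℝ) (l : T → ℝ),
        ∑ k, (∑ u, l u * d u k) * (∑ u, l u * d u k) = ∑ u, ∑ v, l u * l v * ∑ k, d u k * d v k := by
      intro μ _ d l
      simp_rw [Finset.sum_mul_sum, Finset.mul_sum]
      rw [Finset.sum_comm]
      apply Finset.sum_congr rfl; intro u _
      rw [Finset.sum_comm]
      apply Finset.sum_congr rfl; intro v _
      apply Finset.sum_congr rfl; intro k _
      ring
    have q3 := q2 a (fun u => L (Pi.single u 1))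
    have q4 : ∑ k, (∑ u, L (Pi.single u 1) * b u k) * (∑ u, L (Pi.single u 1) * b u k)
       = ∑ u, ∑ v, L (Pi.single u 1) * L (Pi.single v 1) * ∑ k, b u k * b v k := by
      simp_rw [Finset.sum_mul_sum, Finset.mul_sum]
      rw [Finset.sum_comm]
      apply Finset.sum_congr rfl; intro u _
      rw [Finset.sum_comm]
      apply Finset.sum_congr rfl; intro v _
      apply Finset.sum_congr rfl; intro k _
      ring
    rw [q3, q4]
    simp_rw [hab]
  · exact Continuous.aestronglyMeasurable (by fun_prop)
  · exact Continuous.aestronglyMeasurable (by fun_prop)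

theorem gram_int {T : Type*} [Fintype T] [DecidableEq T] {ι κ : Type*} [Fintype ι] [Fintype κ]
    (a : T → ι → ℝ) (b : T → κ → ℝ) (hab : ∀ u v, ∑ k, a u k * a v k = ∑ k, b u k * b v k)
    (F : (T → ℝ) → ℝ) (hF : Continuous F) :
    ∫ x, F (fun u => lin (a u) x) ∂(gm ι) = ∫ x, F (fun u => lin (b u) x) ∂(gm κ) := by
  have ma : Measurable (fun (x : ι → ℝ) u => lin (a u) x) :=
    measurable_pi_iff.2 fun u => (lin_cont _).measurable
  have mb : Measurable (fun (x : κ → ℝ) u => lin (b u) x) :=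
    measurable_pi_iff.2 fun u => (lin_cont _).measurable
  rw [← integral_map ma.aemeasurable hF.aestronglyMeasurable, gram_law a b hab,
    integral_map mb.aemeasurable hF.aestronglyMeasurable]

/-- one linear functional -/
theorem lin_int {ι : Type*} [Fintype ι] (a : ι → ℝ) (σ : ℝ) (ha : ∑ k, a k * a k = σ * σ)
    (F : ℝ → ℝ) (hF : Continuous F) :
    ∫ x, F (lin a x) ∂(gm ι) = ∫ z, F (σ * z) ∂(gaussianReal 0 1) := by
  have := gram_int (T := Unit) (ι := ι) (κ := Unit) (fun _ => a) (fun _ _ => σ) (by simp [ha])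
    (fun y => F (y ())) (by fun_prop)
  rw [this]
  have m := mp_eval (ι := Unit) ()
  rw [← m.map_eq, integral_map m.measurable.aemeasurable]
  · simp [lin]
  · exact Continuous.aestronglyMeasurable (by fun_prop)

theorem coord_mul_int {ι : Type*} [Fintype ι] (i j : ι) : Integrable (fun x : ι → ℝ => x i * x j) (gm ι) :=
  (coord_memLp i 2 (by simp)).integrable_mul (coord_memLp j 2 (by simp))

theorem coord_cov {ι : Type*} [Fintype ι] [DecidableEq ι] (i j : ι) :
    ∫ x, x i * x j ∂(gm ι) = if i = j then 1 else 0 := by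
  rw [ibp i (fun x => x j) (fun _ => if i = j then 1 else 0) _ (coord_integrable j) (coord_mul_int i j) (integrable_const _)]
  · simp
  · intro x
    by_cases h : i = j
    · subst h; simpa using hasDerivAt_id' (x i)
    · simpa [h, Ne.symm h] using hasDerivAt_const (x i) (x j)

theorem lin_mul_int {ι : Type*} [Fintype ι] (a b : ι → ℝ) : Integrable (fun x => lin a x * lin b x) (gm ι) := by
  simp_rw [lin, Finset.sum_mul_sum]
  refine integrable_finsetSum _ fun i _ => integrable_finsetSum _ fun j _ => ?_
  refine ((coord_mul_int i j).const_mul (a i * b j)).congr (ae_of_all _ fun x => ?_)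
  simp only; ring

theorem lin_cov {ι : Type*} [Fintype ι] [DecidableEq ι] (a b : ι → ℝ) :
    ∫ x, lin a x * lin b x ∂(gm ι) = ∑ k, a k * b k := by
  have e : ∀ x : ι → ℝ, lin a x * lin b x = ∑ i, ∑ j, a i * b j * (x i * x j) := by
    intro x
    simp_rw [lin, Finset.sum_mul_sum]
    apply Finset.sum_congr rfl; intro u _
    apply Finset.sum_congr rfl; intro v _
    ring
  simp_rw [e]
  rw [integral_finsetSum _ fun i _ => integrable_finsetSum _ fun j _ => (coord_mul_int i j).const_mul _]
  apply Finset.sum_congr rfl; intro i _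
  rw [integral_finsetSum _ fun j _ => (coord_mul_int i j).const_mul _]
  simp_rw [integral_const_mul, coord_cov]
  simp

theorem lin_integrable {ι : Type*} [Fintype ι] (a : ι → ℝ) : Integrable (fun x => lin a x) (gm ι) := by
  unfold lin
  exact integrable_finsetSum _ fun i _ => (coord_integrable i).const_mul _

theorem lin_mean {ι : Type*} [Fintype ι] (a : ι → ℝ) : ∫ x, lin a x ∂(gm ι) = 0 := by
  unfold lin
  rw [integral_finsetSum _ fun i _ => (coord_integrable i).const_mul _]
  apply Finset.sum_eq_zero; intro i _
  rw [integral_const_mul]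
  have m := mp_eval (ι := ι) i
  have : ∫ x, x i ∂(gm ι) = ∫ t, t ∂(gaussianReal 0 1) := by
    conv_rhs => rw [← m.map_eq]
    rw [integral_map m.measurable.aemeasurable (f := fun t => t) continuous_id.aestronglyMeasurable]
  rw [this]
  simp

/-! tanh -/
theorem hasDerivAt_tanh' (x : ℝ) : HasDerivAt tanh (1 - tanh x ^ 2) x := by
  have h := (hasDerivAt_sinh x).div (hasDerivAt_cosh x) (cosh_pos x).ne'
  have e : tanh = fun x => sinh x / cosh x := by funext x; exact tanh_eq_sinh_div_cosh x
  rw [e]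
  refine HasDerivAt.congr_deriv h ?_
  have := (cosh_pos x).ne'
  field_simp

theorem tanh_sq_lt (x : ℝ) : tanh x ^ 2 < 1 := by
  rw [tanh_eq_sinh_div_cosh, div_pow, div_lt_one (by have := cosh_pos x; positivity)]
  have := cosh_sq x; linarith

theorem sech_sq (x : ℝ) : (cosh x)⁻¹ ^ 2 = 1 - tanh x ^ 2 := by
  rw [tanh_eq_sinh_div_cosh, div_pow]
  have := cosh_sq x
  have := (cosh_pos x).ne'
  field_simp; linarith

theorem tanh_cont : Continuous tanh := continuous_iff_continuousAt.2 fun x => (hasDerivAt_tanh' x).continuousAt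

theorem tanh_strictMono : StrictMono tanh := by
  apply strictMono_of_deriv_pos
  intro x
  rw [(hasDerivAt_tanh' x).deriv]
  linarith [tanh_sq_lt x]

theorem tanh_abs (x : ℝ) : |tanh x| ≤ 1 := by
  rw [← sq_le_one_iff_abs_le_one]; exact (tanh_sq_lt x).le

/-- `f(x) = tanh(h + βx)` -/
def tf (β h x : ℝ) : ℝ := tanh (h + β * x)

theorem tf_cont (β h : ℝ) : Continuous (tf β h) := by
  unfold tf; exact tanh_cont.comp (by fun_prop)

theorem tf_deriv (β h x : ℝ) : HasDerivAt (tf β h) (β * (1 - tf β h x ^ 2)) x := by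
  have h1 : HasDerivAt (fun x => h + β * x) β x := by
    simpa using ((hasDerivAt_id x).const_mul β).const_add h
  refine HasDerivAt.congr_deriv ((hasDerivAt_tanh' (h + β * x)).comp x h1) ?_
  simp only [tf]; ring

theorem tf_sq (β h x : ℝ) : tf β h x ^ 2 < 1 := tanh_sq_lt _
theorem tf_abs (β h x : ℝ) : |tf β h x| ≤ 1 := tanh_abs _

theorem tf_deriv2 (β h x : ℝ) : HasDerivAt (fun x => β * (1 - tf β h x ^ 2))
    (-2 * β ^ 2 * tf β h x * (1 - tf β h x ^ 2)) x := by
  have := (((tf_deriv β h x).fun_pow 2).const_sub 1).const_mul β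
  refine HasDerivAt.congr_deriv this ?_
  simp; ring

theorem tf_inj (β h : ℝ) (hβ : 0 < β) : Function.Injective (tf β h) := by
  intro x y hxy
  have := tanh_strictMono.injective hxy
  have : β * x = β * y := by linarith
  exact mul_left_cancel₀ hβ.ne' this

theorem tf_bd1 (β h x : ℝ) (hβ : 0 < β) : |β * (1 - tf β h x ^ 2)| ≤ β := by
  have := tf_sq β h x
  rw [abs_of_nonneg (mul_nonneg hβ.le (by linarith))]
  nlinarith [sq_nonneg (tf β h x)]

theorem tf_lip (β h : ℝ) (hβ : 0 < β) (x y : ℝ) : |tf β h x - tf β h y| ≤ β * |x - y| := by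
  have := Convex.norm_image_sub_le_of_norm_hasDerivWithin_le (f := tf β h) (s := Set.univ) (C := β)
    (f' := fun x => β * (1 - tf β h x ^ 2)) (x := y) (y := x)
    (fun x _ => (tf_deriv β h x).hasDerivWithinAt) (fun x _ => tf_bd1 β h x hβ) convex_univ trivial trivial
  exact this


theorem mp_three : MeasurePreserving (fun p : ℝ × ℝ × ℝ => (![p.1, p.2.1, p.2.2] : Fin 3 → ℝ))
    ((gaussianReal 0 1).prod ((gaussianReal 0 1).prod (gaussianReal 0 1))) (gm (Fin 3)) := by
  have hm : Measurable (fun p : ℝ × ℝ × ℝ => (![p.1, p.2.1, p.2.2] : Fin 3 → ℝ)) := by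
    rw [measurable_pi_iff]; intro i; fin_cases i <;> simp <;> fun_prop
  refine ⟨hm, ?_⟩
  unfold gm
  symm
  apply Measure.pi_eq
  intro s hs
  rw [Measure.map_apply hm (MeasurableSet.univ_pi hs)]
  have : (fun p : ℝ × ℝ × ℝ => (![p.1, p.2.1, p.2.2] : Fin 3 → ℝ)) ⁻¹' (Set.univ.pi s)
      = s 0 ×ˢ (s 1 ×ˢ s 2) := by
    ext p
    simp [Set.mem_pi, Fin.forall_fin_succ]
  rw [this, Measure.prod_prod, Measure.prod_prod, Fin.prod_univ_three, mul_assoc]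

theorem psi_gm (β h q t : ℝ) : psiFun β h q t =
    ∫ x, tf β h (√t * x 0 + √(q - t) * x 1) * tf β h (√t * x 0 + √(q - t) * x 2) ∂(gm (Fin 3)) := by
  have m := mp_three
  have c := tf_cont β h
  rw [← m.map_eq, integral_map m.measurable.aemeasurable (Continuous.aestronglyMeasurable (by fun_prop))]
  unfold psiFun
  have hb : Integrable (fun p : ℝ × ℝ × ℝ => tf β h (√t * p.1 + √(q - t) * p.2.1) * tf β h (√t * p.1 + √(q - t) * p.2.2))
      ((gaussianReal 0 1).prod ((gaussianReal 0 1).prod (gaussianReal 0 1))) := by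
    refine Integrable.of_bound (Continuous.aestronglyMeasurable (by fun_prop)) 1 (ae_of_all _ fun p => ?_)
    rw [norm_mul]
    exact mul_le_one₀ (tf_abs _ _ _) (norm_nonneg _) (tf_abs _ _ _)
  simp only [Matrix.cons_val_zero, Matrix.cons_val_one, Matrix.cons_val]
  rw [integral_prod _ hb]
  congr 1; funext z
  rw [integral_prod]
  · congr 1; funext z'
    congr 1; funext z''
    simp only [tf]
    congr 1 <;> congr 1 <;> ring
  · refine Integrable.of_bound (Continuous.aestronglyMeasurable (by fun_prop)) 1 (ae_of_all _ fun p => ?_)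
    rw [norm_mul]
    exact mul_le_one₀ (tf_abs _ _ _) (norm_nonneg _) (tf_abs _ _ _)

theorem psi_nonneg (β h q t : ℝ) : 0 ≤ psiFun β h q t := by
  unfold psiFun
  apply integral_nonneg
  intro z
  simp_rw [integral_const_mul, integral_mul_const]
  exact mul_self_nonneg _

/-- the law lemma for two correlated Gaussians -/
theorem psi_law {κ : Type*} [Fintype κ] (β h q t : ℝ) (h0 : 0 ≤ t) (h1 : t ≤ q) (a b : κ → ℝ)
    (ha : ∑ k, a k * a k = q) (hb : ∑ k, b k * b k = q) (hab : ∑ k, a k * b k = t) :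
    ∫ x, tf β h (lin a x) * tf β h (lin b x) ∂(gm κ) = psiFun β h q t := by
  have c := tf_cont β h
  have hba : ∑ k, b k * a k = t := by rw [← hab]; apply Finset.sum_congr rfl; intro k _; ring
  have := gram_int (T := Fin 2) ![a, b] ![![√t, √(q-t), 0], ![√t, 0, √(q-t)]] ?_
    (fun y => tf β h (y 0) * tf β h (y 1)) (by fun_prop)
  · simp only [Matrix.cons_val_zero, Matrix.cons_val_one] at this
    rw [this, psi_gm]
    congr 1; funext x
    simp [lin, Fin.sum_univ_three]
  · have e1 : √t * √t = t := mul_self_sqrt h0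
    have e2 : √(q-t) * √(q-t) = q - t := mul_self_sqrt (by linarith)
    intro u v
    fin_cases u <;> fin_cases v <;> simp [Fin.sum_univ_three, ha, hb, hab, hba, e1, e2]

theorem one_law {κ : Type*} [Fintype κ] (q : ℝ) (h0 : 0 ≤ q) (a : κ → ℝ) (ha : ∑ k, a k * a k = q)
    (F : ℝ → ℝ) (hF : Continuous F) : ∫ x, F (lin a x) ∂(gm κ) = ∫ z, F (√q * z) ∂(gaussianReal 0 1) :=
  lin_int a (√q) (by rw [ha, mul_self_sqrt h0]) F hF

/-- `E F(√q Z)` -/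
def E1 (q : ℝ) (F : ℝ → ℝ) : ℝ := ∫ z, F (√q * z) ∂(gaussianReal 0 1)

theorem q_eq {β h q : ℝ} (hq : isFixedq β h q) : E1 q (fun x => tf β h x ^ 2) = q := by
  conv_rhs => rw [hq.2.2]
  unfold E1 qtanh tf
  congr 1; funext z; ring_nf

theorem gamma1_eq (β h q : ℝ) : gamma1 β h q = E1 q (tf β h) := by
  unfold E1 gamma1 tf
  congr 1; funext z; ring_nf

theorem B_eq (β h q : ℝ) : (∫ z, (Real.cosh (h + β * Real.sqrt q * z))⁻¹ ^ 4 ∂(gaussianReal 0 1))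
    = E1 q (fun x => (1 - tf β h x ^ 2) ^ 2) := by
  unfold E1 tf
  congr 1; funext z
  simp only
  rw [← sech_sq, ← pow_mul]; ring_nf

theorem AT_eq {β h q : ℝ} (hAT : ATcond β h q) : β ^ 2 * E1 q (fun x => (1 - tf β h x ^ 2) ^ 2) < 1 := by
  rw [← B_eq]; exact hAT

theorem gamma1_nonneg (β h q : ℝ) (hh : 0 < h) : 0 ≤ gamma1 β h q := by
  rw [gamma1_eq]
  unfold E1
  have c := tf_cont β h
  have hIntg : Integrable (fun z => tf β h (√q * z)) (gaussianReal 0 1) :=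
    Integrable.of_bound (Continuous.aestronglyMeasurable (by fun_prop)) 1 (ae_of_all _ fun p => tf_abs _ _ _)
  have hIntg' : Integrable (fun z => tf β h (√q * -z)) (gaussianReal 0 1) :=
    Integrable.of_bound (Continuous.aestronglyMeasurable (by fun_prop)) 1 (ae_of_all _ fun p => tf_abs _ _ _)
  have sym : ∫ z, tf β h (√q * z) ∂(gaussianReal 0 1) = ∫ z, tf β h (√q * -z) ∂(gaussianReal 0 1) := by
    have : (gaussianReal 0 1).map (fun z => -z) = gaussianReal 0 1 := by
      rw [gaussianReal_map_neg]; simp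
    conv_lhs => rw [← this]
    rw [integral_map (by fun_prop) (Continuous.aestronglyMeasurable (by fun_prop))]
  have : 0 ≤ ∫ z, (tf β h (√q * z) + tf β h (√q * -z)) ∂(gaussianReal 0 1) := by
    apply integral_nonneg
    intro z
    simp only [Pi.zero_apply, tf]
    have : tanh (h + β * (√q * -z)) = - tanh (-h + β * (√q * z)) := by
      rw [← tanh_neg]; congr 1; ring
    rw [this]
    have : tanh (-h + β * (√q * z)) ≤ tanh (h + β * (√q * z)) := tanh_strictMono.monotone (by linarith)
    linarith
  rw [integral_add hIntg hIntg', ← sym] at this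
  linarith

theorem psi_diff {β h q : ℝ} (hβ : 0 < β) (hq : isFixedq β h q) (t : ℝ) (h0 : 0 ≤ t) (h1 : t < q) :
    psiFun β h q t < q ∧
      q - psiFun β h q t ≤ (β ^ 2 * E1 q (fun x => (1 - tf β h x ^ 2) ^ 2)) * (q - t) := by
  have c := tf_cont β h
  have hq0 := hq.1
  set X : Fin 3 → ℝ := ![√t, √(q-t), 0]
  set Y : Fin 3 → ℝ := ![√t, 0, √(q-t)]
  have e1 : √t * √t = t := mul_self_sqrt h0
  have e2 : √(q-t) * √(q-t) = q - t := mul_self_sqrt (by linarith)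
  have hX : ∑ k, X k * X k = q := by simp [X, Fin.sum_univ_three, e1, e2]
  have hY : ∑ k, Y k * Y k = q := by simp [Y, Fin.sum_univ_three, e1, e2]
  have hXY : ∑ k, X k * Y k = t := by simp [X, Y, Fin.sum_univ_three, e1]
  have cX := lin_cont X
  have cY := lin_cont Y
  constructor
  · have hp := psi_law β h q t h0 h1.le X Y hX hY hXY
    have sqX : ∫ x, tf β h (lin X x) ^ 2 ∂(gm (Fin 3)) = q := by
      rw [one_law q hq0.le X hX (fun x => tf β h x ^ 2) (by fun_prop)]; exact q_eq hq
    have sqY : ∫ x, tf β h (lin Y x) ^ 2 ∂(gm (Fin 3)) = q := by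
      rw [one_law q hq0.le Y hY (fun x => tf β h x ^ 2) (by fun_prop)]; exact q_eq hq
    have bX : ∀ x, |tf β h (lin X x) ^ 2| ≤ 1 := fun x => by rw [abs_pow]; exact pow_le_one₀ (abs_nonneg _) (tf_abs _ _ _)
    have bY : ∀ x, |tf β h (lin Y x) ^ 2| ≤ 1 := fun x => by rw [abs_pow]; exact pow_le_one₀ (abs_nonneg _) (tf_abs _ _ _)
    have iX := bdd_integrable (fun x => tf β h (lin X x) ^ 2) (by fun_prop) 1 bX
    have iY := bdd_integrable (fun x => tf β h (lin Y x) ^ 2) (by fun_prop) 1 bY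
    have iXY := bdd_integrable (fun x => tf β h (lin X x) * tf β h (lin Y x)) (by fun_prop) 1
      (fun x => by rw [abs_mul]; exact mul_le_one₀ (tf_abs _ _ _) (abs_nonneg _) (tf_abs _ _ _))
    have key : ∫ x, (tf β h (lin X x) - tf β h (lin Y x)) ^ 2 ∂(gm (Fin 3)) = 2 * (q - psiFun β h q t) := by
      have : ∀ x, (tf β h (lin X x) - tf β h (lin Y x)) ^ 2 = tf β h (lin X x) ^ 2 + tf β h (lin Y x) ^ 2
        - 2 * (tf β h (lin X x) * tf β h (lin Y x)) := by intro x; ring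
      simp_rw [this]
      rw [integral_sub (f := fun x => tf β h (lin X x) ^ 2 + tf β h (lin Y x) ^ 2) (iX.add iY) (iXY.const_mul 2), integral_add iX iY, integral_const_mul, sqX, sqY, hp]
      ring
    have hIntg : Integrable (fun x => (tf β h (lin X x) - tf β h (lin Y x)) ^ 2) (gm (Fin 3)) := by
      refine ((iX.add iY).sub (iXY.const_mul 2)).congr (ae_of_all _ fun x => ?_)
      simp only [Pi.sub_apply, Pi.add_apply]; ring
    by_contra hcon
    push Not at hcon
    have hz : ∫ x, (tf β h (lin X x) - tf β h (lin Y x)) ^ 2 ∂(gm (Fin 3)) = 0 :=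
      le_antisymm (by rw [key]; linarith) (integral_nonneg fun x => sq_nonneg _)
    rw [integral_eq_zero_iff_of_nonneg (fun x => sq_nonneg _) hIntg] at hz
    have hz2 : ∫ x, (lin (X - Y) x * lin (X - Y) x) ∂(gm (Fin 3)) = 0 := by
      rw [← integral_zero (Fin 3 → ℝ) ℝ (μ := gm (Fin 3))]
      apply integral_congr_ae
      filter_upwards [hz] with x hx
      simp only [Pi.zero_apply] at hx
      have := tf_inj β h hβ (sub_eq_zero.1 (pow_eq_zero_iff (two_ne_zero) |>.1 hx))
      have : lin (X - Y) x = 0 := by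
        have : lin (X - Y) x = lin X x - lin Y x := by
          simp only [lin, Pi.sub_apply, sub_mul, Finset.sum_sub_distrib]
        rw [this]; linarith
      rw [this]; simp
    rw [lin_cov] at hz2
    have : ∑ k, (X - Y) k * (X - Y) k = 2 * (q - t) := by
      simp [X, Y, Fin.sum_univ_three, e2]; ring
    linarith
  · set θ0 := β ^ 2 * E1 q (fun x => (1 - tf β h x ^ 2) ^ 2) with hθ0
    set B : Fin 2 → Fin 4 → ℝ := ![![√t, √(q-t), 0, 0], ![√t, 0, √(q-t), 0]]
    set A : Fin 2 → Fin 4 → ℝ := fun _ => ![0, 0, 0, √q]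
    have e3 : √q * √q = q := mul_self_sqrt hq0.le
    have hAA : ∀ u v, ∑ k, A u k * A v k = q := by intro u v; simp [A, Fin.sum_univ_four, e3]
    have hBd : ∀ u, ∑ k, B u k * B u k = q := by
      intro u; fin_cases u <;> simp [B, Fin.sum_univ_four, e1, e2]
    have hB01 : ∑ k, B 0 k * B 1 k = t := by simp [B, Fin.sum_univ_four, e1]
    have hB10 : ∑ k, B 1 k * B 0 k = t := by simp [B, Fin.sum_univ_four, e1]
    have hAB : ∀ u v, ∑ k, A u k * B v k = 0 := by
      intro u v; fin_cases v <;> simp [A, B, Fin.sum_univ_four]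
    have key := interp_deriv A B hAB (fun u => (hAA u u).trans (hBd u).symm)
      (fun _ => tf β h) (fun _ x => β * (1 - tf β h x ^ 2)) (fun _ x => -2 * β ^ 2 * tf β h x * (1 - tf β h x ^ 2))
      (β + 2 * β ^ 2) (fun _ => tf_deriv β h) (fun _ => tf_deriv2 β h) (fun _ => by fun_prop) (fun _ => tf_abs β h)
      (fun _ x => (tf_bd1 β h x hβ).trans (by nlinarith [sq_nonneg β])) (fun _ x => by
        have a1 := tf_abs β h x
        have a2 : |1 - tf β h x ^ 2| ≤ 1 := by
          have := tf_sq β h x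
          rw [abs_le]; constructor <;> nlinarith [sq_nonneg (tf β h x)]
        rw [mul_assoc, abs_mul, abs_mul (tf β h x)]
        have : |-2 * β ^ 2| = 2 * β ^ 2 := by rw [abs_mul]; simp
        rw [this]
        have := mul_le_one₀ a1 (abs_nonneg _) a2
        nlinarith [sq_nonneg β])
    have hU : ∀ θ u, ∑ k, Uc A B θ u k * Uc A B θ u k = q := by
      intro θ u
      have : ∀ k, Uc A B θ u k * Uc A B θ u k = cos θ ^ 2 * (B u k * B u k) + sin θ ^ 2 * (A u k * A u k)
        + 2 * sin θ * cos θ * (A u k * B u k) := by intro k; simp only [Uc]; ring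
      simp_rw [this, Finset.sum_add_distrib, ← Finset.mul_sum, hAA, hBd, hAB]
      have := cos_sq_add_sin_sq θ
      linear_combination q * this
    set φ := fun θ => ∫ x, ∏ u : Fin 2, tf β h (lin (Uc A B θ u) x) ∂(gm (Fin 4)) with hφ
    have cU : ∀ θ u, Continuous (fun x => lin (Uc A B θ u) x) := fun θ u => lin_cont _
    have dle : ∀ θ ∈ Set.Ioo 0 (π/2), ∃ d, HasDerivAt φ d θ ∧ d ≤ 2 * sin θ * cos θ * ((q - t) * θ0) := by
      intro θ hθ
      refine ⟨_, key θ, ?_⟩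
      have u0 : (Finset.univ : Finset (Fin 2)).erase 0 = {1} := by decide
      have u1 : (Finset.univ : Finset (Fin 2)).erase 1 = {0} := by decide
      rw [Fin.sum_univ_two, u0, u1, Finset.sum_singleton, Finset.sum_singleton, hAA 0 1, hB01, hB10]
      simp only [Finset.erase_singleton, Finset.prod_empty, mul_one]
      have hs := sin_nonneg_of_nonneg_of_le_pi hθ.1.le (by linarith [hθ.2, pi_pos])
      have hc := cos_nonneg_of_neg_pi_div_two_le_of_le (by linarith [hθ.1, pi_pos]) hθ.2.le
      have Ile : ∀ u v, ∫ x, β * (1 - tf β h (lin (Uc A B θ u) x) ^ 2) * (β * (1 - tf β h (lin (Uc A B θ v) x) ^ 2)) ∂(gm (Fin 4)) ≤ θ0 := by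
        intro u v
        have cu := cU θ u
        have cv := cU θ v
        have one : ∀ u, ∫ x, (β * (1 - tf β h (lin (Uc A B θ u) x) ^ 2)) ^ 2 ∂(gm (Fin 4)) = θ0 := by
          intro u
          rw [one_law q hq0.le _ (hU θ u) (fun x => (β * (1 - tf β h x ^ 2)) ^ 2) (by fun_prop), hθ0, E1, ← integral_const_mul]
          congr 1; funext z; ring
        have i2 : ∀ u, Integrable (fun x => (β * (1 - tf β h (lin (Uc A B θ u) x) ^ 2)) ^ 2) (gm (Fin 4)) := by
          intro u
          have cu := cU θ u
          apply bdd_integrable _ (by fun_prop) (β ^ 2)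
          intro x; rw [abs_pow]; exact pow_le_pow_left₀ (abs_nonneg _) (tf_bd1 _ _ _ hβ) 2
        calc _ ≤ ∫ x, (1/2 * (β * (1 - tf β h (lin (Uc A B θ u) x) ^ 2)) ^ 2
              + 1/2 * (β * (1 - tf β h (lin (Uc A B θ v) x) ^ 2)) ^ 2) ∂(gm (Fin 4)) := by
              apply integral_mono
              · apply bdd_integrable _ (by fun_prop) (β * β)
                intro x; rw [abs_mul]; exact mul_le_mul (tf_bd1 _ _ _ hβ) (tf_bd1 _ _ _ hβ) (abs_nonneg _) hβ.le
              · exact ((i2 u).const_mul _).add ((i2 v).const_mul _)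
              · intro x
                simp only
                nlinarith [sq_nonneg (β * (1 - tf β h (lin (Uc A B θ u) x) ^ 2) - β * (1 - tf β h (lin (Uc A B θ v) x) ^ 2))]
          _ = θ0 := by
              rw [integral_add ((i2 u).const_mul _) ((i2 v).const_mul _), integral_const_mul, integral_const_mul, one, one]
              ring
      have t1 := Ile 0 1
      have t2 := Ile 1 0
      have hsc := mul_nonneg hs hc
      have hqt : 0 ≤ q - t := by linarith
      calc _ ≤ sin θ * cos θ * ((q - t) * θ0 + (q - t) * θ0) := by gcongr
        _ = _ := by ring
    have anti : AntitoneOn (fun θ => φ θ - (q - t) * θ0 * sin θ ^ 2) (Set.Icc 0 (π/2)) := by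
      have dd : ∀ θ, HasDerivAt (fun θ => (q - t) * θ0 * sin θ ^ 2) ((q - t) * θ0 * (2 * sin θ * cos θ)) θ := by
        intro θ
        have := ((hasDerivAt_sin θ).fun_pow 2).const_mul ((q - t) * θ0)
        simpa using this
      have dφ : ∀ θ, DifferentiableAt ℝ φ θ := fun θ => (key θ).differentiableAt
      apply antitoneOn_of_deriv_nonpos (convex_Icc _ _)
      · exact fun θ _ => ((dφ θ).continuousAt.sub (dd θ).continuousAt).continuousWithinAt
      · exact fun θ _ => ((dφ θ).sub (dd θ).differentiableAt).differentiableWithinAt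
      · intro θ hθ
        rw [interior_Icc] at hθ
        obtain ⟨d, hd, hle⟩ := dle θ hθ
        rw [(hd.fun_sub (dd θ)).deriv]
        nlinarith
    have fin := anti (Set.left_mem_Icc.2 (by positivity)) (Set.right_mem_Icc.2 (by positivity)) (by positivity)
    simp only [sin_pi_div_two, sin_zero] at fin
    have f0 : φ 0 = psiFun β h q t := by
      rw [hφ]
      simp only [Fin.prod_univ_two]
      apply psi_law β h q t h0 h1.le
      · exact hU 0 0
      · exact hU 0 1
      · simp [Uc, hB01]
    have f1 : φ (π/2) = q := by
      rw [hφ]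
      simp only [Fin.prod_univ_two]
      have : ∀ u, Uc A B (π/2) u = A 0 := by intro u; funext k; simp [Uc, A]
      simp_rw [this, ← sq]
      rw [one_law q hq0.le _ (hAA 0 0) (fun x => tf β h x ^ 2) (by fun_prop)]
      exact q_eq hq
    rw [f0, f1] at fin
    linarith


def al (β h q : ℝ) (k : ℕ) : ℝ := (boltSeq β h q k).1
def ga (β h q : ℝ) (k : ℕ) : ℝ := (boltSeq β h q k).2.1
def Gs (β h q : ℝ) (k : ℕ) : ℝ := GammaSq β h q k
def de (β h q : ℝ) (k : ℕ) : ℝ := q - Gs β h q k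

theorem Gs_zero (β h q : ℝ) : Gs β h q 0 = 0 := by simp [Gs, GammaSq]
theorem Gs_succ (β h q : ℝ) (k : ℕ) : Gs β h q (k+1) = Gs β h q k + ga β h q k ^ 2 := by
  cases k with
  | zero => simp [Gs, GammaSq, ga, boltSeq]
  | succ k => simp [Gs, GammaSq, ga, boltSeq]
theorem de_zero (β h q : ℝ) : de β h q 0 = q := by simp [de, Gs_zero]
theorem de_succ (β h q : ℝ) (k : ℕ) : de β h q (k+1) = de β h q k - ga β h q k ^ 2 := by
  simp only [de, Gs_succ]; ring
theorem Gs_sum (β h q : ℝ) (k : ℕ) : Gs β h q k = ∑ j ∈ Finset.range k, ga β h q j ^ 2 := by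
  induction k with
  | zero => simp [Gs_zero]
  | succ k ih => rw [Gs_succ, Finset.sum_range_succ, ih]
theorem al_succ (β h q : ℝ) (k : ℕ) : al β h q (k+1) = psiFun β h q (al β h q k) := by
  simp [al, boltSeq]
theorem al_zero (β h q : ℝ) : al β h q 0 = √q * gamma1 β h q := by simp [al, boltSeq]
theorem ga_eq {β h q : ℝ} (hq : 0 < q) (k : ℕ) :
    ga β h q k = (al β h q k - Gs β h q k) / √(de β h q k) := by
  cases k with
  | zero =>
    have := (sqrt_pos.2 hq).ne'
    simp [ga, al, de, Gs, GammaSq, boltSeq]; field_simp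
  | succ k => simp [ga, al, de, Gs, GammaSq, boltSeq]

theorem E1_int {q : ℝ} {F : ℝ → ℝ} (hF : Continuous F) (C : ℝ) (hC : ∀ x, |F x| ≤ C) :
    Integrable (fun z => F (√q * z)) (gaussianReal 0 1) :=
  Integrable.of_bound (Continuous.aestronglyMeasurable (by fun_prop)) C (ae_of_all _ fun p => hC _)

theorem al0_lt {β h q : ℝ} (hβ : 0 < β) (hq : isFixedq β h q) : √q * gamma1 β h q < q := by
  have c := tf_cont β h
  have hq0 := hq.1
  have hs := mul_self_sqrt hq0.le
  have i1 : Integrable (fun z => tf β h (√q * z)) (gaussianReal 0 1) := E1_int c 1 (tf_abs β h)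
  have i2 : Integrable (fun z => tf β h (√q * z) ^ 2) (gaussianReal 0 1) :=
    E1_int (F := fun x => tf β h x ^ 2) (by fun_prop) 1 (fun x => by rw [abs_pow]; exact pow_le_one₀ (abs_nonneg _) (tf_abs _ _ _))
  have e : ∀ z, (tf β h (√q * z) - √q) ^ 2 = tf β h (√q * z) ^ 2 - 2 * √q * tf β h (√q * z) + q := by
    intro z
    linear_combination hs
  have i3 : Integrable (fun z => (tf β h (√q * z) - √q) ^ 2) (gaussianReal 0 1) := by
    simp_rw [e]
    exact (i2.sub (i1.const_mul _)).add (integrable_const _)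
  have key : ∫ z, (tf β h (√q * z) - √q) ^ 2 ∂(gaussianReal 0 1) = 2 * (q - √q * gamma1 β h q) := by
    simp_rw [e]
    have q1 := q_eq hq
    have g1 := gamma1_eq β h q
    unfold E1 at q1 g1
    rw [integral_add (f := fun z => tf β h (√q * z) ^ 2 - 2 * √q * tf β h (√q * z)) (i2.sub (i1.const_mul _)) (integrable_const _),
      integral_sub i2 (i1.const_mul _), integral_const_mul, q1, ← g1]
    simp; ring
  by_contra hcon
  push Not at hcon
  have hz : ∫ z, (tf β h (√q * z) - √q) ^ 2 ∂(gaussianReal 0 1) = 0 :=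
      le_antisymm (by rw [key]; linarith) (integral_nonneg fun x => sq_nonneg _)
  rw [integral_eq_zero_iff_of_nonneg (fun x => sq_nonneg _) i3] at hz
  have hne : ∀ᵐ z ∂(gaussianReal 0 1), ∀ᵐ w ∂(gaussianReal 0 1), z = w := by
    filter_upwards [hz] with z hz1
    filter_upwards [hz] with w hw1
    have a1 := sub_eq_zero.1 (pow_eq_zero_iff (two_ne_zero) |>.1 hz1)
    have a2 := sub_eq_zero.1 (pow_eq_zero_iff (two_ne_zero) |>.1 hw1)
    have := tf_inj β h hβ (a1.trans a2.symm)
    exact mul_left_cancel₀ (sqrt_pos.2 hq0).ne' this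
  obtain ⟨z, hz⟩ := hne.exists
  have : gaussianReal 0 1 {z} = 0 := by
    have := nullSingletonClass_gaussianReal (μ := 0) (v := 1) one_ne_zero
    exact measure_singleton z
  have h2 : gaussianReal 0 1 {z}ᶜ = 0 := by
    rw [ae_iff] at hz
    convert hz using 2
    ext w; simp [eq_comm]
  have h3 := measure_union_le (μ := gaussianReal 0 1) {z} {z}ᶜ
  rw [Set.union_compl_self, this, h2] at h3
  simp at h3

theorem seq_facts {β h q : ℝ} (hβ : 0 < β) (hh : 0 < h) (hq : isFixedq β h q) (hAT : ATcond β h q) (k : ℕ) :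
    (0 ≤ al β h q k ∧ al β h q k < q) ∧ (q - al β h q k ≤ de β h q k) ∧
    (de β h q (k+1) ≤ 2 * (q - al β h q k)) ∧ (q - al β h q k ≤ de β h q (k+1)) ∧
    q - al β h q k ≤ (β ^ 2 * E1 q (fun x => (1 - tf β h x ^ 2) ^ 2)) ^ k * q := by
  have hq0 := hq.1
  have hθ := AT_eq hAT
  set θ := β ^ 2 * E1 q (fun x => (1 - tf β h x ^ 2) ^ 2)
  have hθ0 : 0 ≤ θ := mul_nonneg (sq_nonneg _) (integral_nonneg fun x => sq_nonneg _)
  have main : ∀ k, (0 ≤ al β h q k ∧ al β h q k < q) → q - al β h q k ≤ de β h q k →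
      (de β h q (k+1) ≤ 2 * (q - al β h q k)) ∧ (q - al β h q k ≤ de β h q (k+1)) := by
    intro k ⟨h0, h1⟩ h2
    have dpos : 0 < de β h q k := by linarith
    have : ga β h q k ^ 2 = (de β h q k - (q - al β h q k)) ^ 2 / de β h q k := by
      rw [ga_eq hq0, div_pow, sq_sqrt dpos.le]; congr 2; simp only [de]; ring
    have e : de β h q (k+1) = 2 * (q - al β h q k) - (q - al β h q k) ^ 2 / de β h q k := by
      rw [de_succ, this]; field_simp; ring
    have p1 : 0 ≤ (q - al β h q k) ^ 2 / de β h q k := by positivity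
    have p2 : (q - al β h q k) ^ 2 / de β h q k ≤ q - al β h q k := by
      rw [div_le_iff₀ dpos]; nlinarith
    constructor <;> linarith
  induction k with
  | zero =>
    have a0 : 0 ≤ al β h q 0 ∧ al β h q 0 < q := by
      rw [al_zero]; exact ⟨mul_nonneg (sqrt_nonneg _) (gamma1_nonneg _ _ _ hh), al0_lt hβ hq⟩
    have a1 : q - al β h q 0 ≤ de β h q 0 := by rw [de_zero]; linarith [a0.1]
    refine ⟨a0, a1, (main 0 a0 a1).1, (main 0 a0 a1).2, ?_⟩
    simp; linarith [a0.1]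
  | succ k ih =>
    obtain ⟨⟨h0, h1⟩, h2, h3, h4, h5⟩ := ih
    obtain ⟨p1, p2⟩ := psi_diff hβ hq _ h0 h1
    rw [← al_succ] at p1 p2
    have a0 : 0 ≤ al β h q (k+1) ∧ al β h q (k+1) < q := ⟨by rw [al_succ]; exact psi_nonneg _ _ _ _, p1⟩
    have a1 : q - al β h q (k+1) ≤ de β h q (k+1) := by
      have : θ * (q - al β h q k) ≤ 1 * (q - al β h q k) := by
        apply mul_le_mul_of_nonneg_right hθ.le; linarith
      linarith
    refine ⟨a0, a1, (main _ a0 a1).1, (main _ a0 a1).2, p2.trans ?_⟩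
    calc θ * (q - al β h q k) ≤ θ * (θ ^ k * q) := mul_le_mul_of_nonneg_left h5 hθ0
      _ = _ := by ring

theorem de_pos {β h q : ℝ} (hβ : 0 < β) (hh : 0 < h) (hq : isFixedq β h q) (hAT : ATcond β h q) (k : ℕ) :
    0 < de β h q k := by
  obtain ⟨⟨h0, h1⟩, h2, _⟩ := seq_facts hβ hh hq hAT k
  linarith

theorem de_tendsto {β h q : ℝ} (hβ : 0 < β) (hh : 0 < h) (hq : isFixedq β h q) (hAT : ATcond β h q) :
    Tendsto (de β h q) atTop (nhds 0) := by
  rw [← tendsto_add_atTop_iff_nat 1]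
  have hθ := AT_eq hAT
  have hθ0 : 0 ≤ β ^ 2 * E1 q (fun x => (1 - tf β h x ^ 2) ^ 2) := mul_nonneg (sq_nonneg _) (integral_nonneg fun x => sq_nonneg _)
  have l := ((tendsto_pow_atTop_nhds_zero_of_lt_one hθ0 hθ).mul_const q).const_mul 2
  simp only [zero_mul, mul_zero] at l
  refine squeeze_zero (fun k => (de_pos hβ hh hq hAT (k+1)).le) (fun k => ?_) l
  obtain ⟨_, _, h3, _, h5⟩ := seq_facts hβ hh hq hAT k
  linarith

theorem ga_sq_le {β h q : ℝ} (hβ : 0 < β) (hh : 0 < h) (hq : isFixedq β h q) (hAT : ATcond β h q) (k : ℕ) :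
    ga β h q k ^ 2 ≤ de β h q k := by
  have := de_pos hβ hh hq hAT (k+1)
  rw [de_succ] at this; linarith


/-- the filter of events of high probability -/
def whp {Y : ℕ → Type} [∀ N, MeasurableSpace (Y N)] (μ : ∀ N, Measure (Y N)) : Filter (Σ N, Y N) where
  sets := {A | Tendsto (fun N => μ N {y | (⟨N, y⟩ : Σ N, Y N) ∉ A}) atTop (nhds 0)}
  univ_sets := by simp
  sets_of_superset := by
    intro A B hA hAB
    refine tendsto_of_tendsto_of_tendsto_of_le_of_le tendsto_const_nhds hA (fun _ => zero_le) ?_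
    intro N
    exact measure_mono fun y hy h => hy (hAB h)
  inter_sets := by
    intro A B hA hB
    have := Tendsto.add hA hB
    rw [add_zero] at this
    refine tendsto_of_tendsto_of_tendsto_of_le_of_le tendsto_const_nhds this (fun _ => zero_le) ?_
    intro N
    refine le_trans (measure_mono ?_) (measure_union_le _ _)
    intro y hy
    by_contra h
    exact hy ⟨by by_contra h1; exact h (Or.inl h1), by by_contra h1; exact h (Or.inr h1)⟩

theorem whp_iff {Y : ℕ → Type} [∀ N, MeasurableSpace (Y N)] (μ : ∀ N, Measure (Y N)) (A : (Σ N, Y N) → Prop) :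
    (∀ᶠ p in whp μ, A p) ↔ Tendsto (fun N => μ N {y | ¬ A ⟨N, y⟩}) atTop (nhds 0) := Iff.rfl

theorem whp_map {Y Z : ℕ → Type} [∀ N, MeasurableSpace (Y N)] [∀ N, MeasurableSpace (Z N)]
    (μ : ∀ N, Measure (Y N)) (ν : ∀ N, Measure (Z N)) (f : ∀ N, Y N → Z N)
    (hf : ∀ N, MeasurePreserving (f N) (μ N) (ν N)) :
    Tendsto (fun p : Σ N, Y N => (⟨p.1, f p.1 p.2⟩ : Σ N, Z N)) (whp μ) (whp ν) := by
  intro A hA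
  have hA' : Tendsto (fun N => ν N {y | (⟨N, y⟩ : Σ N, Z N) ∉ A}) atTop (nhds 0) := hA
  change Tendsto (fun N => μ N {y | (⟨N, f N y⟩ : Σ N, Z N) ∉ A}) atTop (nhds 0)
  refine tendsto_of_tendsto_of_tendsto_of_le_of_le tendsto_const_nhds hA' (fun _ => zero_le) ?_
  intro N
  have := Measure.le_map_apply (hf N).aemeasurable {y | (⟨N, y⟩ : Σ N, Z N) ∉ A}
  rw [(hf N).map_eq] at this
  exact this

theorem whp_map_back {Y Z : ℕ → Type} [∀ N, MeasurableSpace (Y N)] [∀ N, MeasurableSpace (Z N)]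
    (μ : ∀ N, Measure (Y N)) (ν : ∀ N, Measure (Z N)) (f : ∀ N, Y N → Z N)
    (hf : ∀ N, MeasurePreserving (f N) (μ N) (ν N)) (A : (Σ N, Z N) → Prop)
    (hA : ∀ N, MeasurableSet {z | A ⟨N, z⟩})
    (h : ∀ᶠ p in whp μ, A ⟨p.1, f p.1 p.2⟩) : ∀ᶠ p in whp ν, A p := by
  rw [whp_iff] at h ⊢
  refine h.congr fun N => ?_
  exact (hf N).measure_preimage ((hA N).compl.nullMeasurableSet)

theorem whp_fst {Y : ℕ → Type} [∀ N, MeasurableSpace (Y N)] (μ : ∀ N, Measure (Y N)) :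
    Tendsto (fun p : Σ N, Y N => p.1) (whp μ) atTop := by
  rw [tendsto_atTop]
  intro b
  rw [whp_iff]
  refine tendsto_const_nhds.congr' ?_
  filter_upwards [eventually_ge_atTop b] with N hN
  simp [hN]

theorem whp_tendsto {Y : ℕ → Type} [∀ N, MeasurableSpace (Y N)] (μ : ∀ N, Measure (Y N))
    (X : (Σ N, Y N) → ℝ) (c : ℝ)
    (h : ∀ ε > 0, Tendsto (fun N => μ N {y | ε ≤ |X ⟨N, y⟩ - c|}) atTop (nhds 0)) :
    Tendsto X (whp μ) (nhds c) := by
  rw [Metric.tendsto_nhds]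
  intro ε hε
  rw [whp_iff]
  have := h ε hε
  simpa [Real.dist_eq] using this

structure Nice {ι : Type*} [Fintype ι] (F : (ι → ℝ) → ℝ) : Prop where
  cont : Continuous F
  mem : ∀ p : NNReal, MemLp F p (gm ι)

section
variable {ι : Type*} [Fintype ι]
theorem Nice.int {F : (ι → ℝ) → ℝ} (h : Nice F) : Integrable F (gm ι) := by
  have := h.mem 1
  simp only [ENNReal.coe_one] at this
  exact this.integrable le_rfl
theorem Nice.coord (i : ι) : Nice (fun x : ι → ℝ => x i) :=
  ⟨by fun_prop, fun p => coord_memLp i p (by simp)⟩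
theorem Nice.bdd {F : (ι → ℝ) → ℝ} (hF : Continuous F) (C : ℝ) (h : ∀ x, |F x| ≤ C) : Nice F :=
  ⟨hF, fun p => MemLp.of_bound hF.aestronglyMeasurable C (ae_of_all _ fun x => by simpa using h x)⟩
theorem Nice.const (c : ℝ) : Nice (fun _ : ι → ℝ => c) := Nice.bdd (by fun_prop) |c| (by simp)
theorem Nice.add {F G : (ι → ℝ) → ℝ} (hF : Nice F) (hG : Nice G) : Nice (fun x => F x + G x) :=
  ⟨hF.cont.add hG.cont, fun p => (hF.mem p).add (hG.mem p)⟩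
theorem Nice.sub {F G : (ι → ℝ) → ℝ} (hF : Nice F) (hG : Nice G) : Nice (fun x => F x - G x) :=
  ⟨hF.cont.sub hG.cont, fun p => (hF.mem p).sub (hG.mem p)⟩
theorem Nice.mul {F G : (ι → ℝ) → ℝ} (hF : Nice F) (hG : Nice G) : Nice (fun x => F x * G x) :=
  ⟨hF.cont.mul hG.cont, fun p => by
    have h1 := hF.mem (p * 2)
    have h2 := hG.mem (p * 2)
    have : ENNReal.HolderTriple ((p * 2 : NNReal) : ENNReal) ((p * 2 : NNReal) : ENNReal) p := by
      constructor
      by_cases hp : p = 0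
      · subst hp; simp
      · push_cast
        rw [ENNReal.mul_inv (Or.inl (by simpa using hp)) (Or.inl (by simp)), ← mul_add, ENNReal.inv_two_add_inv_two, mul_one]
    exact MemLp.mul (r := p) h2 h1 |>.congr_norm (hF.cont.mul hG.cont).aestronglyMeasurable
      (ae_of_all _ fun x => by simp)⟩
theorem Nice.pow {F : (ι → ℝ) → ℝ} (hF : Nice F) (n : ℕ) : Nice (fun x => F x ^ n) := by
  induction n with
  | zero => simpa using Nice.const 1
  | succ k ih => simpa [pow_succ] using ih.mul hF
theorem Nice.sum {α : Type*} (s : Finset α) {F : α → (ι → ℝ) → ℝ} (hF : ∀ a ∈ s, Nice (F a)) :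
    Nice (fun x => ∑ a ∈ s, F a x) := by
  classical
  induction s using Finset.induction_on with
  | empty => simpa using Nice.const 0
  | insert a s ha ih =>
    simp only [Finset.sum_insert ha]
    exact (hF a (by simp)).add (ih fun b hb => hF b (by simp [hb]))
theorem Nice.abs {F : (ι → ℝ) → ℝ} (hF : Nice F) : Nice (fun x => |F x|) :=
  ⟨hF.cont.abs, fun p => (hF.mem p).norm⟩
theorem Nice.lin (a : ι → ℝ) : Nice (lin a) := by
  have := Nice.sum Finset.univ (F := fun k x => a k * x k) (fun k _ => (Nice.const (a k)).mul (Nice.coord k))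
  exact this
end

theorem mp_curry (K N : Type*) [Fintype K] [Fintype N] :
    MeasurePreserving (fun (x : N × K → ℝ) (i : N) (s : K) => x (i, s)) (gm (N × K))
      (Measure.pi (fun _ : N => gm K)) := by
  have : MeasurePreserving (MeasurableEquiv.curry N K ℝ).symm (Measure.pi (fun _ : N => gm K)) (gm (N × K)) := by
    refine ⟨MeasurableEquiv.measurable _, ?_⟩
    symm
    unfold gm
    apply Measure.pi_eq
    intro s hs
    rw [Measure.map_apply (MeasurableEquiv.measurable _) (MeasurableSet.univ_pi hs)]
    have : (MeasurableEquiv.curry N K ℝ).symm ⁻¹' (Set.univ.pi s) =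
      Set.univ.pi (fun i => Set.univ.pi (fun k => s (i, k))) := by
      ext x
      simp only [Set.mem_preimage, Set.mem_pi, Set.mem_univ, forall_true_left, Prod.forall]
      rfl
    rw [this, Measure.pi_pi]
    simp only [Measure.pi_pi]
    rw [Fintype.prod_prod_type]
  have h2 := MeasurePreserving.symm _ this
  exact h2

theorem lln (K : ℕ) {F : (Fin K → ℝ) → ℝ} (hF : Nice F) :
    Tendsto (fun p : Σ N : ℕ, (Fin N × Fin K → ℝ) => (∑ i, F (fun s => p.2 (i, s))) / p.1)
      (whp (fun N => gm (Fin N × Fin K))) (nhds (∫ x, F x ∂(gm (Fin K)))) := by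
  have key : Tendsto (fun p : Σ N : ℕ, (Fin N → Fin K → ℝ) => (∑ i, F (p.2 i)) / p.1)
      (whp (fun N => Measure.pi (fun _ : Fin N => gm (Fin K)))) (nhds (∫ x, F x ∂(gm (Fin K)))) := by
    apply whp_tendsto
    intro ε hε
    have h2 : MemLp F 2 (gm (Fin K)) := by simpa using hF.mem 2
    have lim : Tendsto (fun N : ℕ => ENNReal.ofReal (Var[F; gm (Fin K)] / ε ^ 2 * (N : ℝ)⁻¹)) atTop (nhds 0) := by
      have : Tendsto (fun N : ℕ => (Var[F; gm (Fin K)] / ε ^ 2 * (N : ℝ)⁻¹)) atTop (nhds 0) := by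
        simpa using (tendsto_inv_atTop_nhds_zero_nat (𝕜 := ℝ)).const_mul (Var[F; gm (Fin K)] / ε ^ 2)
      simpa using ENNReal.tendsto_ofReal this
    refine tendsto_of_tendsto_of_tendsto_of_le_of_le' tendsto_const_nhds lim (Eventually.of_forall fun _ => zero_le) ?_
    filter_upwards [eventually_gt_atTop 0] with N hN
    have hN' : (0:ℝ) < N := by exact_mod_cast hN
    set μ := Measure.pi (fun _ : Fin N => gm (Fin K)) with hμ
    set X : (Fin N → Fin K → ℝ) → ℝ := ∑ i, fun y => F (y i) with hX
    have hXi : ∀ i : Fin N, MemLp (fun y : Fin N → Fin K → ℝ => F (y i)) 2 μ := fun i =>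
      h2.comp_measurePreserving (measurePreserving_eval _ i)
    have hXm : MemLp X 2 μ := memLp_finsetSum' _ fun i _ => hXi i
    have hv : Var[X; μ] = N * Var[F; gm (Fin K)] := by
      have := variance_sum_pi (μ := fun _ : Fin N => gm (Fin K)) (X := fun _ => F) (fun _ => h2)
      rw [hX, hμ, this]; simp
    have hm : ∫ y, X y ∂μ = N * ∫ x, F x ∂(gm (Fin K)) := by
      simp only [hX, Finset.sum_apply]
      rw [integral_finsetSum _ fun i _ => (hXi i).integrable (by norm_num)]
      have : ∀ i : Fin N, ∫ y, F (y i) ∂μ = ∫ x, F x ∂(gm (Fin K)) := fun i => by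
        have mp := measurePreserving_eval (fun _ : Fin N => gm (Fin K)) i
        rw [← mp.map_eq, integral_map mp.measurable.aemeasurable hF.cont.aestronglyMeasurable]
      simp [this]
    have := meas_ge_le_variance_div_sq hXm (c := ε * N) (by positivity)
    rw [hv, hm] at this
    refine le_trans (measure_mono ?_) (le_trans this (le_of_eq ?_))
    · intro y hy
      simp only [Set.mem_ofPred_eq] at hy ⊢
      have e : X y - N * ∫ x, F x ∂(gm (Fin K)) = N * ((∑ i, F (y i)) / N - ∫ x, F x ∂(gm (Fin K))) := by
        simp only [hX, Finset.sum_apply]; field_simp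
      rw [e, abs_mul, abs_of_pos hN', mul_comm]
      gcongr
    · congr 1; field_simp
  have h2 := whp_map (fun N => gm (Fin N × Fin K)) (fun N => Measure.pi (fun _ : Fin N => gm (Fin K)))
    (fun N x i s => x (i, s)) (fun N => mp_curry _ _)
  have := key.comp h2
  simp only [Function.comp_def] at this
  exact this

theorem mp_sum (ι κ : Type*) [Fintype ι] [Fintype κ] :
    MeasurePreserving (fun (p : (ι → ℝ) × (κ → ℝ)) => (Sum.elim p.1 p.2 : ι ⊕ κ → ℝ))
      ((gm ι).prod (gm κ)) (gm (ι ⊕ κ)) := by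
  have := measurePreserving_sumPiEquivProdPi_symm (X := fun _ : ι ⊕ κ => ℝ) (fun _ : ι ⊕ κ => gaussianReal 0 1)
  convert! this using 1

/-- replace the vector number `s` -/
def upd {N K : ℕ} (s : Fin K) (x : Fin N × Fin K → ℝ) (y : Fin N → ℝ) : Fin N × Fin K → ℝ :=
  fun k => if k.2 = s then y k.1 else x k

theorem mp_upd (N K : ℕ) (s : Fin K) :
    MeasurePreserving (fun p : (Fin N × Fin K → ℝ) × (Fin N → ℝ) => upd s p.1 p.2)
      ((gm (Fin N × Fin K)).prod (gm (Fin N))) (gm (Fin N × Fin K)) := by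
  have h := (mp_comp_inj (ι := Fin N × Fin K) (κ := (Fin N × Fin K) ⊕ Fin N)
    (fun k => if k.2 = s then Sum.inr k.1 else Sum.inl k) (by
      rintro ⟨i, a⟩ ⟨j, b⟩ h
      simp only at h
      split_ifs at h <;> simp_all)).comp (mp_sum (Fin N × Fin K) (Fin N))
  convert h using 1
  funext p
  ext k
  simp only [upd, Function.comp]
  split_ifs <;> simp


def nr {N : ℕ} (v : Fin N → ℝ) : ℝ := √(dotp N v v)
def qf (N : ℕ) (A : Fin N → Fin N → ℝ) (u : Fin N → ℝ) : ℝ := dotp N u (mulVec N A u)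

section vec
variable {N : ℕ}
theorem dotp_comm (u v : Fin N → ℝ) : dotp N u v = dotp N v u := by
  unfold dotp; exact Finset.sum_congr rfl fun i _ => mul_comm _ _
theorem dotp_add_left (u v w : Fin N → ℝ) : dotp N (u + v) w = dotp N u w + dotp N v w := by
  simp [dotp, add_mul, Finset.sum_add_distrib]
theorem dotp_add_right (u v w : Fin N → ℝ) : dotp N w (u + v) = dotp N w u + dotp N w v := by
  simp [dotp, mul_add, Finset.sum_add_distrib]
theorem dotp_sub_left (u v w : Fin N → ℝ) : dotp N (u - v) w = dotp N u w - dotp N v w := by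
  simp [dotp, sub_mul, Finset.sum_sub_distrib]
theorem dotp_sub_right (u v w : Fin N → ℝ) : dotp N w (u - v) = dotp N w u - dotp N w v := by
  simp [dotp, mul_sub, Finset.sum_sub_distrib]
theorem dotp_smul_left (c : ℝ) (u v : Fin N → ℝ) : dotp N (c • u) v = c * dotp N u v := by
  simp [dotp, Finset.mul_sum, mul_assoc]
theorem dotp_smul_right (c : ℝ) (u v : Fin N → ℝ) : dotp N u (c • v) = c * dotp N u v := by
  rw [dotp_comm, dotp_smul_left, dotp_comm]
theorem dotp_zero_left (u : Fin N → ℝ) : dotp N 0 u = 0 := by simp [dotp]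
theorem dotp_zero_right (u : Fin N → ℝ) : dotp N u 0 = 0 := by simp [dotp]
theorem dotp_sum_left {α : Type*} (s : Finset α) (f : α → Fin N → ℝ) (u : Fin N → ℝ) :
    dotp N (∑ a ∈ s, f a) u = ∑ a ∈ s, dotp N (f a) u := by
  simp only [dotp, Finset.sum_apply, Finset.sum_mul]
  exact Finset.sum_comm
theorem dotp_sum_right {α : Type*} (s : Finset α) (f : α → Fin N → ℝ) (u : Fin N → ℝ) :
    dotp N u (∑ a ∈ s, f a) = ∑ a ∈ s, dotp N u (f a) := by
  rw [dotp_comm, dotp_sum_left]; exact Finset.sum_congr rfl fun a _ => dotp_comm _ _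
theorem dotp_self_nonneg (u : Fin N → ℝ) : 0 ≤ dotp N u u := by
  unfold dotp; exact Finset.sum_nonneg fun i _ => mul_self_nonneg _
theorem nr_nonneg (u : Fin N → ℝ) : 0 ≤ nr u := Real.sqrt_nonneg _
theorem nr_sq (u : Fin N → ℝ) : nr u ^ 2 = dotp N u u := Real.sq_sqrt (dotp_self_nonneg u)
theorem nr_mul (u : Fin N → ℝ) : nr u * nr u = dotp N u u := Real.mul_self_sqrt (dotp_self_nonneg u)
theorem nr_eq (u : Fin N → ℝ) : nr u = ‖(WithLp.toLp 2 u : EuclideanSpace ℝ (Fin N))‖ := by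
  rw [EuclideanSpace.norm_eq, nr, dotp]
  congr 1
  exact Finset.sum_congr rfl fun i _ => by simp [sq]
theorem nr_add_le (u v : Fin N → ℝ) : nr (u + v) ≤ nr u + nr v := by
  simp only [nr_eq, WithLp.toLp_add]; exact norm_add_le _ _
theorem nr_sub_le (u v : Fin N → ℝ) : nr (u - v) ≤ nr u + nr v := by
  simp only [nr_eq, WithLp.toLp_sub]; exact norm_sub_le _ _
theorem nr_sub_comm (u v : Fin N → ℝ) : nr (u - v) = nr (v - u) := by
  simp only [nr_eq, WithLp.toLp_sub]; exact norm_sub_rev _ _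
theorem nr_smul (c : ℝ) (u : Fin N → ℝ) : nr (c • u) = |c| * nr u := by
  simp only [nr_eq, WithLp.toLp_smul, norm_smul, Real.norm_eq_abs]
theorem nr_zero : nr (0 : Fin N → ℝ) = 0 := by simp [nr, dotp]
theorem nr_sum_le {α : Type*} (s : Finset α) (f : α → Fin N → ℝ) :
    nr (∑ a ∈ s, f a) ≤ ∑ a ∈ s, nr (f a) := by
  classical
  induction s using Finset.induction_on with
  | empty => simp [nr_zero]
  | insert a s ha ih =>
    rw [Finset.sum_insert ha, Finset.sum_insert ha]
    linarith [nr_add_le (f a) (∑ a ∈ s, f a)]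
theorem abs_dotp_le (u v : Fin N → ℝ) : |dotp N u v| ≤ nr u * nr v := by
  rw [nr, nr, ← Real.sqrt_mul (dotp_self_nonneg u)]
  apply Real.abs_le_sqrt
  have := Finset.sum_mul_sq_le_sq_mul_sq Finset.univ u v
  simpa [dotp, sq] using this
theorem dotp_le (u v : Fin N → ℝ) : dotp N u v ≤ nr u * nr v := (le_abs_self _).trans (abs_dotp_le u v)
theorem nr_abs_sub_le (u v : Fin N → ℝ) : |nr u - nr v| ≤ nr (u - v) := by
  simp only [nr_eq, WithLp.toLp_sub]; exact abs_norm_sub_norm_le _ _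
theorem nr_mono {u v : Fin N → ℝ} (h : ∀ i, |u i| ≤ |v i|) : nr u ≤ nr v := by
  apply Real.sqrt_le_sqrt
  exact Finset.sum_le_sum fun i _ => by
    have := abs_le_abs (h i) (by linarith [abs_nonneg (u i), abs_nonneg (v i)])
    have := sq_le_sq.2 this
    simpa [sq] using this
theorem nr_cont : Continuous (nr : (Fin N → ℝ) → ℝ) := by
  unfold nr dotp; fun_prop
theorem dotp_cont : Continuous (fun p : (Fin N → ℝ) × (Fin N → ℝ) => dotp N p.1 p.2) := by
  unfold dotp; fun_prop
theorem mulVec_add (A : Fin N → Fin N → ℝ) (u v : Fin N → ℝ) : mulVec N A (u + v) = mulVec N A u + mulVec N A v := by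
  funext i; simp [mulVec, mul_add, Finset.sum_add_distrib]
theorem mulVec_sub (A : Fin N → Fin N → ℝ) (u v : Fin N → ℝ) : mulVec N A (u - v) = mulVec N A u - mulVec N A v := by
  funext i; simp [mulVec, mul_sub, Finset.sum_sub_distrib]
theorem mulVec_smul (A : Fin N → Fin N → ℝ) (c : ℝ) (u : Fin N → ℝ) : mulVec N A (c • u) = c • mulVec N A u := by
  funext i; simp [mulVec, Finset.mul_sum, mul_left_comm]
theorem mulVec_zero (A : Fin N → Fin N → ℝ) : mulVec N A 0 = 0 := by
  funext i; simp [mulVec]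
theorem dotp_mulVec_symm (A : Fin N → Fin N → ℝ) (hA : ∀ i j, A i j = A j i) (u v : Fin N → ℝ) :
    dotp N u (mulVec N A v) = dotp N (mulVec N A u) v := by
  simp only [dotp, mulVec, Finset.mul_sum, Finset.sum_mul]
  rw [Finset.sum_comm]
  exact Finset.sum_congr rfl fun i _ => Finset.sum_congr rfl fun j _ => by rw [hA j i]; ring
end vec

def Mx (N : ℕ) (x : Fin N × Fin N → ℝ) : Fin N → Fin N → ℝ := fun i j => (x (i,j) + x (j,i)) / √(2 * N)

def goe (N : ℕ) : Measure (Fin N → Fin N → ℝ) := (gm (Fin N × Fin N)).map (Mx N)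

theorem Mx_meas (N : ℕ) : Measurable (Mx N) := by unfold Mx; fun_prop

instance goe_prob (N : ℕ) : IsProbabilityMeasure (goe N) :=
  Measure.isProbabilityMeasure_map (Mx_meas N).aemeasurable

theorem Mx_mp (N : ℕ) : MeasurePreserving (Mx N) (gm (Fin N × Fin N)) (goe N) := ⟨Mx_meas N, rfl⟩

def qcoef (N : ℕ) (u : Fin N → ℝ) (k : Fin N × Fin N) : ℝ := √(2 / N) * (u k.1 * u k.2)

theorem qf_Mx (N : ℕ) (hN : 0 < N) (x : Fin N × Fin N → ℝ) (u : Fin N → ℝ) : qf N (Mx N x) u = lin (qcoef N u) x := by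
  have hN' : (0:ℝ) < N := by exact_mod_cast hN
  have e : √(2 / N) = 2 / √(2 * N) := by
    rw [eq_div_iff (by positivity), ← Real.sqrt_mul (by positivity)]
    rw [show (2 / (N:ℝ) * (2 * N)) = 2 * 2 by field_simp]; simp
  have h1 : qf N (Mx N x) u = ∑ i, ∑ j, (u i * u j / √(2*N)) * x (i,j) + ∑ i, ∑ j, (u i * u j / √(2*N)) * x (j,i) := by
    simp only [qf, dotp, mulVec, Mx, Finset.mul_sum, ← Finset.sum_add_distrib]
    exact Finset.sum_congr rfl fun i _ => Finset.sum_congr rfl fun j _ => by ring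
  rw [h1, Finset.sum_comm (f := fun i j => (u i * u j / √(2*N)) * x (j,i)), ← Finset.sum_add_distrib]
  unfold lin qcoef
  rw [Fintype.sum_prod_type]
  refine Finset.sum_congr rfl fun i _ => ?_
  rw [← Finset.sum_add_distrib]
  exact Finset.sum_congr rfl fun j _ => by rw [e]; ring

theorem qcoef_gram (N : ℕ) (u v : Fin N → ℝ) :
    ∑ k, qcoef N u k * qcoef N v k = 2 / N * dotp N u v ^ 2 := by
  simp only [qcoef, dotp, sq, Finset.sum_mul_sum]
  rw [Fintype.sum_prod_type, Finset.mul_sum]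
  refine Finset.sum_congr rfl fun i _ => ?_
  rw [Finset.mul_sum]
  refine Finset.sum_congr rfl fun j _ => ?_
  have := Real.mul_self_sqrt (show (0:ℝ) ≤ 2 / N by positivity)
  linear_combination (u i * u j * (v i * v j)) * this

theorem half_gauss : (1:ENNReal) ≤ 2 * gm Unit {y | 0 ≤ y ()} := by
  have h1 : gm Unit {y | 0 ≤ y ()} = gaussianReal 0 1 (Set.Ici 0) := by
    rw [← (mp_eval (ι := Unit) ()).measure_preimage measurableSet_Ici.nullMeasurableSet]; rfl
  have h2 : gaussianReal 0 1 (Set.Iic 0) = gaussianReal 0 1 (Set.Ici 0) := by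
    have := gaussianReal_map_neg (μ := 0) (v := 1)
    rw [neg_zero] at this
    conv_lhs => rw [← this]
    rw [Measure.map_apply measurable_neg measurableSet_Iic]
    congr 1; ext x; simp
  rw [h1, two_mul]
  nth_rewrite 1 [← h2]
  rw [← measure_univ (μ := gaussianReal 0 1), ← Set.Iic_union_Ici (a := (0:ℝ))]
  exact measure_union_le _ _

theorem goe_comp (N : ℕ) (hN : 0 < N) {T : Type} [Fintype T] [DecidableEq T] (u : T → Fin N → ℝ) (f : T → ℝ) :
    goe N {M | ¬ ∀ t, qf N M (u t) ≤ f t} ≤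
      2 * gm (Fin N) {g | ¬ ∀ t, 2 / √N * nr (u t) * dotp N g (u t) ≤ f t} := by
  have hN' : (0:ℝ) < N := by exact_mod_cast hN
  set A : T → (Unit ⊕ (Fin N × Fin N)) → ℝ := fun t => Sum.elim (fun _ => √(2/N) * nr (u t) ^ 2) (qcoef N (u t)) with hA
  set B : T → Fin N → ℝ := fun t k => 2 / √N * nr (u t) * u t k with hB
  have gA : ∀ s t, ∑ k, A s k * A t k = 2 / N * (nr (u s) ^ 2 * nr (u t) ^ 2 + dotp N (u s) (u t) ^ 2) := by
    intro s t
    rw [Fintype.sum_sum_type]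
    simp only [hA, Sum.elim_inl, Sum.elim_inr, qcoef_gram]
    have := Real.mul_self_sqrt (show (0:ℝ) ≤ 2 / N by positivity)
    simp only [Finset.univ_unique, Finset.sum_const, Finset.card_singleton, one_smul]
    linear_combination (nr (u s) ^ 2 * nr (u t) ^ 2) * this
  have gB : ∀ s t, ∑ k, B s k * B t k = 4 / N * (nr (u s) * nr (u t)) * dotp N (u s) (u t) := by
    intro s t
    simp only [hB, dotp, Finset.mul_sum]
    refine Finset.sum_congr rfl fun k _ => ?_
    have h2 : √(N:ℝ) ≠ 0 := by positivity
    have := Real.sq_sqrt hN'.le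
    field_simp
    rw [this]; ring
  have key := slepian A B (fun t => by rw [gA, gB, ← nr_sq]; ring) (fun s t => by
    rw [gA, gB]
    have : 0 ≤ 2 / (N:ℝ) * (nr (u s) * nr (u t) - dotp N (u s) (u t)) ^ 2 := by positivity
    have e : 4 / (N:ℝ) = 2 * (2 / N) := by ring
    rw [e]
    nlinarith) f
  have lB : ∀ t y, lin (B t) y = 2 / √N * nr (u t) * dotp N y (u t) := by
    intro t y
    simp only [lin, hB, dotp, Finset.mul_sum]
    exact Finset.sum_congr rfl fun k _ => by ring
  have mA : MeasurableSet {x | ∀ t, lin (A t) x ≤ f t} := by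
    rw [Set.ofPred_forall]
    exact MeasurableSet.iInter fun t => measurableSet_le (lin_cont _).measurable measurable_const
  have mB : MeasurableSet {x | ∀ t, lin (B t) x ≤ f t} := by
    rw [Set.ofPred_forall]
    exact MeasurableSet.iInter fun t => measurableSet_le (lin_cont _).measurable measurable_const
  have key2 : gm _ {x | ¬ ∀ t, lin (A t) x ≤ f t} ≤ gm _ {y | ¬ ∀ t, lin (B t) y ≤ f t} := by
    have e1 : {x | ¬ ∀ t, lin (A t) x ≤ f t} = {x | ∀ t, lin (A t) x ≤ f t}ᶜ := rfl
    have e2 : {x | ¬ ∀ t, lin (B t) x ≤ f t} = {x | ∀ t, lin (B t) x ≤ f t}ᶜ := rfl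
    rw [e1, e2, prob_compl_eq_one_sub mA, prob_compl_eq_one_sub mB]
    exact tsub_le_tsub_left key 1
  simp only [lB] at key2
  refine le_trans ?_ (mul_le_mul_right key2 2)
  have mM : MeasurableSet {M : Fin N → Fin N → ℝ | ¬ ∀ t, qf N M (u t) ≤ f t} := by
    refine MeasurableSet.compl (s := {M | ∀ t, qf N M (u t) ≤ f t}) ?_
    rw [Set.ofPred_forall]
    refine MeasurableSet.iInter fun t => measurableSet_le ?_ measurable_const
    unfold qf dotp mulVec; fun_prop
  rw [← (Mx_mp N).measure_preimage mM.nullMeasurableSet]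
  have mA' : MeasurableSet {x | ¬ ∀ t, lin (A t) x ≤ f t} := mA.compl
  rw [← (mp_sum Unit (Fin N × Fin N)).measure_preimage mA'.nullMeasurableSet]
  have sub : {y : Unit → ℝ | 0 ≤ y ()} ×ˢ (Mx N ⁻¹' {M | ¬ ∀ t, qf N M (u t) ≤ f t}) ⊆
      (fun p : (Unit → ℝ) × (Fin N × Fin N → ℝ) => (Sum.elim p.1 p.2 : Unit ⊕ (Fin N × Fin N) → ℝ)) ⁻¹'
        {x | ¬ ∀ t, lin (A t) x ≤ f t} := by
    rintro ⟨y, x⟩ ⟨h1, h2⟩ h3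
    apply h2
    intro t
    have := h3 t
    simp only [lin, Fintype.sum_sum_type, hA, Sum.elim_inl, Sum.elim_inr] at this
    rw [qf_Mx N hN]
    unfold lin
    simp only [Finset.univ_unique, Finset.sum_singleton] at this
    have h1' : 0 ≤ y () := h1
    have : 0 ≤ √(2 / N) * nr (u t) ^ 2 * y () := by positivity
    linarith!
  refine le_trans ?_ (mul_le_mul_right (measure_mono sub) 2)
  rw [Measure.prod_prod, ← mul_assoc]
  exact le_mul_of_one_le_left' half_gauss

theorem goe_comp_seq (N : ℕ) (hN : 0 < N) (u : ℕ → Fin N → ℝ) (f : ℕ → ℝ) :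
    goe N {M | ¬ ∀ t, qf N M (u t) ≤ f t} ≤
      2 * gm (Fin N) {g | ¬ ∀ t, 2 / √N * nr (u t) * dotp N g (u t) ≤ f t} := by
  have e : {M | ¬ ∀ t, qf N M (u t) ≤ f t} = ⋃ n : ℕ, {M | ¬ ∀ t : Fin n, qf N M (u t) ≤ f t} := by
    ext M
    simp only [Set.mem_iUnion, Set.mem_ofPred_eq, not_forall, not_le]
    constructor
    · rintro ⟨t, ht⟩; exact ⟨t+1, ⟨t, by simp⟩, ht⟩
    · rintro ⟨n, t, ht⟩; exact ⟨t, ht⟩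
  have mono : Monotone (fun n : ℕ => {M | ¬ ∀ t : Fin n, qf N M (u t) ≤ f t}) := by
    intro a b hab M hM h
    exact hM fun t => h ⟨t, t.2.trans_le hab⟩
  rw [e, mono.measure_iUnion]
  refine iSup_le fun n => ?_
  refine le_trans (goe_comp N hN (fun t : Fin n => u t) (fun t => f t)) (mul_le_mul_right (measure_mono ?_) 2)
  intro g hg h
  exact hg fun t => h t


theorem lln1 {ι : ℕ → Type} [∀ N, Fintype (ι N)] (e : ∀ N, Fin N → ι N) (he : ∀ N, Function.Injective (e N))
    (m : ℕ) :
    Tendsto (fun p : Σ N : ℕ, (ι N → ℝ) => (∑ i, p.2 (e p.1 i) ^ m) / p.1)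
      (whp (fun N => gm (ι N))) (nhds (∫ x : Fin 1 → ℝ, x 0 ^ m ∂(gm (Fin 1)))) := by
  have h1 := lln 1 ((Nice.coord (0 : Fin 1)).pow m)
  have h2 := whp_map (fun N => gm (ι N)) (fun N => gm (Fin N × Fin 1))
    (fun N x k => x (e N k.1)) (fun N => mp_comp_inj (fun k : Fin N × Fin 1 => e N k.1) (by
      rintro ⟨i, a⟩ ⟨j, b⟩ h
      have := he N h
      simp only at this
      subst this
      simp only [Prod.mk.injEq, true_and]
      exact Subsingleton.elim _ _))
  have := h1.comp h2
  simp only [Function.comp_def] at this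
  exact this

theorem m2 : ∫ x : Fin 1 → ℝ, x 0 ^ 2 ∂(gm (Fin 1)) = 1 := by
  have := coord_cov (ι := Fin 1) 0 0
  simpa [sq] using this

theorem gm_norm : ∀ᶠ p in whp (fun N => gm (Fin N)), nr p.2 ≤ 3 / 2 * √p.1 := by
  have h := lln1 (ι := fun N => Fin N) (fun N i => i) (fun N => Function.injective_id) 2
  rw [m2] at h
  have h1 := h.eventually (gt_mem_nhds (show (1:ℝ) < 9/4 by norm_num))
  have h0 := (whp_fst (fun N => gm (Fin N))).eventually (eventually_gt_atTop 0)
  filter_upwards [h1, h0] with p hp hN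
  have hN' : (0:ℝ) < p.1 := by exact_mod_cast hN
  rw [div_lt_iff₀ hN'] at hp
  rw [nr, show (3/2 * √(p.1:ℝ)) = √(9/4 * p.1) by
    rw [Real.sqrt_mul (by norm_num), show (9/4:ℝ) = (3/2)^2 by norm_num, Real.sqrt_sq (by norm_num)]]
  apply Real.sqrt_le_sqrt
  refine le_trans (le_of_eq ?_) hp.le
  simp [dotp, sq]

theorem qf_smul (N : ℕ) (M : Fin N → Fin N → ℝ) (c : ℝ) (u : Fin N → ℝ) : qf N M (c • u) = c ^ 2 * qf N M u := by
  simp only [qf, mulVec_smul, dotp_smul_left, dotp_smul_right]; ring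

theorem qf_cont (N : ℕ) (M : Fin N → Fin N → ℝ) : Continuous (qf N M) := by
  unfold qf dotp mulVec; fun_prop
theorem qf_meas (N : ℕ) (u : Fin N → ℝ) : Measurable (fun M => qf N M u) := by
  unfold qf dotp mulVec; fun_prop

theorem goe_upper : ∀ᶠ p in whp goe, ∀ u, qf p.1 p.2 u ≤ 3 * nr u ^ 2 := by
  rw [whp_iff]
  have h1 := (whp_iff _ _).1 gm_norm
  have h2 := ENNReal.Tendsto.const_mul (a := 2) h1 (Or.inr (by simp))
  rw [mul_zero] at h2
  refine tendsto_of_tendsto_of_tendsto_of_le_of_le' tendsto_const_nhds h2 (Eventually.of_forall fun _ => zero_le) ?_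
  filter_upwards [eventually_gt_atTop 0] with N hN
  have hN' : (0:ℝ) < N := by exact_mod_cast hN
  have h3 := goe_comp_seq N hN (TopologicalSpace.denseSeq (Fin N → ℝ)) (fun t => 3 * nr (TopologicalSpace.denseSeq (Fin N → ℝ) t) ^ 2)
  refine le_trans (measure_mono ?_) (h3.trans (mul_le_mul_right (measure_mono ?_) 2))
  · intro M hM h
    apply hM
    intro u
    have hd := TopologicalSpace.denseRange_denseSeq (Fin N → ℝ)
    have hc : IsClosed {u | qf N M u ≤ 3 * nr u ^ 2} := isClosed_le (qf_cont N M) (by have := nr_cont (N := N); fun_prop)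
    have hs : Set.range (TopologicalSpace.denseSeq (Fin N → ℝ)) ⊆ {u | qf N M u ≤ 3 * nr u ^ 2} := by
      rintro _ ⟨t, rfl⟩; exact h t
    have := hc.closure_subset_iff.2 hs
    rw [hd.closure_range] at this
    exact this (Set.mem_univ u)
  · intro g hg h
    apply hg
    intro t
    set u := TopologicalSpace.denseSeq (Fin N → ℝ) t
    have h4 := dotp_le g u
    have h5 : nr g ≤ 3 / 2 * √N := h
    have h6 : 2 / √N * nr u * dotp N g u ≤ 2 / √N * nr u * (3 / 2 * √N * nr u) := by
      have := nr_nonneg u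
      have := mul_le_mul_of_nonneg_right h5 this
      gcongr; linarith
    refine h6.trans (le_of_eq ?_)
    have : √(N:ℝ) ≠ 0 := by positivity
    field_simp
    try ring

theorem gm_neg (ι : Type*) [Fintype ι] : MeasurePreserving (fun x : ι → ℝ => -x) (gm ι) (gm ι) := by
  have h := measurePreserving_pi (fun _ : ι => gaussianReal 0 1) (fun _ : ι => gaussianReal 0 1) (f := fun _ x => -x)
    (fun _ => ⟨measurable_neg, by simpa using gaussianReal_map_neg (μ := 0) (v := 1)⟩)
  exact h

theorem goe_neg (N : ℕ) : MeasurePreserving (fun M : Fin N → Fin N → ℝ => -M) (goe N) (goe N) := by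
  refine ⟨measurable_neg, ?_⟩
  unfold goe
  rw [Measure.map_map measurable_neg (Mx_meas N)]
  conv_rhs => rw [← (gm_neg (Fin N × Fin N)).map_eq]
  rw [Measure.map_map (Mx_meas N) (gm_neg _).measurable]
  congr 1
  funext x i j
  simp [Mx]; ring

theorem qf_neg (N : ℕ) (M : Fin N → Fin N → ℝ) (u : Fin N → ℝ) : qf N (-M) u = - qf N M u := by
  simp [qf, dotp, mulVec]

theorem opbd {N : ℕ} (M : Fin N → Fin N → ℝ) (hs : ∀ i j, M i j = M j i) (hu : ∀ u, |qf N M u| ≤ 3 * nr u ^ 2)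
    (u : Fin N → ℝ) : nr (mulVec N M u) ≤ 3 * nr u := by
  by_cases hr : nr (mulVec N M u) = 0
  · rw [hr]; linarith [nr_nonneg u]
  have hr0 : 0 < nr (mulVec N M u) := lt_of_le_of_ne (nr_nonneg _) (Ne.symm hr)
  set r := nr (mulVec N M u) with hrd
  set v : Fin N → ℝ := (nr u / r) • mulVec N M u with hv
  have nv : nr v = nr u := by
    rw [hv, nr_smul, abs_of_nonneg (div_nonneg (nr_nonneg u) hr0.le), ← hrd]; field_simp
  have e1 : qf N M (u + v) - qf N M (u - v) = 4 * dotp N v (mulVec N M u) := by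
    simp only [qf, mulVec_add, mulVec_sub, dotp_add_left, dotp_add_right, dotp_sub_left, dotp_sub_right]
    rw [dotp_mulVec_symm M hs u v, dotp_comm (mulVec N M u) v]; ring
  have e2 : dotp N v (mulVec N M u) = nr u * r := by
    rw [hv, dotp_smul_left, ← nr_mul, ← hrd]; field_simp
  have e3 : nr (u + v) ^ 2 + nr (u - v) ^ 2 = 2 * nr u ^ 2 + 2 * nr v ^ 2 := by
    simp only [nr_sq, dotp_add_left, dotp_add_right, dotp_sub_left, dotp_sub_right]; ring
  have h1 := (abs_le.1 (hu (u + v))).2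
  have h2 := (abs_le.1 (hu (u - v))).1
  rw [nv] at e3
  rw [e2] at e1
  have h3 : nr u * r ≤ nr u * (3 * nr u) := by nlinarith
  by_cases h0 : nr u = 0
  · exfalso
    have : dotp N v v = 0 := by rw [← nr_mul, nv, h0, zero_mul]
    have hu0 : u = 0 := by
      funext i
      have := (Finset.sum_eq_zero_iff_of_nonneg (fun i _ => mul_self_nonneg (u i))).1
        (show ∑ i, u i * u i = 0 by have := nr_mul u; rw [h0] at this; simpa [dotp] using this.symm) i (Finset.mem_univ i)
      simpa using this
    rw [hu0, mulVec_zero, nr_zero] at hrd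
    linarith
  · exact le_of_mul_le_mul_left h3 (lt_of_le_of_ne (nr_nonneg _) (Ne.symm h0))

theorem goe_symm (N : ℕ) : ∀ᵐ M ∂(goe N), ∀ i j, M i j = M j i := by
  unfold goe
  rw [ae_map_iff (Mx_meas N).aemeasurable]
  · refine ae_of_all _ fun x i j => ?_
    simp [Mx, add_comm]
  · rw [Set.ofPred_forall]
    refine MeasurableSet.iInter fun i => ?_
    rw [Set.ofPred_forall]
    exact MeasurableSet.iInter fun j => measurableSet_eq_fun (by fun_prop) (by fun_prop)

theorem whp_ae {Y : ℕ → Type} [∀ N, MeasurableSpace (Y N)] (μ : ∀ N, Measure (Y N)) (A : (Σ N, Y N) → Prop)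
    (h : ∀ N, ∀ᵐ y ∂(μ N), A ⟨N, y⟩) : ∀ᶠ p in whp μ, A p := by
  rw [whp_iff]
  refine tendsto_const_nhds.congr fun N => ?_
  exact (ae_iff.1 (h N)).symm

/-- good matrix event -/
def gdM (N : ℕ) (ε : ℝ) (M : Fin N → Fin N → ℝ) : Prop :=
  (∀ i j, M i j = M j i) ∧ (∀ u, nr (mulVec N M u) ≤ 3 * nr u) ∧ ∀ i, |M i i| ≤ ε

theorem goe_diag (ε : ℝ) (hε : 0 < ε) : ∀ᶠ p in whp goe, ∀ i, |p.2 i i| ≤ ε := by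
  refine whp_map_back (fun N => gm (Fin N × Fin N)) goe Mx Mx_mp (fun p => ∀ i, |p.2 i i| ≤ ε) ?_ ?_
  · intro N
    simp only [Set.ofPred_forall]
    exact MeasurableSet.iInter fun i => measurableSet_le (by fun_prop) measurable_const
  have h := lln1 (ι := fun N => Fin N × Fin N) (fun N i => (i, i)) (fun N a b h => (Prod.mk.inj h).1) 4
  set C := ∫ x : Fin 1 → ℝ, x 0 ^ 4 ∂(gm (Fin 1)) with hC
  have hC0 : 0 ≤ C := integral_nonneg fun x => by positivity
  have h1 := h.eventually (gt_mem_nhds (show C < C + 1 by linarith))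
  have h0 := (whp_fst (fun N => gm (Fin N × Fin N))).eventually (eventually_gt_atTop 0)
  have h2 := (whp_fst (fun N => gm (Fin N × Fin N))).eventually ((tendsto_natCast_atTop_atTop (R := ℝ)).eventually (eventually_ge_atTop (4 * (C+1) / ε ^ 4)))
  filter_upwards [h1, h0, h2] with p hp hN h2
  intro i
  have hN' : (0:ℝ) < p.1 := by exact_mod_cast hN
  rw [div_lt_iff₀ hN'] at hp
  have h3 : p.2 (i,i) ^ 4 ≤ (C + 1) * p.1 := by
    refine le_trans ?_ hp.le
    exact Finset.single_le_sum (f := fun i => p.2 (i,i) ^ 4) (fun i _ => by positivity) (Finset.mem_univ i)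
  have e : Mx p.1 p.2 i i ^ 4 = 4 * p.2 (i,i) ^ 4 / p.1 ^ 2 := by
    have : √(2 * (p.1:ℝ)) ^ 4 = 4 * p.1 ^ 2 := by
      rw [show √(2 * (p.1:ℝ)) ^ 4 = (√(2 * (p.1:ℝ)) ^ 2) ^ 2 by ring, Real.sq_sqrt (by positivity)]; ring
    simp only [Mx]
    rw [div_pow, this]; field_simp; ring
  have h4 : Mx p.1 p.2 i i ^ 4 ≤ ε ^ 4 := by
    rw [e, div_le_iff₀ (by positivity)]
    rw [div_le_iff₀ (by positivity)] at h2
    calc 4 * p.2 (i,i) ^ 4 ≤ 4 * ((C + 1) * p.1) := by gcongr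
      _ = (4 * (C+1)) * p.1 := by ring
      _ ≤ (p.1 * ε ^ 4) * p.1 := by gcongr
      _ = _ := by ring
  have h5 : |Mx p.1 p.2 i i| ^ 4 ≤ ε ^ 4 := by rwa [show |Mx p.1 p.2 i i| ^ 4 = Mx p.1 p.2 i i ^ 4 from Even.pow_abs (by decide) _]
  exact le_of_pow_le_pow_left₀ (by norm_num) hε.le h5

theorem goe_good (ε : ℝ) (hε : 0 < ε) : ∀ᶠ p in whp goe, gdM p.1 ε p.2 := by
  have h1 := goe_upper
  have h2 := (whp_map goe goe (fun N M => -M) goe_neg).eventually goe_upper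
  have h3 := whp_ae goe (fun p => ∀ i j, p.2 i j = p.2 j i) goe_symm
  filter_upwards [h1, h2, h3, goe_diag ε hε] with p h1 h2 h3 h4
  refine ⟨h3, opbd p.2 h3 ?_, h4⟩
  intro u
  rw [abs_le]
  have := h2 u
  simp only [qf_neg] at this
  exact ⟨by linarith, h1 u⟩

theorem gdM_meas (N : ℕ) (ε : ℝ) : MeasurableSet {M | gdM N ε M} := by
  have hc : IsClosed {M | gdM N ε M} := by
    unfold gdM
    simp only [Set.ofPred_and, Set.ofPred_forall]
    refine IsClosed.inter ?_ (IsClosed.inter ?_ ?_)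
    · exact isClosed_iInter fun i => isClosed_iInter fun j => isClosed_eq (by fun_prop) (by fun_prop)
    · refine isClosed_iInter fun u => isClosed_le ?_ continuous_const
      unfold nr mulVec dotp; fun_prop
    · exact isClosed_iInter fun i => isClosed_le (by fun_prop) continuous_const
  exact hc.measurableSet


def pj {N : ℕ} (φ v : Fin N → ℝ) : Fin N → ℝ := v - dotp N φ v • φ
def Pm {N : ℕ} (φ : Fin N → ℝ) (i k : Fin N) : ℝ := (if i = k then 1 else 0) - φ i * φ k
def uz {N : ℕ} (φ : Fin N → ℝ) : Prop := dotp N φ φ = 1 ∨ φ = 0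

def stp (N : ℕ) (φ y : Fin N → ℝ) (M : Fin N → Fin N → ℝ) : Fin N → Fin N → ℝ := fun i j =>
  (pj φ y i * φ j + φ i * pj φ y j + √2 * dotp N φ y * (φ i * φ j)) / √N
    + ∑ k, ∑ l, Pm φ i k * Pm φ j l * M k l

theorem pj_Pm {N : ℕ} (φ v : Fin N → ℝ) (i : Fin N) : pj φ v i = ∑ k, Pm φ i k * v k := by
  simp only [pj, Pm, sub_mul, Finset.sum_sub_distrib, Pi.sub_apply, Pi.smul_apply, smul_eq_mul, dotp, Finset.sum_mul]
  congr 1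
  · simp
  · exact Finset.sum_congr rfl fun k _ => by ring

theorem Pm_sq {N : ℕ} (φ : Fin N → ℝ) (h : uz φ) (i j : Fin N) : ∑ k, Pm φ i k * Pm φ j k = Pm φ i j := by
  have e : ∀ k, Pm φ i k * Pm φ j k = (if i = k then (if j = k then 1 else 0) else 0) - (if i = k then φ j * φ k else 0)
      - (if j = k then φ i * φ k else 0) + φ i * φ j * (φ k * φ k) := by
    intro k; simp only [Pm]; split_ifs <;> ring
  simp only [e, Finset.sum_add_distrib, Finset.sum_sub_distrib, Finset.sum_ite_eq, Finset.mem_univ, if_true, ← Finset.mul_sum]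
  have e2 : ∑ k, φ k * φ k = dotp N φ φ := rfl
  rw [e2]
  simp only [Pm, @eq_comm _ j i]
  rcases h with h | h
  · rw [h]; ring
  · subst h; simp

theorem Pm_phi {N : ℕ} (φ : Fin N → ℝ) (h : uz φ) (i : Fin N) : ∑ k, Pm φ i k * φ k = 0 := by
  rw [← pj_Pm]
  simp only [pj, Pi.sub_apply, Pi.smul_apply, smul_eq_mul]
  rcases h with h | h
  · rw [h]; ring
  · subst h; simp

theorem Pm_comm {N : ℕ} (φ : Fin N → ℝ) (i j : Fin N) : Pm φ i j = Pm φ j i := by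
  simp only [Pm, @eq_comm _ j i]; ring

def stA (N : ℕ) (φ : Fin N → ℝ) (u : Fin N × Fin N) : Fin N ⊕ (Fin N × Fin N) → ℝ :=
  Sum.elim (fun k => (Pm φ u.1 k * φ u.2 + φ u.1 * Pm φ u.2 k + √2 * (φ u.1 * φ u.2) * φ k) / √N)
    (fun k => (Pm φ u.1 k.1 * Pm φ u.2 k.2 + Pm φ u.1 k.2 * Pm φ u.2 k.1) / √(2 * N))
def stB (N : ℕ) (u : Fin N × Fin N) (k : Fin N × Fin N) : ℝ :=
  ((if u = k then 1 else 0) + (if u.swap = k then 1 else 0)) / √(2 * N)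

theorem stB_lin (N : ℕ) (x : Fin N × Fin N → ℝ) (u : Fin N × Fin N) : lin (stB N u) x = Mx N x u.1 u.2 := by
  simp only [lin, stB, Mx, add_div, add_mul, Finset.sum_add_distrib]
  congr 1
  · rw [Finset.sum_eq_single u]
    · simp; ring
    · intro b _ hb; simp [Ne.symm hb]
    · simp
  · rw [Finset.sum_eq_single u.swap]
    · simp [Prod.swap]; ring
    · intro b _ hb; simp [Ne.symm hb]
    · simp

theorem stA_lin (N : ℕ) (φ y : Fin N → ℝ) (x : Fin N × Fin N → ℝ) (u : Fin N × Fin N) :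
    lin (stA N φ u) (Sum.elim y x) = stp N φ y (Mx N x) u.1 u.2 := by
  simp only [lin, Fintype.sum_sum_type, stA, stp, Sum.elim_inl, Sum.elim_inr]
  congr 1
  · rw [pj_Pm, pj_Pm]
    simp only [dotp, Finset.mul_sum, Finset.sum_mul, ← Finset.sum_add_distrib, Finset.sum_div]
    exact Finset.sum_congr rfl fun k _ => by ring
  · rw [Fintype.sum_prod_type]
    simp only [Mx, add_mul, add_div, mul_add, Finset.sum_add_distrib]
    congr 1
    · exact Finset.sum_congr rfl fun k _ => Finset.sum_congr rfl fun l _ => by ring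
    · rw [Finset.sum_comm]
      exact Finset.sum_congr rfl fun k _ => Finset.sum_congr rfl fun l _ => by ring

theorem st_gram (N : ℕ) (φ : Fin N → ℝ) (h : uz φ) (u v : Fin N × Fin N) :
    ∑ k, stA N φ u k * stA N φ v k = ∑ k, stB N u k * stB N v k := by
  by_cases hN : N = 0
  · subst hN; exact u.1.elim0
  have hN' : (0:ℝ) < N := by positivity
  have r1 := Real.mul_self_sqrt hN'.le
  have r2 := Real.mul_self_sqrt (show (0:ℝ) ≤ 2 * N by positivity)
  have r3 := Real.mul_self_sqrt (show (0:ℝ) ≤ 2 by norm_num)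
  obtain ⟨i, j⟩ := u
  obtain ⟨p, q⟩ := v
  have hB : ∑ k, stB N (i,j) k * stB N (p,q) k = ((if i = p then 1 else 0) * (if j = q then 1 else 0)
      + (if i = q then 1 else 0) * (if j = p then 1 else 0)) / N := by
    have e : ∀ k, stB N (i,j) k * stB N (p,q) k = ((if (i,j) = k then ((if (p,q) = k then 1 else 0) + (if (q,p) = k then 1 else 0)) else 0)
      + (if (j,i) = k then ((if (p,q) = k then 1 else 0) + (if (q,p) = k then 1 else 0)) else 0)) / (2 * N) := by
      intro k
      simp only [stB, Prod.swap_prod_mk]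
      rw [div_mul_div_comm, r2]
      congr 1
      split_ifs <;> ring
    simp only [e, ← Finset.sum_div, Finset.sum_add_distrib, Finset.sum_ite_eq, Finset.mem_univ, if_true, Prod.mk.injEq]
    have c1 : (p = i) = (i = p) := propext eq_comm
    have c2 : (p = j) = (j = p) := propext eq_comm
    have c3 : (q = i) = (i = q) := propext eq_comm
    have c4 : (q = j) = (j = q) := propext eq_comm
    have ia : ∀ (a b : Prop) [Decidable a] [Decidable b], (if a ∧ b then (1:ℝ) else 0) = (if a then 1 else 0) * (if b then 1 else 0) := by
      intro a b _ _
      by_cases ha : a <;> by_cases hb : b <;> simp [ha, hb]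
    simp only [c1, c2, c3, c4, ia]
    field_simp
    ring
  have hR : ∑ k : Fin N × Fin N, stA N φ (i,j) (Sum.inr k) * stA N φ (p,q) (Sum.inr k) = (Pm φ i p * Pm φ j q + Pm φ i q * Pm φ j p) / N := by
    simp only [stA, Sum.elim_inr, div_mul_div_comm, r2]
    rw [← Finset.sum_div, Fintype.sum_prod_type]
    have prodsum : ∀ f g : Fin N → ℝ, ∑ k, ∑ l, f k * g l = (∑ k, f k) * ∑ l, g l := fun f g => by
      rw [Finset.sum_mul_sum]
    have e : ∀ k l, (Pm φ i k * Pm φ j l + Pm φ i l * Pm φ j k) * (Pm φ p k * Pm φ q l + Pm φ p l * Pm φ q k)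
      = (Pm φ i k * Pm φ p k) * (Pm φ j l * Pm φ q l) + (Pm φ i k * Pm φ q k) * (Pm φ j l * Pm φ p l)
       + (Pm φ j k * Pm φ p k) * (Pm φ i l * Pm φ q l) + (Pm φ j k * Pm φ q k) * (Pm φ i l * Pm φ p l) := by intros; ring
    simp only [e, Finset.sum_add_distrib, prodsum, Pm_sq φ h]
    field_simp; ring
  have hL : ∑ k : Fin N, stA N φ (i,j) (Sum.inl k) * stA N φ (p,q) (Sum.inl k)
     = (Pm φ i p * φ j * φ q + Pm φ i q * φ j * φ p + Pm φ j p * φ i * φ q + Pm φ j q * φ i * φ p + 2 * dotp N φ φ * (φ i * φ j * φ p * φ q)) / N := by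
    simp only [stA, Sum.elim_inl, div_mul_div_comm, r1]
    rw [← Finset.sum_div]
    congr 1
    have e : ∀ k, (Pm φ i k * φ j + φ i * Pm φ j k + √2 * (φ i * φ j) * φ k) * (Pm φ p k * φ q + φ p * Pm φ q k + √2 * (φ p * φ q) * φ k)
      = φ j * φ q * (Pm φ i k * Pm φ p k) + φ j * φ p * (Pm φ i k * Pm φ q k) + φ i * φ q * (Pm φ j k * Pm φ p k)
        + φ i * φ p * (Pm φ j k * Pm φ q k) + √2 * (φ p * φ q) * φ j * (Pm φ i k * φ k) + √2 * (φ p * φ q) * φ i * (Pm φ j k * φ k)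
        + √2 * (φ i * φ j) * φ q * (Pm φ p k * φ k) + √2 * (φ i * φ j) * φ p * (Pm φ q k * φ k)
        + 2 * (φ i * φ j * φ p * φ q) * (φ k * φ k) := by
      intro k
      linear_combination ((φ i * φ j * φ p * φ q) * (φ k * φ k)) * r3
    simp only [e, Finset.sum_add_distrib, ← Finset.mul_sum, Pm_sq φ h, Pm_phi φ h]
    have e2 : ∑ k, φ k * φ k = dotp N φ φ := rfl
    rw [e2]; ring
  rw [Fintype.sum_sum_type, hB, hR, hL, ← add_div]
  congr 1
  rcases h with h | h
  · rw [h]; simp only [Pm]; ring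
  · subst h; simp [Pm]

theorem stp_meas (N : ℕ) : Measurable (fun p : (Fin N → ℝ) × (Fin N → ℝ) × (Fin N → Fin N → ℝ) => stp N p.1 p.2.1 p.2.2) := by
  refine Continuous.measurable ?_
  unfold stp pj Pm dotp
  simp only [Pi.sub_apply, Pi.smul_apply, smul_eq_mul]
  fun_prop

theorem goe_step (N : ℕ) (φ : Fin N → ℝ) (h : uz φ) :
    MeasurePreserving (fun p : (Fin N → ℝ) × (Fin N → Fin N → ℝ) => stp N φ p.1 p.2)
      ((gm (Fin N)).prod (goe N)) (goe N) := by
  have hm : Measurable (fun p : (Fin N → ℝ) × (Fin N → Fin N → ℝ) => stp N φ p.1 p.2) :=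
    (stp_meas N).comp (measurable_const.prodMk measurable_id)
  refine ⟨hm, ?_⟩
  have h1 := gram_law _ _ (st_gram N φ h)
  have mA : Measurable (fun (x : Fin N ⊕ (Fin N × Fin N) → ℝ) u => lin (stA N φ u) x) :=
    measurable_pi_iff.2 fun u => (lin_cont _).measurable
  have mB : Measurable (fun (x : (Fin N × Fin N) → ℝ) u => lin (stB N u) x) :=
    measurable_pi_iff.2 fun u => (lin_cont _).measurable
  have mC : Measurable (fun (M : Fin N × Fin N → ℝ) (i j : Fin N) => M (i, j)) := by fun_prop
  have h2 := congrArg (Measure.map (fun (M : Fin N × Fin N → ℝ) (i j : Fin N) => M (i, j))) h1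
  rw [Measure.map_map mC mA, Measure.map_map mC mB, ← (mp_sum _ _).map_eq,
    Measure.map_map (mC.comp mA) (mp_sum _ _).measurable] at h2
  have e1 : (fun (M : Fin N × Fin N → ℝ) (i j : Fin N) => M (i, j)) ∘ (fun (x : (Fin N × Fin N) → ℝ) u => lin (stB N u) x) = Mx N := by
    funext x i j
    simp only [Function.comp, stB_lin]
  rw [e1] at h2
  change _ = goe N at h2
  have h3 : (gm (Fin N)).prod (goe N) = Measure.map (Prod.map id (Mx N)) ((gm (Fin N)).prod (gm (Fin N × Fin N))) := by
    have := Measure.map_prod_map (gm (Fin N)) (gm (Fin N × Fin N)) measurable_id (Mx_meas N)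
    rw [Measure.map_id] at this
    exact this
  refine Eq.trans ?_ h2
  rw [h3, Measure.map_map hm (measurable_id.prodMap (Mx_meas N))]
  congr 1
  funext p i j
  simp only [Function.comp, stA_lin, Prod.map, id]


def gv {N K : ℕ} (x : Fin N × Fin K → ℝ) (s : ℕ) : Fin N → ℝ := fun i => if h : s < K then x (i, ⟨s, h⟩) else 0

theorem gv_upd_ne {N K : ℕ} (x : Fin N × Fin K → ℝ) (y : Fin N → ℝ) (s : Fin K) (j : ℕ) (h : j ≠ s) :
    gv (upd s x y) j = gv x j := by
  funext i
  simp only [gv, upd]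
  split_ifs with h1 h2
  · exact absurd (by rw [← h2]) h
  · rfl
  · rfl

theorem gv_upd_self {N K : ℕ} (x : Fin N × Fin K → ℝ) (y : Fin N → ℝ) (s : Fin K) :
    gv (upd s x y) s = y := by
  funext i
  simp [gv, upd]

theorem gv_meas {N K : ℕ} (s : ℕ) : Measurable (fun x : Fin N × Fin K → ℝ => gv x s) := by
  unfold gv
  refine measurable_pi_iff.2 fun i => ?_
  by_cases h : s < K
  · simp only [h, dite_true]; fun_prop
  · simp only [h, dite_false]; fun_prop

def Bm {N : ℕ} (φ g : ℕ → Fin N → ℝ) : ℕ → (Fin N → Fin N → ℝ) → (Fin N → Fin N → ℝ)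
  | 0 => fun M => M
  | n + 1 => fun M => Bm φ g n (stp N (φ n) (g n) M)

theorem Bm_congr {N : ℕ} (φ g φ' g' : ℕ → Fin N → ℝ) (n : ℕ) (h : ∀ j < n, φ j = φ' j) (h' : ∀ j < n, g j = g' j) (M) :
    Bm φ g n M = Bm φ' g' n M := by
  induction n generalizing M with
  | zero => rfl
  | succ n ih =>
    simp only [Bm]
    rw [h n (by omega), h' n (by omega)]
    exact ih (fun j hj => h j (by omega)) (fun j hj => h' j (by omega)) _

theorem B_meas {N : ℕ} {X : Type*} [MeasurableSpace X] (φ g : X → ℕ → Fin N → ℝ) (hφ : ∀ s, Measurable (fun x => φ x s))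
    (hg : ∀ s, Measurable (fun x => g x s)) (n : ℕ) :
    ∀ (m : X → Fin N → Fin N → ℝ), Measurable m → Measurable (fun p : X => Bm (φ p) (g p) n (m p)) := by
  induction n with
  | zero => exact fun m hm => hm
  | succ n ih =>
    intro m hm
    simp only [Bm]
    exact ih (fun p => stp N (φ p n) (g p n) (m p)) ((stp_meas N).comp ((hφ n).prodMk ((hg n).prodMk hm)))

theorem B_law (N K : ℕ) (Φ : (Fin N × Fin K → ℝ) → ℕ → Fin N → ℝ) (hm : ∀ s, Measurable (fun x => Φ x s))
    (hu : ∀ x s, uz (Φ x s))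
    (hl : ∀ (s : Fin K) x y, ∀ j ≤ (s : ℕ), Φ (upd s x y) j = Φ x j) (n : ℕ) (hn : n ≤ K) :
    MeasurePreserving (fun p : (Fin N × Fin K → ℝ) × (Fin N → Fin N → ℝ) => Bm (Φ p.1) (gv p.1) n p.2)
      ((gm (Fin N × Fin K)).prod (goe N)) (goe N) := by
  have meas : ∀ n, Measurable (fun p : (Fin N × Fin K → ℝ) × (Fin N → Fin N → ℝ) => Bm (Φ p.1) (gv p.1) n p.2) := by
    intro n
    exact B_meas (X := (Fin N × Fin K → ℝ) × (Fin N → Fin N → ℝ)) (fun p => Φ p.1) (fun p => gv p.1)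
      (fun s => (hm s).comp measurable_fst) (fun s => (gv_meas s).comp measurable_fst) n _ measurable_snd
  induction n with
  | zero => exact measurePreserving_snd
  | succ n ih =>
    have ih := ih (by omega)
    refine ⟨meas _, Measure.ext fun S hS => ?_⟩
    have hR : goe N S = ∫⁻ x, goe N (Prod.mk x ⁻¹' ((fun p : (Fin N × Fin K → ℝ) × (Fin N → Fin N → ℝ) => Bm (Φ p.1) (gv p.1) n p.2) ⁻¹' S)) ∂gm (Fin N × Fin K) := by
      rw [← Measure.prod_apply (meas _ hS)]
      exact (ih.measure_preimage hS.nullMeasurableSet).symm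
    rw [Measure.map_apply (meas _) hS, Measure.prod_apply (meas _ hS), hR]
    set s : Fin K := ⟨n, hn⟩ with hs
    have m1 : Measurable fun x => goe N (Prod.mk x ⁻¹' ((fun p : (Fin N × Fin K → ℝ) × (Fin N → Fin N → ℝ) => Bm (Φ p.1) (gv p.1) (n+1) p.2) ⁻¹' S)) :=
      measurable_measure_prodMk_left (meas _ hS)
    have e := (mp_upd N K s).lintegral_comp m1
    rw [← e]
    refine (lintegral_prod _ (m1.comp (mp_upd N K s).measurable).aemeasurable).trans ?_
    refine lintegral_congr fun x => ?_
    have hT : MeasurableSet (Prod.mk x ⁻¹' ((fun p : (Fin N × Fin K → ℝ) × (Fin N → Fin N → ℝ) => Bm (Φ p.1) (gv p.1) n p.2) ⁻¹' S)) :=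
      measurable_prodMk_left (meas _ hS)
    have st := goe_step N (Φ x n) (hu x n)
    rw [← st.measure_preimage hT.nullMeasurableSet, Measure.prod_apply (st.measurable hT)]
    refine lintegral_congr fun y => ?_
    refine congrArg (goe N) (Set.ext fun M => ?_)
    simp only [Set.mem_preimage, Bm]
    have e1 : Φ (upd s x y) n = Φ x n := hl s x y n le_rfl
    have e2 : gv (upd s x y) n = y := gv_upd_self x y s
    rw [e1, e2, Bm_congr _ _ (Φ x) (gv x) n (fun j hj => hl s x y j (by simp [hs]; omega))
      (fun j hj => gv_upd_ne x y s j (by simp [hs]; omega))]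

section alg
variable {N : ℕ}

def nrm (v : Fin N → ℝ) : Fin N → ℝ := fun i => v i / √(dotp N v v)

theorem nrm_eq (v : Fin N → ℝ) : nrm v = (nr v)⁻¹ • v := by
  funext i; simp [nrm, nr, div_eq_inv_mul]

theorem nrm_uz (v : Fin N → ℝ) : uz (nrm v) := by
  by_cases h : nr v = 0
  · right; rw [nrm_eq, h]; simp
  · left; rw [nrm_eq, dotp_smul_left, dotp_smul_right, ← nr_mul]; field_simp

def qs (m : ℕ → Fin N → ℝ) : ℕ → (Fin N → ℝ) → (Fin N → ℝ)
  | 0 => fun v => v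
  | n + 1 => fun v => pj (nrm (qs m n (m n))) (qs m n v)

def ph (m : ℕ → Fin N → ℝ) (n : ℕ) : Fin N → ℝ := nrm (qs m n (m n))

theorem ph_uz (m : ℕ → Fin N → ℝ) (n : ℕ) : uz (ph m n) := nrm_uz _

theorem qs_succ (m : ℕ → Fin N → ℝ) (n : ℕ) (v : Fin N → ℝ) : qs m (n+1) v = pj (ph m n) (qs m n v) := rfl

theorem qs_congr (m m' : ℕ → Fin N → ℝ) (n : ℕ) (h : ∀ j < n, m j = m' j) : qs m n = qs m' n := by
  induction n with
  | zero => rfl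
  | succ n ih =>
    funext v
    simp only [qs]
    rw [ih (fun j hj => h j (by omega)), h n (by omega)]

theorem ph_congr (m m' : ℕ → Fin N → ℝ) (n : ℕ) (h : ∀ j ≤ n, m j = m' j) : ph m n = ph m' n := by
  unfold ph
  rw [qs_congr m m' n (fun j hj => h j (by omega)), h n le_rfl]

theorem pj_orth (φ v : Fin N → ℝ) (h : uz φ) : dotp N φ (pj φ v) = 0 := by
  rw [pj, dotp_sub_right, dotp_smul_right]
  rcases h with h | h
  · rw [h]; ring
  · subst h; simp [dotp_zero_left]

theorem ph_qs (m : ℕ → Fin N → ℝ) (n : ℕ) : ∀ j < n, ∀ v, dotp N (ph m j) (qs m n v) = 0 := by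
  induction n with
  | zero => intro j hj; omega
  | succ n ih =>
    intro j hj v
    rw [qs_succ]
    by_cases h : j = n
    · subst h; exact pj_orth _ _ (ph_uz m j)
    · have hj' : j < n := by omega
      rw [pj, dotp_sub_right, dotp_smul_right, ih j hj' v]
      have : dotp N (ph m j) (ph m n) = 0 := by
        rw [ph, ph, nrm_eq (qs m n (m n)), dotp_smul_right]
        have := ih j hj' (m n)
        rw [ph] at this
        rw [this, mul_zero]
      rw [this]; ring

theorem ph_orth (m : ℕ → Fin N → ℝ) (j n : ℕ) (h : j < n) : dotp N (ph m j) (ph m n) = 0 := by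
  have := ph_qs m n j h (m n)
  rw [ph.eq_1 m n, nrm_eq (qs m n (m n)), dotp_smul_right, this, mul_zero]

theorem ph_orth' (m : ℕ → Fin N → ℝ) (j n : ℕ) (h : j ≠ n) : dotp N (ph m j) (ph m n) = 0 := by
  rcases lt_or_gt_of_ne h with h | h
  · exact ph_orth m j n h
  · rw [dotp_comm]; exact ph_orth m n j h

theorem qs_sum (m : ℕ → Fin N → ℝ) (n : ℕ) (v : Fin N → ℝ) :
    qs m n v = v - ∑ j ∈ Finset.range n, dotp N (ph m j) v • ph m j := by
  induction n with
  | zero => simp [qs]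
  | succ n ih =>
    rw [qs_succ, pj, Finset.sum_range_succ]
    have : dotp N (ph m n) (qs m n v) = dotp N (ph m n) v := by
      rw [ih, dotp_sub_right, dotp_sum_right, Finset.sum_eq_zero, sub_zero]
      intro j hj
      rw [dotp_smul_right, ph_orth' m n j (by simp at hj; omega), mul_zero]
    rw [this, ih]; abel

theorem ph_qs_ge (m : ℕ → Fin N → ℝ) (n j : ℕ) (h : n ≤ j) (v : Fin N → ℝ) :
    dotp N (ph m j) (qs m n v) = dotp N (ph m j) v := by
  rw [qs_sum, dotp_sub_right, dotp_sum_right, Finset.sum_eq_zero, sub_zero]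
  intro i hi
  rw [dotp_smul_right, ph_orth' m j i (by simp at hi; omega), mul_zero]

theorem qs_sub (m : ℕ → Fin N → ℝ) (n : ℕ) (u v : Fin N → ℝ) : qs m n (u - v) = qs m n u - qs m n v := by
  simp only [qs_sum, dotp_sub_right, sub_smul, Finset.sum_sub_distrib]; abel
theorem qs_smul (m : ℕ → Fin N → ℝ) (n : ℕ) (c : ℝ) (v : Fin N → ℝ) : qs m n (c • v) = c • qs m n v := by
  simp only [qs_sum, dotp_smul_right, smul_sub, Finset.smul_sum, smul_smul]

theorem qs_idem (m : ℕ → Fin N → ℝ) (n : ℕ) (v : Fin N → ℝ) : qs m n (qs m n v) = qs m n v := by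
  rw [qs_sum m n (qs m n v), Finset.sum_eq_zero, sub_zero]
  intro j hj
  rw [ph_qs m n j (by simpa using hj), zero_smul]

theorem qs_ph_ge (m : ℕ → Fin N → ℝ) (n j : ℕ) (h : n ≤ j) : qs m n (ph m j) = ph m j := by
  rw [qs_sum, Finset.sum_eq_zero, sub_zero]
  intro i hi
  rw [ph_orth' m i j (by simp at hi; omega), zero_smul]

theorem uz_smul (φ : Fin N → ℝ) (h : uz φ) : dotp N φ φ • φ = φ := by
  rcases h with h | h
  · rw [h, one_smul]
  · subst h; simp

theorem qs_ph_lt (m : ℕ → Fin N → ℝ) (n j : ℕ) (h : j < n) : qs m n (ph m j) = 0 := by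
  rw [qs_sum, Finset.sum_eq_single j, uz_smul _ (ph_uz m j), sub_self]
  · intro i _ hi; rw [ph_orth' m i j hi, zero_smul]
  · intro h1; simp at h1; omega

theorem qs_adj (m : ℕ → Fin N → ℝ) (n : ℕ) (u v : Fin N → ℝ) : dotp N u (qs m n v) = dotp N (qs m n u) v := by
  rw [qs_sum, qs_sum, dotp_sub_right, dotp_sub_left, dotp_sum_right, dotp_sum_left]
  congr 1
  refine Finset.sum_congr rfl fun j _ => ?_
  rw [dotp_smul_right, dotp_smul_left, dotp_comm u]; ring

theorem qs_nr (m : ℕ → Fin N → ℝ) (n : ℕ) (v : Fin N → ℝ) :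
    nr (qs m n v) ^ 2 = nr v ^ 2 - ∑ j ∈ Finset.range n, dotp N (ph m j) v ^ 2 := by
  rw [nr_sq, ← qs_adj, qs_idem, qs_sum, dotp_sub_right, dotp_sum_right, nr_sq]
  congr 1
  refine Finset.sum_congr rfl fun j _ => ?_
  rw [dotp_smul_right, dotp_comm v]; ring

theorem qs_nr_le (m : ℕ → Fin N → ℝ) (n : ℕ) (v : Fin N → ℝ) : nr (qs m n v) ≤ nr v := by
  apply le_of_sq_le_sq _ (nr_nonneg v)
  rw [qs_nr]
  have : 0 ≤ ∑ j ∈ Finset.range n, dotp N (ph m j) v ^ 2 := Finset.sum_nonneg fun j _ => sq_nonneg _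
  linarith

theorem nr_uz (φ : Fin N → ℝ) (h : uz φ) : nr φ ≤ 1 := by
  rcases h with h | h
  · rw [nr, h]; simp
  · subst h; simp [nr_zero]

end alg

section alg2
variable {N : ℕ}

theorem stp_mulVec (φ y : Fin N → ℝ) (M : Fin N → Fin N → ℝ) (v : Fin N → ℝ) :
    mulVec N (stp N φ y M) v = (√N)⁻¹ • (dotp N φ v • pj φ y + dotp N (pj φ y) v • φ + (√2 * dotp N φ y * dotp N φ v) • φ)
      + pj φ (mulVec N M (pj φ v)) := by
  funext i
  have h1 : mulVec N (stp N φ y M) v i = ∑ j, (((√N)⁻¹ * (pj φ y i * (φ j * v j) + (pj φ y j * v j) * φ i + √2 * dotp N φ y * (φ j * v j) * φ i))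
      + (∑ k, ∑ l, Pm φ i k * Pm φ j l * M k l) * v j) := by
    simp only [mulVec, stp]
    refine Finset.sum_congr rfl fun j _ => ?_
    ring
  rw [h1, Finset.sum_add_distrib]
  simp only [Pi.add_apply, Pi.smul_apply, smul_eq_mul]
  congr 1
  · rw [← Finset.mul_sum, Finset.sum_add_distrib, Finset.sum_add_distrib, ← Finset.mul_sum, ← Finset.sum_mul,
      ← Finset.sum_mul, ← Finset.mul_sum]
    simp only [dotp]; ring
  · rw [pj_Pm]
    simp only [Finset.sum_mul]
    rw [Finset.sum_comm]
    refine Finset.sum_congr rfl fun k _ => ?_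
    simp only [mulVec, Finset.mul_sum]
    rw [Finset.sum_comm]
    refine Finset.sum_congr rfl fun l _ => ?_
    rw [pj_Pm]
    simp only [Finset.mul_sum]
    refine Finset.sum_congr rfl fun j _ => ?_
    rw [Pm_comm φ j l]
    ring

theorem qs_add (m : ℕ → Fin N → ℝ) (n : ℕ) (u v : Fin N → ℝ) : qs m n (u + v) = qs m n u + qs m n v := by
  simp only [qs_sum, dotp_add_right, add_smul, Finset.sum_add_distrib]; abel

theorem qs_zero (m : ℕ → Fin N → ℝ) (n : ℕ) : qs m n 0 = 0 := by
  have := qs_smul m n 0 0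
  simpa using this

theorem qs_finsum (m : ℕ → Fin N → ℝ) (n : ℕ) {α : Type*} (s : Finset α) (f : α → Fin N → ℝ) :
    qs m n (∑ a ∈ s, f a) = ∑ a ∈ s, qs m n (f a) := by
  classical
  induction s using Finset.induction_on with
  | empty => simp [qs_zero]
  | insert a s ha ih => rw [Finset.sum_insert ha, Finset.sum_insert ha, qs_add, ih]

theorem qs_pj (m : ℕ → Fin N → ℝ) (n : ℕ) (x : Fin N → ℝ) : qs m n (pj (ph m n) x) = qs m (n+1) x := by
  rw [qs_succ, pj, pj, qs_sub, qs_smul, qs_ph_ge m n n le_rfl, ph_qs_ge m n n le_rfl]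

def Rm (m g : ℕ → Fin N → ℝ) (s : ℕ) (v : Fin N → ℝ) : Fin N → ℝ :=
  (√N)⁻¹ • (dotp N (ph m s) v • qs m (s+1) (g s) + dotp N (qs m (s+1) (g s)) v • ph m s
    + (√2 * dotp N (ph m s) (g s) * dotp N (ph m s) v) • ph m s)

theorem Bm_mulVec (m g : ℕ → Fin N → ℝ) (n : ℕ) (M : Fin N → Fin N → ℝ) (v : Fin N → ℝ) :
    mulVec N (Bm (ph m) g n M) v = ∑ s ∈ Finset.range n, Rm m g s v + qs m n (mulVec N M (qs m n v)) := by
  induction n generalizing M with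
  | zero => simp [Bm, qs]
  | succ n ih =>
    simp only [Bm]
    rw [ih, stp_mulVec, qs_add, qs_pj, Finset.sum_range_succ, ← qs_succ, ← add_assoc]
    congr 2
    rw [Rm, qs_smul, qs_add, qs_add, qs_smul, qs_smul, qs_smul, qs_pj, qs_ph_ge m n n le_rfl, ph_qs_ge m n n le_rfl,
      qs_adj m n, qs_pj]

theorem Bm_qf (m g : ℕ → Fin N → ℝ) (n : ℕ) (M : Fin N → Fin N → ℝ) (u : Fin N → ℝ) :
    |qf N (Bm (ph m) g n M) u - 2 / √N * ∑ s ∈ Finset.range n, dotp N (ph m s) u * dotp N (g s) u - qf N M (qs m n u)|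
      ≤ 4 * (∑ s ∈ Finset.range n, ∑ j ∈ Finset.range (s+1), |dotp N (ph m j) (g s)| / √N) * nr u ^ 2 := by
  have key : qf N (Bm (ph m) g n M) u - 2 / √N * ∑ s ∈ Finset.range n, dotp N (ph m s) u * dotp N (g s) u - qf N M (qs m n u)
     = ∑ s ∈ Finset.range n, (√N)⁻¹ * (√2 * dotp N (ph m s) (g s) * dotp N (ph m s) u ^ 2
        - 2 * dotp N (ph m s) u * ∑ j ∈ Finset.range (s+1), dotp N (ph m j) (g s) * dotp N (ph m j) u) := by
    unfold qf
    rw [Bm_mulVec, dotp_add_right, qs_adj, dotp_sum_right, Finset.mul_sum]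
    rw [add_sub_right_comm, add_sub_cancel_right, ← Finset.sum_sub_distrib]
    refine Finset.sum_congr rfl fun s _ => ?_
    rw [Rm, dotp_smul_right, dotp_add_right, dotp_add_right, dotp_smul_right, dotp_smul_right, dotp_smul_right,
      dotp_comm u (qs m (s+1) (g s)), dotp_comm u (ph m s)]
    rw [qs_sum, dotp_sub_left, dotp_sum_left]
    simp only [dotp_smul_left]
    rw [div_eq_mul_inv]
    ring
  rw [key, Finset.mul_sum, Finset.sum_mul]
  refine (Finset.abs_sum_le_sum_abs _ _).trans (Finset.sum_le_sum fun s _ => ?_)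
  have hp : ∀ j, |dotp N (ph m j) u| ≤ nr u := fun j => (abs_dotp_le _ _).trans
    (mul_le_of_le_one_left (nr_nonneg u) (nr_uz _ (ph_uz m j)))
  have hu := nr_nonneg u
  set S := ∑ j ∈ Finset.range (s+1), |dotp N (ph m j) (g s)| with hS
  have hS1 : |dotp N (ph m s) (g s)| ≤ S :=
    Finset.single_le_sum (f := fun j => |dotp N (ph m j) (g s)|) (fun _ _ => abs_nonneg _) (Finset.mem_range.2 (by omega : s < s + 1))
  have hS2 : |∑ j ∈ Finset.range (s+1), dotp N (ph m j) (g s) * dotp N (ph m j) u| ≤ S * nr u := by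
    rw [hS, Finset.sum_mul]
    refine (Finset.abs_sum_le_sum_abs _ _).trans (Finset.sum_le_sum fun j _ => ?_)
    rw [abs_mul]; exact mul_le_mul_of_nonneg_left (hp j) (abs_nonneg _)
  have h2 : √2 ≤ 2 := Real.sqrt_le_iff.2 (by norm_num)
  have a1 : |√2 * dotp N (ph m s) (g s) * dotp N (ph m s) u ^ 2| ≤ 2 * S * nr u ^ 2 := by
    rw [abs_mul, abs_mul, abs_of_nonneg (Real.sqrt_nonneg 2), abs_pow]
    have := hp s
    gcongr
  have a2 : |2 * dotp N (ph m s) u * ∑ j ∈ Finset.range (s+1), dotp N (ph m j) (g s) * dotp N (ph m j) u| ≤ 2 * S * nr u ^ 2 := by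
    rw [abs_mul, abs_mul, abs_of_nonneg (zero_le_two)]
    calc 2 * |dotp N (ph m s) u| * _ ≤ 2 * nr u * (S * nr u) := by
          have := hp s
          gcongr
      _ = _ := by ring
  rw [← Finset.sum_div, abs_mul, abs_of_nonneg (inv_nonneg.2 (Real.sqrt_nonneg _))]
  calc (√N)⁻¹ * _ ≤ (√N)⁻¹ * (2 * S * nr u ^ 2 + 2 * S * nr u ^ 2) := by
        refine mul_le_mul_of_nonneg_left ((abs_sub _ _).trans (add_le_add a1 a2)) (inv_nonneg.2 (Real.sqrt_nonneg _))
    _ = _ := by rw [div_eq_mul_inv]; ring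

theorem Bm_phi (m g : ℕ → Fin N → ℝ) (hN : 0 < N) (n s : ℕ) (hs : s < n) (h1 : dotp N (ph m s) (ph m s) = 1) (M : Fin N → Fin N → ℝ) :
    nr (√N • qs m s (mulVec N (Bm (ph m) g n M) (ph m s)) - g s) ≤ 3 * ∑ j ∈ Finset.range (s+1), |dotp N (ph m j) (g s)| := by
  have hN' : √(N:ℝ) ≠ 0 := by
    have : (0:ℝ) < N := by exact_mod_cast hN
    positivity
  have e : √N • qs m s (mulVec N (Bm (ph m) g n M) (ph m s)) = qs m (s+1) (g s) + (√2 * dotp N (ph m s) (g s)) • ph m s := by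
    rw [Bm_mulVec, qs_ph_lt m n s hs, mulVec_zero, qs_zero, add_zero, qs_finsum, Finset.sum_eq_single s]
    · rw [Rm, h1, qs_smul, smul_smul, mul_inv_cancel₀ hN', one_smul, qs_add, qs_add, qs_smul, qs_smul, qs_smul, qs_ph_ge m s s le_rfl,
        one_smul, mul_one, dotp_comm _ (ph m s), ph_qs m (s+1) s (by omega), zero_smul, add_zero]
      congr 1
      rw [← qs_pj, qs_idem]
    · intro r _ hr
      rw [Rm, ph_orth' m r s hr, zero_smul, mul_zero, zero_smul, zero_add, add_zero, qs_smul, qs_smul]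
      rcases lt_or_gt_of_ne hr with h | h
      · rw [qs_ph_lt m s r h, smul_zero, smul_zero]
      · rw [dotp_comm, ph_qs m (r+1) s (by omega), zero_smul, smul_zero]
    · intro h; simp at h; omega
  rw [e, qs_sum]
  have e2 : g s - ∑ j ∈ Finset.range (s+1), dotp N (ph m j) (g s) • ph m j + (√2 * dotp N (ph m s) (g s)) • ph m s - g s
     = (√2 * dotp N (ph m s) (g s)) • ph m s - ∑ j ∈ Finset.range (s+1), dotp N (ph m j) (g s) • ph m j := by abel
  rw [e2]
  set S := ∑ j ∈ Finset.range (s+1), |dotp N (ph m j) (g s)| with hS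
  have hS1 : |dotp N (ph m s) (g s)| ≤ S :=
    Finset.single_le_sum (f := fun j => |dotp N (ph m j) (g s)|) (fun _ _ => abs_nonneg _) (Finset.mem_range.2 (by omega : s < s + 1))
  have h2 : √2 ≤ 2 := Real.sqrt_le_iff.2 (by norm_num)
  have hp : ∀ j, nr (ph m j) ≤ 1 := fun j => nr_uz _ (ph_uz m j)
  have a1 : nr ((√2 * dotp N (ph m s) (g s)) • ph m s) ≤ 2 * S := by
    rw [nr_smul, abs_mul, abs_of_nonneg (Real.sqrt_nonneg 2)]
    calc √2 * |dotp N (ph m s) (g s)| * nr (ph m s) ≤ 2 * S * 1 := by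
          have := hp s
          have := nr_nonneg (ph m s)
          gcongr
      _ = _ := by ring
  have a2 : nr (∑ j ∈ Finset.range (s+1), dotp N (ph m j) (g s) • ph m j) ≤ S := by
    refine (nr_sum_le _ _).trans (Finset.sum_le_sum fun j _ => ?_)
    rw [nr_smul]
    exact mul_le_of_le_one_right (abs_nonneg _) (hp j)
  have := nr_sub_le ((√2 * dotp N (ph m s) (g s)) • ph m s) (∑ j ∈ Finset.range (s+1), dotp N (ph m j) (g s) • ph m j)
  linarith

end alg2

section tap
variable {N : ℕ}

def zv (β h q : ℝ) (g : ℕ → Fin N → ℝ) (s : ℕ) : Fin N → ℝ :=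
  ∑ j ∈ Finset.range s, ga β h q j • g j + √(de β h q s) • g s

def mm (β h q : ℝ) (g : ℕ → Fin N → ℝ) : ℕ → Fin N → ℝ
  | 0 => fun _ => √q
  | s + 1 => fun i => tf β h (zv β h q g s i)

theorem zv_congr (β h q : ℝ) (g g' : ℕ → Fin N → ℝ) (s : ℕ) (H : ∀ j ≤ s, g j = g' j) : zv β h q g s = zv β h q g' s := by
  unfold zv
  rw [H s le_rfl, Finset.sum_congr rfl fun j hj => by rw [H j (by simp at hj; omega)]]

theorem mm_congr (β h q : ℝ) (g g' : ℕ → Fin N → ℝ) (s : ℕ) (H : ∀ j < s, g j = g' j) : mm β h q g s = mm β h q g' s := by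
  cases s with
  | zero => rfl
  | succ s => simp only [mm]; rw [zv_congr β h q g g' s (fun j hj => H j (by omega))]

def Rel (β h q : ℝ) (G : Fin N → Fin N → ℝ) (ζ : ℕ → Fin N → ℝ) : Prop :=
  ∀ s, ζ s = √N • qs (mm β h q ζ) s (mulVec N G (ph (mm β h q ζ) s))

theorem Rel_unique (β h q : ℝ) (G : Fin N → Fin N → ℝ) (ζ ζ' : ℕ → Fin N → ℝ) (H : Rel β h q G ζ) (H' : Rel β h q G ζ') :
    ∀ s, ζ s = ζ' s := by
  intro s
  induction s using Nat.strong_induction_on with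
  | _ s ih =>
    rw [H s, H' s]
    rw [qs_congr (mm β h q ζ) (mm β h q ζ') s (fun j hj => mm_congr β h q _ _ j (fun i hi => ih i (by omega))),
      ph_congr (mm β h q ζ) (mm β h q ζ') s (fun j hj => mm_congr β h q _ _ j (fun i hi => ih i (by omega)))]

def wst (W : Fin N → Fin N → ℝ) (φ : Fin N → ℝ) : Fin N → Fin N → ℝ := fun i j =>
    W i j - (mulVec N W φ i * φ j + φ i * mulVec N (fun i j => W j i) φ j
      - dotp N (mulVec N W φ) φ * φ i * φ j)

theorem dotp_transpose (W : Fin N → Fin N → ℝ) (u v : Fin N → ℝ) :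
    dotp N (mulVec N (fun i j => W j i) u) v = dotp N u (mulVec N W v) := by
  simp only [dotp, mulVec, Finset.mul_sum, Finset.sum_mul]
  rw [Finset.sum_comm]
  exact Finset.sum_congr rfl fun i _ => Finset.sum_congr rfl fun j _ => by ring

theorem wst_mulVec (W : Fin N → Fin N → ℝ) (φ v : Fin N → ℝ) : mulVec N (wst W φ) v = pj φ (mulVec N W (pj φ v)) := by
  have e : mulVec N (wst W φ) v = mulVec N W v - (dotp N φ v • mulVec N W φ + dotp N (mulVec N (fun i j => W j i) φ) v • φ
      - (dotp N (mulVec N W φ) φ * dotp N φ v) • φ) := by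
    funext i
    simp only [Pi.sub_apply, Pi.add_apply, Pi.smul_apply, smul_eq_mul]
    conv_lhs => simp only [mulVec]
    have : ∀ j, wst W φ i j * v j = W i j * v j - ((φ j * v j) * mulVec N W φ i + (mulVec N (fun i j => W j i) φ j * v j) * φ i
      - dotp N (mulVec N W φ) φ * φ i * (φ j * v j)) := fun j => by simp only [wst]; ring
    rw [Finset.sum_congr rfl fun j _ => this j, Finset.sum_sub_distrib, Finset.sum_sub_distrib, Finset.sum_add_distrib,
      ← Finset.sum_mul, ← Finset.sum_mul, ← Finset.mul_sum]
    simp only [dotp, mulVec]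
    ring
  rw [e, dotp_transpose]
  simp only [pj]
  rw [mulVec_sub, mulVec_smul, dotp_sub_right, dotp_smul_right, dotp_comm (mulVec N W φ) φ]
  funext i
  simp only [Pi.sub_apply, Pi.add_apply, Pi.smul_apply, smul_eq_mul]
  ring

theorem wst_transpose (W : Fin N → Fin N → ℝ) (φ : Fin N → ℝ) : (fun i j => wst W φ j i) = wst (fun i j => W j i) φ := by
  funext i j
  simp only [wst]
  have := dotp_transpose W φ φ
  rw [this, dotp_comm φ]
  ring

theorem symmG_mulVec (W : Fin N → Fin N → ℝ) (v : Fin N → ℝ) :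
    mulVec N (symmG N W) v = (√2)⁻¹ • (mulVec N W v + mulVec N (fun i j => W j i) v) := by
  funext i
  simp only [mulVec, symmG, Pi.smul_apply, Pi.add_apply, smul_eq_mul, ← Finset.sum_add_distrib, Finset.mul_sum]
  exact Finset.sum_congr rfl fun j _ => by ring

theorem pj_add (φ u v : Fin N → ℝ) : pj φ (u + v) = pj φ u + pj φ v := by
  simp only [pj, dotp_add_right, add_smul]; abel
theorem pj_smul (φ u : Fin N → ℝ) (c : ℝ) : pj φ (c • u) = c • pj φ u := by
  simp only [pj, dotp_smul_right, smul_sub, smul_smul]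

theorem symmG_wst (W : Fin N → Fin N → ℝ) (φ v : Fin N → ℝ) :
    mulVec N (symmG N (wst W φ)) v = pj φ (mulVec N (symmG N W) (pj φ v)) := by
  rw [symmG_mulVec, symmG_mulVec, wst_transpose, wst_mulVec, wst_mulVec, pj_smul, pj_add]

def rz (β h q : ℝ) (W : Fin N → Fin N → ℝ) (s : ℕ) : Fin N → ℝ := (tapState N β h q W s).zeta (s+1)

theorem sum_Icc_one (k : ℕ) (f : ℕ → ℝ) : ∑ s ∈ Finset.Icc 1 k, f s = ∑ j ∈ Finset.range k, f (j+1) := by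
  induction k with
  | zero => simp
  | succ k ih => rw [Finset.sum_Icc_succ_top (by omega), ih, Finset.sum_range_succ]

theorem tap_inv (β h q : ℝ) (hq : 0 < q) (W : Fin N → Fin N → ℝ) (k : ℕ) :
    (∀ j ≤ k, (tapState N β h q W k).zeta (j+1) = rz β h q W j) ∧
    (tapState N β h q W k).m = mm β h q (rz β h q W) k ∧
    (∀ j ≤ k, (tapState N β h q W k).phi (j+1) = ph (mm β h q (rz β h q W)) j) ∧
    (∀ v, mulVec N (symmG N (tapState N β h q W k).W) v = qs (mm β h q (rz β h q W)) k (mulVec N (symmG N W) (qs (mm β h q (rz β h q W)) k v))) ∧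
    rz β h q W k = √N • qs (mm β h q (rz β h q W)) k (mulVec N (symmG N W) (ph (mm β h q (rz β h q W)) k)) := by
  induction k with
  | zero =>
    have hphi : (fun _ : Fin N => (√(N:ℝ))⁻¹) = ph (mm β h q (rz β h q W)) 0 := by
      funext i
      simp only [ph, qs, nrm, mm, dotp, Finset.sum_const, Finset.card_univ, Fintype.card_fin, nsmul_eq_mul]
      rw [Real.mul_self_sqrt hq.le, Real.sqrt_mul (Nat.cast_nonneg N), mul_comm, ← div_div, div_self (Real.sqrt_pos.2 hq).ne', one_div]
    refine ⟨fun j hj => ?_, rfl, fun j hj => ?_, fun v => rfl, ?_⟩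
    · obtain rfl : j = 0 := by omega
      rfl
    · obtain rfl : j = 0 := by omega
      rw [← hphi]; simp [tapState, tapInit]
    · rw [← hphi]
      simp only [rz, tapState, tapInit, zero_add, if_true, qs]
      rw [← mulVec_smul]; rfl
  | succ k ih =>
    obtain ⟨i1, i2, i3, i4, i5⟩ := ih
    have c1 : ∀ j ≤ k + 1, (tapState N β h q W (k+1)).zeta (j+1) = rz β h q W j := by
      intro j hj
      by_cases hjk : j = k + 1
      · subst hjk; rfl
      · rw [← i1 j (by omega)]
        simp only [tapState, tapStep]
        rw [Function.update_of_ne (by omega)]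
    have c2 : (tapState N β h q W (k+1)).m = mm β h q (rz β h q W) (k+1) := by
      simp only [tapState, tapStep, mm, tf]
      funext i
      congr 2
      simp only [zv, Pi.add_apply, Finset.sum_apply, Pi.smul_apply, smul_eq_mul, Nat.add_sub_cancel]
      rw [i1 k le_rfl]
      congr 2
      rw [sum_Icc_one]
      exact Finset.sum_congr rfl fun j hj => by
        rw [i1 j (by simp at hj; omega)]; rfl
    have c3 : ∀ j ≤ k+1, (tapState N β h q W (k+1)).phi (j+1) = ph (mm β h q (rz β h q W)) j := by
      intro j hj
      by_cases hjk : j = k + 1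
      · subst hjk
        rw [ph, ← c2, qs_sum]
        have e : ∀ f : ℕ → Fin N → ℝ, (∀ j ≤ k, (tapState N β h q W k).phi (j+1) = f j) →
            (fun i => (tapState N β h q W (k+1)).m i - ∑ s ∈ Finset.Icc 1 (k+1), dotp N (tapState N β h q W (k+1)).m ((tapState N β h q W k).phi s) * (tapState N β h q W k).phi s i)
            = (tapState N β h q W (k+1)).m - ∑ j ∈ Finset.range (k+1), dotp N (f j) (tapState N β h q W (k+1)).m • f j := by
          intro f hf
          funext i
          simp only [Pi.sub_apply, Finset.sum_apply, Pi.smul_apply, smul_eq_mul]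
          rw [sum_Icc_one]
          congr 1
          exact Finset.sum_congr rfl fun j hj => by
            rw [hf j (by simp at hj; omega), dotp_comm]
        rw [← e _ i3]
        simp only [tapState, tapStep, Function.update_self]
        rfl
      · rw [← i3 j (by omega)]
        simp only [tapState, tapStep]
        rw [Function.update_of_ne (by omega)]
    have c4 : ∀ v, mulVec N (symmG N (tapState N β h q W (k+1)).W) v = qs (mm β h q (rz β h q W)) (k+1) (mulVec N (symmG N W) (qs (mm β h q (rz β h q W)) (k+1) v)) := by
      intro v
      have : (tapState N β h q W (k+1)).W = wst (tapState N β h q W k).W ((tapState N β h q W k).phi (k+1)) := rfl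
      rw [this, symmG_wst, i3 k le_rfl, i4, qs_pj, ← qs_succ]
    refine ⟨c1, c2, c3, c4, ?_⟩
    have : rz β h q W (k+1) = mulVec N (symmG N (tapState N β h q W (k+1)).W) (√N • (tapState N β h q W (k+1)).phi (k+2)) := by
      simp only [rz, tapState, tapStep, Function.update_self]
      rfl
    rw [this, c3 (k+1) le_rfl, mulVec_smul, c4, qs_ph_ge _ _ _ le_rfl]

theorem rz_Rel (β h q : ℝ) (hq : 0 < q) (W : Fin N → Fin N → ℝ) : Rel β h q (symmG N W) (rz β h q W) :=
  fun s => (tap_inv β h q hq W s).2.2.2.2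

theorem mTAP_eq (β h q : ℝ) (hq : 0 < q) (W : Fin N → Fin N → ℝ) (k : ℕ) : mTAP N β h q W (k+1) = mm β h q (rz β h q W) k :=
  (tap_inv β h q hq W k).2.1

theorem mTAP_symm (β h q : ℝ) (hq : 0 < q) (W W' : Fin N → Fin N → ℝ) (H : symmG N W = symmG N W') (k : ℕ) :
    mTAP N β h q W (k+1) = mTAP N β h q W' (k+1) := by
  rw [mTAP_eq β h q hq, mTAP_eq β h q hq]
  refine mm_congr β h q _ _ k fun j _ => Rel_unique β h q (symmG N W) _ _ (rz_Rel β h q hq W) ?_ j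
  rw [H]; exact rz_Rel β h q hq W'

theorem tap_meas (β h q : ℝ) (k : ℕ) :
    Measurable (fun W => (tapState N β h q W k).W) ∧ (∀ j, Measurable (fun W => (tapState N β h q W k).phi j)) ∧
    (∀ j, Measurable (fun W => (tapState N β h q W k).zeta j)) ∧ Measurable (fun W => (tapState N β h q W k).m) := by
  induction k with
  | zero =>
    simp only [tapState, tapInit]
    refine ⟨measurable_id, fun j => by fun_prop, fun j => ?_, by fun_prop⟩
    by_cases hj : j = 1
    · simp only [hj, if_true]; unfold mulVec symmG; fun_prop
    · simp only [hj, if_false]; fun_prop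
  | succ k ih =>
    obtain ⟨i1, i2, i3, i4⟩ := ih
    have i1' : ∀ i j, Measurable (fun W => (tapState N β h q W k).W i j) := fun i j =>
      measurable_pi_iff.1 (measurable_pi_iff.1 i1 i) j
    have i2' : ∀ s i, Measurable (fun W => (tapState N β h q W k).phi s i) := fun s i => measurable_pi_iff.1 (i2 s) i
    have i3' : ∀ s i, Measurable (fun W => (tapState N β h q W k).zeta s i) := fun s i => measurable_pi_iff.1 (i3 s) i
    have c1 : Measurable (fun W => (tapState N β h q W (k+1)).W) := by
      simp only [tapState, tapStep, mulVec, dotp]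
      fun_prop
    have c4 : Measurable (fun W => (tapState N β h q W (k+1)).m) := by
      simp only [tapState, tapStep]
      refine measurable_pi_iff.2 fun i => tanh_cont.measurable.comp ?_
      fun_prop
    have c4' : ∀ i, Measurable (fun W => (tapState N β h q W (k+1)).m i) := fun i => measurable_pi_iff.1 c4 i
    have c1' : ∀ i j, Measurable (fun W => (tapState N β h q W (k+1)).W i j) := fun i j =>
      measurable_pi_iff.1 (measurable_pi_iff.1 c1 i) j
    have c2 : ∀ j, Measurable (fun W => (tapState N β h q W (k+1)).phi j) := by
      intro j
      by_cases hj : j = k + 1 + 1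
      · have : (fun W => (tapState N β h q W (k+1)).phi j) = fun W => nrm (fun i =>
           (tapState N β h q W (k+1)).m i - ∑ s ∈ Finset.Icc 1 (k+1), dotp N (tapState N β h q W (k+1)).m ((tapState N β h q W k).phi s) * (tapState N β h q W k).phi s i) := by
          funext W
          subst hj
          simp only [tapState, tapStep, Function.update_self]
          rfl
        rw [this]
        unfold nrm dotp
        fun_prop
      · have : (fun W => (tapState N β h q W (k+1)).phi j) = fun W => (tapState N β h q W k).phi j := by
          funext W
          simp only [tapState, tapStep]
          rw [Function.update_of_ne hj]
        rw [this]; exact i2 j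
    have c2' : ∀ s i, Measurable (fun W => (tapState N β h q W (k+1)).phi s i) := fun s i => measurable_pi_iff.1 (c2 s) i
    refine ⟨c1, c2, fun j => ?_, c4⟩
    by_cases hj : j = k + 1 + 1
    · have : (fun W => (tapState N β h q W (k+1)).zeta j) = fun W =>
         mulVec N (symmG N (tapState N β h q W (k+1)).W) (fun i => √N * (tapState N β h q W (k+1)).phi (k+2) i) := by
        funext W
        subst hj
        simp only [tapState, tapStep, Function.update_self]
      rw [this]
      unfold mulVec symmG
      fun_prop
    · have : (fun W => (tapState N β h q W (k+1)).zeta j) = fun W => (tapState N β h q W k).zeta j := by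
        funext W
        simp only [tapState, tapStep]
        rw [Function.update_of_ne hj]
      rw [this]; exact i3 j

theorem mTAP_meas (β h q : ℝ) (k : ℕ) : Measurable (fun W => mTAP N β h q W k) := (tap_meas β h q (k-1)).2.2.2

end tap


/-- bounded continuous -/
def BC (F : ℝ → ℝ) : Prop := Continuous F ∧ ∃ C, ∀ x, |F x| ≤ C

theorem BC.nice {F : ℝ → ℝ} (h : BC F) {ι : Type*} [Fintype ι] (a : ι → ℝ) : Nice (fun y => F (lin a y)) := by
  obtain ⟨c, C, hC⟩ := h
  exact Nice.bdd (c.comp (lin_cont a)) C fun x => hC _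

theorem lin_upd_comp {κ : Type*} [Fintype κ] [DecidableEq κ] (a : κ → ℝ) (x : κ → ℝ) (k : κ) (F F' : ℝ → ℝ)
    (hd : ∀ x, HasDerivAt F (F' x) x) :
    HasDerivAt (fun t => F (lin a (Function.update x k t))) (a k * F' (lin a x)) (x k) := by
  have h1 := lin_update a x k
  have h2 : HasDerivAt F (F' (lin a x)) (lin a (Function.update x k (x k))) := by
    rw [Function.update_eq_self]; exact hd _
  have := HasDerivAt.comp (x k) h2 h1
  simp only [Function.comp_def] at this
  refine HasDerivAt.congr_deriv this ?_
  ring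

theorem lin_ibp {κ : Type*} [Fintype κ] [DecidableEq κ] (a : κ → ℝ) (k : κ) (F F' : ℝ → ℝ)
    (hd : ∀ x, HasDerivAt F (F' x) x) (hF : BC F) (hF' : BC F') :
    ∫ y, y k * F (lin a y) ∂(gm κ) = a k * ∫ y, F' (lin a y) ∂(gm κ) := by
  rw [ibp k (fun y => F (lin a y)) (fun y => a k * F' (lin a y)) (fun x => lin_upd_comp a x k F F' hd)
    (hF.nice a).int ((Nice.coord k).mul (hF.nice a)).int ((Nice.const _).mul (hF'.nice a)).int, integral_const_mul]

theorem lin_ibp2 {κ : Type*} [Fintype κ] [DecidableEq κ] (a : κ → ℝ) (s t : κ) (F F' F'' : ℝ → ℝ)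
    (hd : ∀ x, HasDerivAt F (F' x) x) (hd' : ∀ x, HasDerivAt F' (F'' x) x) (hF : BC F) (hF' : BC F') (hF'' : BC F'') :
    ∫ y, y s * (y t * F (lin a y)) ∂(gm κ) = (if s = t then ∫ y, F (lin a y) ∂(gm κ) else 0) + a s * a t * ∫ y, F'' (lin a y) ∂(gm κ) := by
  rw [ibp s (fun y => y t * F (lin a y)) (fun y => (if s = t then 1 else 0) * F (lin a y) + a s * (y t * F' (lin a y))) _
    ((Nice.coord t).mul (hF.nice a)).int ((Nice.coord s).mul ((Nice.coord t).mul (hF.nice a))).int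
    (((Nice.const _).mul (hF.nice a)).add ((Nice.const _).mul ((Nice.coord t).mul (hF'.nice a)))).int]
  · rw [integral_add ((Nice.const _).mul (hF.nice a)).int ((Nice.const _).mul ((Nice.coord t).mul (hF'.nice a))).int,
      integral_const_mul, integral_const_mul, lin_ibp a t F' F'' hd' hF' hF'']
    split_ifs <;> ring
  · intro x
    have h1 := lin_upd_comp a x s F F' hd
    have h2 : HasDerivAt (fun r => Function.update x s r t) (if s = t then 1 else 0) (x s) := by
      by_cases h : s = t
      · subst h; simpa using hasDerivAt_id' (x s)
      · simp only [Function.update_of_ne (Ne.symm h), h, if_false]; exact hasDerivAt_const _ _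
    have := h2.fun_mul h1
    refine HasDerivAt.congr_deriv this ?_
    simp only [Function.update_eq_self]
    ring

theorem tf_BC (β h : ℝ) : BC (tf β h) := ⟨tf_cont β h, 1, tf_abs β h⟩
theorem BC.mul {F G : ℝ → ℝ} (hF : BC F) (hG : BC G) : BC (fun x => F x * G x) := by
  obtain ⟨c, C, hC⟩ := hF
  obtain ⟨d, D, hD⟩ := hG
  refine ⟨c.mul d, C * D, fun x => ?_⟩
  rw [abs_mul]
  exact mul_le_mul (hC x) (hD x) (abs_nonneg _) ((abs_nonneg _).trans (hC x))
theorem BC.const (c : ℝ) : BC (fun _ => c) := ⟨by fun_prop, |c|, fun _ => le_rfl⟩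
theorem BC.add {F G : ℝ → ℝ} (hF : BC F) (hG : BC G) : BC (fun x => F x + G x) := by
  obtain ⟨c, C, hC⟩ := hF
  obtain ⟨d, D, hD⟩ := hG
  exact ⟨c.add d, C + D, fun x => (abs_add_le _ _).trans (add_le_add (hC x) (hD x))⟩
theorem BC.sub {F G : ℝ → ℝ} (hF : BC F) (hG : BC G) : BC (fun x => F x - G x) := by
  obtain ⟨c, C, hC⟩ := hF
  obtain ⟨d, D, hD⟩ := hG
  exact ⟨c.sub d, C + D, fun x => (abs_sub _ _).trans (add_le_add (hC x) (hD x))⟩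
theorem BC.pow {F : ℝ → ℝ} (hF : BC F) (n : ℕ) : BC (fun x => F x ^ n) := by
  induction n with
  | zero => simpa using BC.const 1
  | succ n ih => simpa [pow_succ] using ih.mul hF

def cf (β h q : ℝ) (s t : ℕ) : ℝ := if t < s then ga β h q t else if t = s then √(de β h q s) else 0

theorem cf_sum (β h q : ℝ) (K s : ℕ) (hs : s < K) (f : ℕ → ℝ) :
    ∑ t : Fin K, cf β h q s t * f t = ∑ j ∈ Finset.range s, ga β h q j * f j + √(de β h q s) * f s := by
  rw [Fin.sum_univ_eq_sum_range (fun t => cf β h q s t * f t) K]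
  rw [← Finset.sum_subset (Finset.range_subset_range.2 (show s + 1 ≤ K by omega))]
  · rw [Finset.sum_range_succ]
    congr 1
    · exact Finset.sum_congr rfl fun j hj => by
        rw [Finset.mem_range] at hj; simp [cf, hj]
    · simp [cf]
  · intro j _ hj
    simp only [Finset.mem_range, not_lt] at hj
    simp [cf, show ¬ j < s by omega, show ¬ j = s by omega]

theorem cf_gram (β h q : ℝ) (hβ : 0 < β) (hh : 0 < h) (hq : isFixedq β h q) (hAT : ATcond β h q) (K j k : ℕ) (hj : j ≤ k) (hk : k < K) :
    ∑ t : Fin K, cf β h q j t * cf β h q k t = if j = k then q else al β h q j := by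
  rw [cf_sum β h q K j (by omega)]
  have hd := de_pos hβ hh hq hAT j
  have e : ∑ t ∈ Finset.range j, ga β h q t * cf β h q k t = Gs β h q j := by
    rw [Gs_sum]
    refine Finset.sum_congr rfl fun t ht => ?_
    rw [Finset.mem_range] at ht
    rw [cf, if_pos (by omega)]; ring
  rw [e]
  split_ifs with h1
  · subst h1
    rw [cf, if_neg (by omega), if_pos rfl, mul_self_sqrt hd.le, de]; ring
  · rw [cf, if_pos (by omega), ga_eq hq.1, mul_div_cancel₀ _ (sqrt_pos.2 hd).ne']; ring

def Mf (β h q : ℝ) (K : ℕ) (k : ℕ) (y : Fin K → ℝ) : ℝ :=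
  match k with
  | 0 => √q
  | s + 1 => tf β h (lin (fun t : Fin K => cf β h q s t) y)

theorem zv_lin (β h q : ℝ) (N K s : ℕ) (hs : s < K) (x : Fin N × Fin K → ℝ) (i : Fin N) :
    zv β h q (gv x) s i = lin (fun t : Fin K => cf β h q s t) (fun t => x (i, t)) := by
  have := cf_sum β h q K s hs (fun t => gv x t i)
  simp only [zv, Pi.add_apply, Finset.sum_apply, Pi.smul_apply, smul_eq_mul]
  rw [← this, lin]
  refine Finset.sum_congr rfl fun t _ => ?_
  simp [gv]

theorem mm_Mf (β h q : ℝ) (N K s : ℕ) (hs : s ≤ K) (x : Fin N × Fin K → ℝ) (i : Fin N) :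
    mm β h q (gv x) s i = Mf β h q K s (fun t => x (i, t)) := by
  cases s with
  | zero => rfl
  | succ s => simp only [mm, Mf]; rw [zv_lin β h q N K s (by omega)]

theorem Mf_nice (β h q : ℝ) (K k : ℕ) : Nice (Mf β h q K k) := by
  cases k with
  | zero => exact Nice.const _
  | succ s => exact (tf_BC β h).nice _

theorem Mf_cov {β h q : ℝ} (hβ : 0 < β) (hh : 0 < h) (hq : isFixedq β h q) (hAT : ATcond β h q) (K j k : ℕ) (hj : j ≤ k) (hk : k ≤ K) :
    ∫ y, Mf β h q K j y * Mf β h q K k y ∂gm (Fin K) = if j = k then q else al β h q j := by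
  have hq0 := hq.1
  have gg : ∀ s < K, ∑ t : Fin K, cf β h q s t * cf β h q s t = q := fun s hs => by
    rw [cf_gram β h q hβ hh hq hAT K s s le_rfl hs, if_pos rfl]
  cases k with
  | zero =>
    obtain rfl : j = 0 := by omega
    simp [Mf, mul_self_sqrt hq0.le]
  | succ k =>
    cases j with
    | zero =>
      simp only [Mf]
      rw [integral_const_mul, one_law q hq0.le _ (gg k (by omega)) _ (tf_cont β h), if_neg (by omega), al_zero, gamma1_eq]
      rfl
    | succ j =>
      simp only [Mf]
      split_ifs with h1
      · obtain rfl : j = k := by omega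
        have := one_law q hq0.le _ (gg j (by omega)) (fun x => tf β h x * tf β h x) (by have := tf_cont β h; fun_prop)
        rw [this]
        have := q_eq hq
        simp only [E1, sq] at this
        exact this
      · have hs := (seq_facts hβ hh hq hAT j).1
        rw [psi_law β h q (al β h q j) hs.1 hs.2.le _ _ (gg j (by omega)) (gg k (by omega))
          (by rw [cf_gram β h q hβ hh hq hAT K j k (by omega) (by omega), if_neg (by omega)]), al_succ]

theorem Mf_coord {β h q : ℝ} (K j : ℕ) (k : Fin K) (hj : j ≤ k) :
    ∫ y, Mf β h q K j y * y k ∂gm (Fin K) = 0 := by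
  simp_rw [mul_comm]
  cases j with
  | zero =>
    simp only [Mf]
    rw [integral_mul_const]
    have := lin_mean (fun t : Fin K => if t = k then 1 else 0)
    simp [lin] at this
    rw [this, zero_mul]
  | succ j =>
    simp only [Mf]
    rw [lin_ibp _ k (tf β h) (fun x => β * (1 - tf β h x ^ 2)) (tf_deriv β h) (tf_BC β h)
      ((BC.const β).mul ((BC.const 1).sub ((tf_BC β h).pow 2)))]
    rw [cf, if_neg (by omega), if_neg (by omega), zero_mul]


abbrev Fl (K : ℕ) : Filter (Σ N : ℕ, (Fin N × Fin K → ℝ)) := whp (fun N => gm (Fin N × Fin K))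

theorem mm_cov_lim {β h q : ℝ} (hβ : 0 < β) (hh : 0 < h) (hq : isFixedq β h q) (hAT : ATcond β h q) (K j k : ℕ) (hj : j ≤ k) (hk : k ≤ K) :
    Tendsto (fun p : Σ N : ℕ, (Fin N × Fin K → ℝ) => dotp p.1 (mm β h q (gv p.2) j) (mm β h q (gv p.2) k) / p.1) (Fl K)
      (nhds (if j = k then q else al β h q j)) := by
  have := lln K ((Mf_nice β h q K j).mul (Mf_nice β h q K k))
  rw [Mf_cov hβ hh hq hAT K j k hj hk] at this
  refine this.congr fun p => ?_
  congr 1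
  refine Finset.sum_congr rfl fun i _ => ?_
  rw [mm_Mf β h q _ K j (by omega), mm_Mf β h q _ K k (by omega)]

theorem mm_g_lim {β h q : ℝ} (K j k : ℕ) (hj : j ≤ k) (hk : k < K) :
    Tendsto (fun p : Σ N : ℕ, (Fin N × Fin K → ℝ) => dotp p.1 (mm β h q (gv p.2) j) (gv p.2 k) / p.1) (Fl K)
      (nhds 0) := by
  have := lln K ((Mf_nice β h q K j).mul (Nice.coord (⟨k, hk⟩ : Fin K)))
  rw [Mf_coord K j ⟨k, hk⟩ hj] at this
  refine this.congr fun p => ?_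
  congr 1
  refine Finset.sum_congr rfl fun i _ => ?_
  rw [mm_Mf β h q _ K j (by omega)]
  simp [gv, hk]

theorem g_norm_lim (K k : ℕ) (hk : k < K) :
    Tendsto (fun p : Σ N : ℕ, (Fin N × Fin K → ℝ) => nr (gv p.2 k) / √p.1) (Fl K) (nhds 1) := by
  have := lln K ((Nice.coord (⟨k, hk⟩ : Fin K)).mul (Nice.coord (⟨k, hk⟩ : Fin K)))
  rw [coord_cov, if_pos rfl] at this
  have := (Real.continuous_sqrt.tendsto 1).comp this
  rw [Real.sqrt_one] at this
  refine this.congr fun p => ?_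
  simp only [Function.comp_def]
  rw [nr, ← Real.sqrt_div (dotp_self_nonneg _)]
  congr 2
  refine Finset.sum_congr rfl fun i _ => ?_
  simp [gv, hk]

theorem ph_dot {N : ℕ} (m : ℕ → Fin N → ℝ) (s : ℕ) (v : Fin N → ℝ) :
    dotp N (ph m s) v / √N = (dotp N (m s) v / N - ∑ j ∈ Finset.range s, (dotp N (ph m j) (m s) / √N) * (dotp N (ph m j) v / √N))
      / (nr (qs m s (m s)) / √N) := by
  have e : dotp N (ph m s) v = (nr (qs m s (m s)))⁻¹ * (dotp N (m s) v - ∑ j ∈ Finset.range s, dotp N (ph m j) (m s) * dotp N (ph m j) v) := by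
    rw [ph, nrm_eq, dotp_smul_left]
    congr 1
    rw [qs_sum, dotp_sub_left, dotp_sum_left]
    simp only [dotp_smul_left]
  have e2 : (N:ℝ) = √N * √N := (Real.mul_self_sqrt (Nat.cast_nonneg N)).symm
  have e3 : dotp N (m s) v / N - ∑ j ∈ Finset.range s, (dotp N (ph m j) (m s) / √N) * (dotp N (ph m j) v / √N)
     = (dotp N (m s) v - ∑ j ∈ Finset.range s, dotp N (ph m j) (m s) * dotp N (ph m j) v) / (√N * √N) := by
    rw [← e2, sub_div, Finset.sum_div]
    congr 1
    refine Finset.sum_congr rfl fun j _ => ?_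
    rw [div_mul_div_comm, ← e2]
  rw [e, e3]
  generalize √(N:ℝ) = a
  by_cases ha : a = 0
  · simp [ha]
  by_cases hb : nr (qs m s (m s)) = 0
  · simp [hb]
  field_simp

theorem nr_qs_div {N : ℕ} (m : ℕ → Fin N → ℝ) (s : ℕ) (v : Fin N → ℝ) :
    nr (qs m s v) / √N = √(dotp N v v / N - ∑ j ∈ Finset.range s, (dotp N (ph m j) v / √N) ^ 2) := by
  have e2 : √(N:ℝ)^2 = N := (Real.sq_sqrt (Nat.cast_nonneg N))
  have : nr (qs m s v) / √N = √((nr (qs m s v) / √N)^2) := (Real.sqrt_sq (div_nonneg (nr_nonneg _) (Real.sqrt_nonneg _))).symm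
  rw [this]
  congr 1
  rw [div_pow, qs_nr, sub_div, e2, nr_sq, Finset.sum_div]
  congr 1
  exact Finset.sum_congr rfl fun j _ => by rw [div_pow, e2]

theorem GS {β h q : ℝ} (hβ : 0 < β) (hh : 0 < h) (hq : isFixedq β h q) (hAT : ATcond β h q) (K : ℕ) (s : ℕ) (hs : s ≤ K) :
    Tendsto (fun p : Σ N : ℕ, (Fin N × Fin K → ℝ) => nr (qs (mm β h q (gv p.2)) s (mm β h q (gv p.2) s)) / √p.1) (Fl K) (nhds (√(de β h q s))) ∧
    (∀ k, s < k → k ≤ K → Tendsto (fun p : Σ N : ℕ, (Fin N × Fin K → ℝ) => dotp p.1 (ph (mm β h q (gv p.2)) s) (mm β h q (gv p.2) k) / √p.1) (Fl K) (nhds (ga β h q s))) ∧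
    (∀ k, s ≤ k → k < K → Tendsto (fun p : Σ N : ℕ, (Fin N × Fin K → ℝ) => dotp p.1 (ph (mm β h q (gv p.2)) s) (gv p.2 k) / √p.1) (Fl K) (nhds 0)) := by
  induction s using Nat.strong_induction_on with
  | _ s ih =>
    have hd := de_pos hβ hh hq hAT s
    have hd' := (Real.sqrt_pos.2 hd).ne'
    have c1 : Tendsto (fun p : Σ N : ℕ, (Fin N × Fin K → ℝ) => nr (qs (mm β h q (gv p.2)) s (mm β h q (gv p.2) s)) / √p.1) (Fl K) (nhds (√(de β h q s))) := by
      simp_rw [nr_qs_div]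
      refine (Real.continuous_sqrt.tendsto _).comp ?_
      have a1 := mm_cov_lim hβ hh hq hAT K s s le_rfl hs
      rw [if_pos rfl] at a1
      rw [de, Gs_sum]
      refine a1.sub (tendsto_finsetSum _ fun j hj => ?_)
      rw [Finset.mem_range] at hj
      exact ((ih j hj (by omega)).2.1 s hj hs).pow 2
    refine ⟨c1, fun k hk hkK => ?_, fun k hk hkK => ?_⟩
    · simp_rw [ph_dot _ s]
      rw [ga_eq hq.1]
      refine Tendsto.div ?_ c1 hd'
      have a1 := mm_cov_lim hβ hh hq hAT K s k hk.le hkK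
      rw [if_neg (by omega)] at a1
      rw [Gs_sum]
      refine a1.sub (tendsto_finsetSum _ fun j hj => ?_)
      rw [Finset.mem_range] at hj
      rw [sq]
      exact ((ih j hj (by omega)).2.1 s hj hs).mul ((ih j hj (by omega)).2.1 k (by omega) hkK)
    · simp_rw [ph_dot _ s]
      have e : (0:ℝ) = (0 - ∑ j ∈ Finset.range s, ga β h q j * 0) / √(de β h q s) := by simp
      rw [e]
      refine Tendsto.div ?_ c1 hd'
      refine (mm_g_lim K s k hk hkK).sub (tendsto_finsetSum _ fun j hj => ?_)
      rw [Finset.mem_range] at hj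
      exact ((ih j hj (by omega)).2.1 s hj hs).mul ((ih j hj (by omega)).2.2 k (by omega) hkK)


theorem mm_meas (β h q : ℝ) (N K s : ℕ) : Measurable (fun x : Fin N × Fin K → ℝ => mm β h q (gv x) s) := by
  cases s with
  | zero => simp only [mm]; fun_prop
  | succ s =>
    simp only [mm]
    refine measurable_pi_iff.2 fun i => (tf_cont β h).measurable.comp ?_
    have hg : ∀ j, Measurable (fun x : Fin N × Fin K → ℝ => gv x j i) := fun j => measurable_pi_iff.1 (gv_meas j) i
    simp only [zv, Pi.add_apply, Finset.sum_apply, Pi.smul_apply, smul_eq_mul]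
    fun_prop

theorem ph_meas {N : ℕ} {X : Type*} [MeasurableSpace X] (m : X → ℕ → Fin N → ℝ) (hm : ∀ s, Measurable (fun x => m x s)) (s : ℕ) :
    Measurable (fun x => ph (m x) s) ∧ ∀ v : X → Fin N → ℝ, Measurable v → Measurable (fun x => qs (m x) s (v x)) := by
  have mnrm : Measurable (nrm : (Fin N → ℝ) → Fin N → ℝ) := by unfold nrm dotp; fun_prop
  have mpj : Measurable (fun p : (Fin N → ℝ) × (Fin N → ℝ) => pj p.1 p.2) := by
    unfold pj dotp
    refine measurable_pi_iff.2 fun i => ?_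
    simp only [Pi.sub_apply, Pi.smul_apply, smul_eq_mul]
    fun_prop
  have : ∀ s, ∀ v : X → Fin N → ℝ, Measurable v → Measurable (fun x => qs (m x) s (v x)) := by
    intro s
    induction s with
    | zero => exact fun v hv => hv
    | succ s ih =>
      intro v hv
      simp only [qs]
      exact mpj.comp ((mnrm.comp (ih _ (hm s))).prodMk (ih v hv))
  exact ⟨mnrm.comp (this s _ (hm s)), this s⟩

def YP (K N : ℕ) : Type := (Fin N × Fin K → ℝ) × (Fin N → Fin N → ℝ)
instance (K N : ℕ) : MeasurableSpace (YP K N) := inferInstanceAs (MeasurableSpace ((Fin N × Fin K → ℝ) × (Fin N → Fin N → ℝ)))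
def muP (K N : ℕ) : Measure (YP K N) := (gm (Fin N × Fin K)).prod (goe N)
abbrev FP (K : ℕ) : Filter (Σ N : ℕ, YP K N) := whp (muP K)

def Bp (β h q : ℝ) {K N : ℕ} (n : ℕ) (y : YP K N) : Fin N → Fin N → ℝ := Bm (ph (mm β h q (gv y.1))) (gv y.1) n y.2

theorem FP_fst (K : ℕ) : Tendsto (fun p : Σ N : ℕ, YP K N => (⟨p.1, p.2.1⟩ : Σ N : ℕ, (Fin N × Fin K → ℝ))) (FP K) (Fl K) :=
  whp_map (muP K) (fun N => gm (Fin N × Fin K)) (fun N (y : YP K N) => y.1) (fun N => measurePreserving_fst)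

theorem mm_upd (β h q : ℝ) {N K : ℕ} (s : Fin K) (x : Fin N × Fin K → ℝ) (y : Fin N → ℝ) (j : ℕ) (hj : j ≤ s) :
    mm β h q (gv (upd s x y)) j = mm β h q (gv x) j :=
  mm_congr β h q _ _ j fun i hi => gv_upd_ne x y s i (by omega)

theorem Bp_mp (β h q : ℝ) (K n N : ℕ) (hn : n ≤ K) : MeasurePreserving (Bp β h q n) (muP K N) (goe N) := by
  refine B_law N K (fun x => ph (mm β h q (gv x))) (fun s => (ph_meas (X := Fin N × Fin K → ℝ) (fun x => mm β h q (gv x)) (mm_meas β h q N K) s).1)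
    (fun x s => ph_uz _ _) (fun s x y j hj => ph_congr _ _ j fun i hi => mm_upd β h q s x y i (by omega)) n hn

theorem FP_B (β h q : ℝ) (K n : ℕ) (hn : n ≤ K) :
    Tendsto (fun p : Σ N : ℕ, YP K N => (⟨p.1, Bp β h q n p.2⟩ : Σ N : ℕ, (Fin N → Fin N → ℝ))) (FP K) (whp goe) :=
  whp_map (muP K) goe (fun N => Bp β h q n) (fun N => Bp_mp β h q K n N hn)

def od {N : ℕ} (M : Fin N → Fin N → ℝ) : Fin N → Fin N → ℝ := fun i j => if i = j then 0 else M i j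

theorem od_diff {N : ℕ} (M : Fin N → Fin N → ℝ) (ε : ℝ) (hε : 0 ≤ ε) (h : ∀ i, |M i i| ≤ ε) (v : Fin N → ℝ) :
    nr (mulVec N (od M) v - mulVec N M v) ≤ ε * nr v := by
  have e : mulVec N (od M) v - mulVec N M v = fun i => - M i i * v i := by
    funext i
    simp only [Pi.sub_apply, mulVec, ← Finset.sum_sub_distrib]
    rw [Finset.sum_eq_single i]
    · simp [od]
    · intro j _ hj; simp [od, Ne.symm hj]
    · simp
  rw [e, ← abs_of_nonneg hε, ← nr_smul]
  refine nr_mono fun i => ?_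
  rw [abs_mul, abs_neg, Pi.smul_apply, smul_eq_mul, abs_mul, abs_of_nonneg hε]
  exact mul_le_mul_of_nonneg_right (h i) (abs_nonneg _)

theorem qs_diff {N : ℕ} (m m' : ℕ → Fin N → ℝ) (s : ℕ) (v : Fin N → ℝ) :
    nr (qs m s v - qs m' s v) ≤ (2 * ∑ j ∈ Finset.range s, nr (ph m j - ph m' j)) * nr v := by
  have e : qs m s v - qs m' s v = ∑ j ∈ Finset.range s, (dotp N (ph m' j) v • (ph m' j - ph m j) - dotp N (ph m j - ph m' j) v • ph m j) := by
    rw [qs_sum, qs_sum, sub_sub_sub_cancel_left, ← Finset.sum_sub_distrib]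
    refine Finset.sum_congr rfl fun j _ => ?_
    rw [dotp_sub_left, smul_sub, sub_smul]; abel
  rw [e, Finset.mul_sum, Finset.sum_mul]
  refine (nr_sum_le _ _).trans (Finset.sum_le_sum fun j _ => ?_)
  refine (nr_sub_le _ _).trans ?_
  rw [nr_smul, nr_smul, nr_sub_comm]
  have h1 := abs_dotp_le (ph m' j) v
  have h2 := abs_dotp_le (ph m j - ph m' j) v
  have h3 := nr_uz _ (ph_uz m j)
  have h4 := nr_uz _ (ph_uz m' j)
  have h5 := nr_nonneg v
  have h6 := nr_nonneg (ph m j - ph m' j)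
  have h7 := nr_nonneg (ph m j)
  have : |dotp N (ph m' j) v| ≤ nr v := h1.trans (mul_le_of_le_one_left h5 h4)
  have a1 : |dotp N (ph m' j) v| * nr (ph m j - ph m' j) ≤ nr v * nr (ph m j - ph m' j) := mul_le_mul_of_nonneg_right this h6
  have a2 : |dotp N (ph m j - ph m' j) v| * nr (ph m j) ≤ nr (ph m j - ph m' j) * nr v * 1 :=
    mul_le_mul h2 h3 h7 (by positivity)
  linarith

theorem nrm_diff {N : ℕ} (w v : Fin N → ℝ) (hv : 0 < nr v) : nr (nrm w - nrm v) ≤ 2 * (nr (w - v) / nr v) := by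
  rw [nrm_eq, nrm_eq]
  by_cases hw : nr w = 0
  · rw [hw, inv_zero, zero_smul, nr_sub_comm, sub_zero, nr_smul, abs_of_nonneg (inv_nonneg.2 hv.le), inv_mul_cancel₀ hv.ne']
    have := nr_abs_sub_le w v
    rw [hw, zero_sub, abs_neg, abs_of_pos hv] at this
    have : 1 ≤ nr (w - v) / nr v := (one_le_div hv).2 this
    linarith
  · have hw' : 0 < nr w := lt_of_le_of_ne (nr_nonneg w) (Ne.symm hw)
    have e : (nr w)⁻¹ • w - (nr v)⁻¹ • v = (nr v)⁻¹ • (w - v) + ((nr w)⁻¹ - (nr v)⁻¹) • w := by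
      rw [smul_sub, sub_smul]; abel
    rw [e]
    refine (nr_add_le _ _).trans ?_
    rw [nr_smul, nr_smul, abs_of_pos (inv_pos.2 hv)]
    have : |(nr w)⁻¹ - (nr v)⁻¹| * nr w = |nr w - nr v| / nr v := by
      have : (nr w)⁻¹ - (nr v)⁻¹ = -(nr w - nr v) / (nr w * nr v) := by field_simp; ring
      rw [this, abs_div, abs_neg, abs_of_pos (mul_pos hw' hv)]
      field_simp
    rw [this]
    have h2 := div_le_div_of_nonneg_right (nr_abs_sub_le w v) hv.le
    rw [inv_mul_eq_div]; linarith

theorem nr_bdd {N : ℕ} (v : Fin N → ℝ) (h : ∀ i, |v i| ≤ 1) : nr v ≤ √N := by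
  rw [nr]
  refine Real.sqrt_le_sqrt ?_
  calc dotp N v v ≤ ∑ i : Fin N, (1:ℝ) := Finset.sum_le_sum fun i _ => by
        have := h i
        rw [← abs_mul_abs_self]; nlinarith [abs_nonneg (v i)]
    _ = N := by simp

theorem mm_abs (β h q : ℝ) (hq : q < 1) {N : ℕ} (g : ℕ → Fin N → ℝ) (s : ℕ) (i : Fin N) : |mm β h q g s i| ≤ 1 := by
  cases s with
  | zero => simp only [mm]; rw [abs_of_nonneg (Real.sqrt_nonneg _)]; exact Real.sqrt_le_iff.2 ⟨by norm_num, by nlinarith⟩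
  | succ s => exact tf_abs _ _ _

theorem zv_diff (β h q : ℝ) {N : ℕ} (g g' : ℕ → Fin N → ℝ) (s : ℕ) :
    nr (zv β h q g s - zv β h q g' s) ≤ ∑ j ∈ Finset.range s, |ga β h q j| * nr (g j - g' j) + √(de β h q s) * nr (g s - g' s) := by
  have e : zv β h q g s - zv β h q g' s = ∑ j ∈ Finset.range s, ga β h q j • (g j - g' j) + √(de β h q s) • (g s - g' s) := by
    simp only [zv, smul_sub, Finset.sum_sub_distrib]; abel
  rw [e]
  refine (nr_add_le _ _).trans (add_le_add ((nr_sum_le _ _).trans (Finset.sum_le_sum fun j _ => ?_)) ?_)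
  · rw [nr_smul]
  · rw [nr_smul, abs_of_nonneg (Real.sqrt_nonneg _)]

theorem mm_diff (β h q : ℝ) (hβ : 0 < β) {N : ℕ} (g g' : ℕ → Fin N → ℝ) (s : ℕ) :
    nr (mm β h q g (s+1) - mm β h q g' (s+1)) ≤ β * nr (zv β h q g s - zv β h q g' s) := by
  rw [← abs_of_pos hβ, ← nr_smul, abs_of_pos hβ]
  refine nr_mono fun i => ?_
  simp only [mm, Pi.sub_apply, Pi.smul_apply, smul_eq_mul, abs_mul, abs_of_pos hβ]
  exact tf_lip β h hβ _ _


theorem squeeze_eps {X : Type*} {l : Filter X} {f R : X → ℝ} (h0 : ∀ x, 0 ≤ f x) (hR : Tendsto R l (nhds 0))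
    (h : ∀ ε > 0, ∀ᶠ x in l, f x ≤ ε + R x) : Tendsto f l (nhds 0) := by
  rw [Metric.tendsto_nhds]
  intro ε hε
  filter_upwards [h (ε/2) (by positivity), (Metric.tendsto_nhds.1 hR) (ε/2) (by positivity)] with x h1 h2
  rw [Real.dist_eq, sub_zero] at h2 ⊢
  rw [abs_of_nonneg (h0 x)]
  linarith [le_abs_self (R x)]

theorem cmp_zeta {β h q : ℝ} {N : ℕ} (hN : 0 < N) (ζ g : ℕ → Fin N → ℝ) (n s : ℕ) (hs : s < n) (M : Fin N → Fin N → ℝ) (ε : ℝ) (hε : 0 ≤ ε)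
    (hB : gdM N ε (Bm (ph (mm β h q g)) g n M)) (hR : Rel β h q (od (Bm (ph (mm β h q g)) g n M)) ζ)
    (h1 : dotp N (ph (mm β h q g) s) (ph (mm β h q g) s) = 1) :
    nr (ζ s - g s) / √N ≤ ε + (3 * nr (ph (mm β h q ζ) s - ph (mm β h q g) s)
      + 6 * ∑ j ∈ Finset.range s, nr (ph (mm β h q ζ) j - ph (mm β h q g) j)
      + 3 * ∑ j ∈ Finset.range (s+1), |dotp N (ph (mm β h q g) j) (g s) / √N|) := by
  have hb := Bm_phi (mm β h q g) g hN n s hs h1 M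
  set m := mm β h q ζ
  set m' := mm β h q g
  set B := Bm (ph m') g n M
  have hN' : (0:ℝ) < √N := Real.sqrt_pos.2 (by exact_mod_cast hN)
  have e : ζ s - g s = √N • qs m s (mulVec N (od B) (ph m s) - mulVec N B (ph m s))
      + √N • qs m s (mulVec N B (ph m s - ph m' s))
      + √N • (qs m s (mulVec N B (ph m' s)) - qs m' s (mulVec N B (ph m' s)))
      + (√N • qs m' s (mulVec N B (ph m' s)) - g s) := by
    rw [hR s, mulVec_sub, qs_sub, qs_sub]
    simp only [smul_sub]
    abel
  have a1 : nr (√N • qs m s (mulVec N (od B) (ph m s) - mulVec N B (ph m s))) ≤ √N * ε := by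
    rw [nr_smul, abs_of_pos hN']
    refine mul_le_mul_of_nonneg_left ?_ hN'.le
    refine (qs_nr_le _ _ _).trans ((od_diff B ε hε hB.2.2 _).trans ?_)
    exact mul_le_of_le_one_right hε (nr_uz _ (ph_uz m s))
  have a2 : nr (√N • qs m s (mulVec N B (ph m s - ph m' s))) ≤ √N * (3 * nr (ph m s - ph m' s)) := by
    rw [nr_smul, abs_of_pos hN']
    exact mul_le_mul_of_nonneg_left ((qs_nr_le _ _ _).trans (hB.2.1 _)) hN'.le
  have a3 : nr (√N • (qs m s (mulVec N B (ph m' s)) - qs m' s (mulVec N B (ph m' s)))) ≤ √N * (6 * ∑ j ∈ Finset.range s, nr (ph m j - ph m' j)) := by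
    rw [nr_smul, abs_of_pos hN']
    refine mul_le_mul_of_nonneg_left ((qs_diff _ _ _ _).trans ?_) hN'.le
    have h2 := hB.2.1 (ph m' s)
    have h3 := nr_uz _ (ph_uz m' s)
    have h4 : 0 ≤ ∑ j ∈ Finset.range s, nr (ph m j - ph m' j) := Finset.sum_nonneg fun _ _ => nr_nonneg _
    nlinarith
  have a4 : 3 * ∑ j ∈ Finset.range (s+1), |dotp N (ph m' j) (g s)| = √N * (3 * ∑ j ∈ Finset.range (s+1), |dotp N (ph m' j) (g s) / √N|) := by
    simp only [abs_div, abs_of_pos hN']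
    rw [← Finset.sum_div]; field_simp
  rw [a4] at hb
  rw [div_le_iff₀ hN', e]
  have t1 := nr_add_le (√N • qs m s (mulVec N (od B) (ph m s) - mulVec N B (ph m s))
      + √N • qs m s (mulVec N B (ph m s - ph m' s))
      + √N • (qs m s (mulVec N B (ph m' s)) - qs m' s (mulVec N B (ph m' s)))) (√N • qs m' s (mulVec N B (ph m' s)) - g s)
  have t2 := nr_add_le (√N • qs m s (mulVec N (od B) (ph m s) - mulVec N B (ph m s))
      + √N • qs m s (mulVec N B (ph m s - ph m' s)))
      (√N • (qs m s (mulVec N B (ph m' s)) - qs m' s (mulVec N B (ph m' s))))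
  have t3 := nr_add_le (√N • qs m s (mulVec N (od B) (ph m s) - mulVec N B (ph m s)))
      (√N • qs m s (mulVec N B (ph m s - ph m' s)))
  linarith

theorem cmp_ph {N : ℕ} (m m' : ℕ → Fin N → ℝ) (s : ℕ) (hm : ∀ i, |m' s i| ≤ 1) (hN : 0 < N) (hp : 0 < nr (qs m' s (m' s))) :
    nr (ph m s - ph m' s) ≤ 2 * ((nr (m s - m' s) / √N + 2 * ∑ j ∈ Finset.range s, nr (ph m j - ph m' j)) / (nr (qs m' s (m' s)) / √N)) := by
  have hN' : (0:ℝ) < √N := Real.sqrt_pos.2 (by exact_mod_cast hN)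
  refine (nrm_diff _ _ hp).trans (mul_le_mul_of_nonneg_left ?_ (by norm_num))
  rw [div_div_eq_mul_div]
  refine div_le_div_of_nonneg_right ?_ hp.le
  have e : qs m s (m s) - qs m' s (m' s) = qs m s (m s - m' s) + (qs m s (m' s) - qs m' s (m' s)) := by rw [qs_sub]; abel
  rw [e]
  refine (nr_add_le _ _).trans ?_
  rw [add_mul, div_mul_cancel₀ _ hN'.ne']
  refine add_le_add (qs_nr_le _ _ _) ((qs_diff _ _ _ _).trans ?_)
  refine mul_le_mul_of_nonneg_left (nr_bdd _ hm) ?_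
  exact mul_nonneg (by norm_num) (Finset.sum_nonneg fun _ _ => nr_nonneg _)

theorem uz_one {N : ℕ} (m : ℕ → Fin N → ℝ) (s : ℕ) (hp : 0 < nr (qs m s (m s))) : dotp N (ph m s) (ph m s) = 1 := by
  rw [← nr_sq, ph, nrm_eq, nr_smul, abs_of_pos (inv_pos.2 hp), inv_mul_cancel₀ hp.ne', one_pow]

theorem zv_lim {X : Type*} {l : Filter X} (β h q : ℝ) (Nf : X → ℕ) (ζ g : ∀ x, ℕ → Fin (Nf x) → ℝ) (s : ℕ)
    (H : ∀ j ≤ s, Tendsto (fun x => nr (ζ x j - g x j) / √(Nf x)) l (nhds 0)) :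
    Tendsto (fun x => nr (zv β h q (ζ x) s - zv β h q (g x) s) / √(Nf x)) l (nhds 0) := by
  have lim : Tendsto (fun x => ∑ j ∈ Finset.range s, |ga β h q j| * (nr (ζ x j - g x j) / √(Nf x)) + √(de β h q s) * (nr (ζ x s - g x s) / √(Nf x))) l
      (nhds (∑ j ∈ Finset.range s, |ga β h q j| * 0 + √(de β h q s) * 0)) := by
    refine Tendsto.add (tendsto_finsetSum _ fun j hj => ?_) ?_
    · exact (H j (by simp at hj; omega)).const_mul _
    · exact (H s le_rfl).const_mul _
  simp only [mul_zero, Finset.sum_const_zero, add_zero] at lim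
  refine squeeze_zero (fun x => div_nonneg (nr_nonneg _) (Real.sqrt_nonneg _)) (fun x => ?_) lim
  refine (div_le_div_of_nonneg_right (zv_diff β h q (ζ x) (g x) s) (Real.sqrt_nonneg _)).trans (le_of_eq ?_)
  rw [add_div, Finset.sum_div]
  simp only [mul_div_assoc]

theorem cmp_all {β h q : ℝ} (hβ : 0 < β) (hh : 0 < h) (hq : isFixedq β h q) (hAT : ATcond β h q) (K n : ℕ) (hn : n ≤ K)
    (ζ : ∀ p : Σ N : ℕ, YP K N, ℕ → Fin p.1 → ℝ)
    (hR : ∀ᶠ p in FP K, Rel β h q (od (Bp β h q n p.2)) (ζ p)) (s : ℕ) (hs : s < n) :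
    Tendsto (fun p => nr (ζ p s - gv p.2.1 s) / √p.1) (FP K) (nhds 0) ∧
    Tendsto (fun p => nr (ph (mm β h q (ζ p)) s - ph (mm β h q (gv p.2.1)) s)) (FP K) (nhds 0) := by
  induction s using Nat.strong_induction_on with
  | _ s ih =>
    have hd := Real.sqrt_pos.2 (de_pos hβ hh hq hAT s)
    have gs := GS hβ hh hq hAT K s (by omega)
    have gs1 := gs.1.comp (FP_fst K)
    simp only [Function.comp_def] at gs1
    have hNpos : ∀ᶠ p : Σ N : ℕ, YP K N in FP K, 0 < p.1 := (whp_fst (muP K)).eventually (eventually_gt_atTop 0)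
    have hpos : ∀ᶠ p : Σ N : ℕ, YP K N in FP K, 0 < nr (qs (mm β h q (gv p.2.1)) s (mm β h q (gv p.2.1) s)) := by
      filter_upwards [gs1.eventually (lt_mem_nhds hd)] with p hp
      by_contra hc
      have : nr (qs (mm β h q (gv p.2.1)) s (mm β h q (gv p.2.1) s)) = 0 := le_antisymm (not_lt.1 hc) (nr_nonneg _)
      rw [this, zero_div] at hp
      exact lt_irrefl _ hp
    have hmd : Tendsto (fun p : Σ N : ℕ, YP K N => nr (mm β h q (ζ p) s - mm β h q (gv p.2.1) s) / √p.1) (FP K) (nhds 0) := by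
      cases s with
      | zero =>
        refine tendsto_const_nhds.congr fun p => ?_
        simp [mm, nr_zero]
      | succ s =>
        have := (zv_lim β h q (fun p : Σ N : ℕ, YP K N => p.1) ζ (fun p => gv p.2.1) s (l := FP K) (fun j hj => (ih j (by omega) (by omega)).1)).const_mul β
        rw [mul_zero] at this
        refine squeeze_zero (fun x => div_nonneg (nr_nonneg _) (Real.sqrt_nonneg _)) (fun p => ?_) this
        rw [← mul_div_assoc]
        exact div_le_div_of_nonneg_right (mm_diff β h q hβ _ _ s) (Real.sqrt_nonneg _)
    have hS : Tendsto (fun p : Σ N : ℕ, YP K N => ∑ j ∈ Finset.range s, nr (ph (mm β h q (ζ p)) j - ph (mm β h q (gv p.2.1)) j)) (FP K) (nhds 0) := by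
      have : Tendsto (fun p : Σ N : ℕ, YP K N => ∑ j ∈ Finset.range s, nr (ph (mm β h q (ζ p)) j - ph (mm β h q (gv p.2.1)) j)) (FP K)
          (nhds (∑ j ∈ Finset.range s, 0)) := by
        refine tendsto_finsetSum _ fun j hj => ?_
        rw [Finset.mem_range] at hj
        exact (ih j hj (by omega)).2
      simpa using this
    have hphi : Tendsto (fun p : Σ N : ℕ, YP K N => nr (ph (mm β h q (ζ p)) s - ph (mm β h q (gv p.2.1)) s)) (FP K) (nhds 0) := by
      have := ((hmd.add (hS.const_mul 2)).div gs1 hd.ne').const_mul 2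
      simp only [mul_zero, add_zero, zero_div] at this
      refine squeeze_zero' (Eventually.of_forall fun x => nr_nonneg _) ?_ this
      filter_upwards [hpos, hNpos] with p h1 h2
      exact cmp_ph _ _ s (fun i => mm_abs β h q hq.2.1 _ _ _) h2 h1
    refine ⟨?_, hphi⟩
    have hG : Tendsto (fun p : Σ N : ℕ, YP K N => ∑ j ∈ Finset.range (s+1), |dotp p.1 (ph (mm β h q (gv p.2.1)) j) (gv p.2.1 s) / √p.1|) (FP K) (nhds 0) := by
      have : Tendsto (fun p : Σ N : ℕ, YP K N => ∑ j ∈ Finset.range (s+1), |dotp p.1 (ph (mm β h q (gv p.2.1)) j) (gv p.2.1 s) / √p.1|) (FP K)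
          (nhds (∑ j ∈ Finset.range (s+1), |(0:ℝ)|)) := by
        refine tendsto_finsetSum _ fun j hj => ?_
        rw [Finset.mem_range] at hj
        have := (((GS hβ hh hq hAT K j (by omega)).2.2 s (by omega) (by omega)).comp (FP_fst K)).abs
        exact this
      simpa using this
    refine squeeze_eps (fun x => div_nonneg (nr_nonneg _) (Real.sqrt_nonneg _)) (R := fun p =>
      3 * nr (ph (mm β h q (ζ p)) s - ph (mm β h q (gv p.2.1)) s)
      + 6 * ∑ j ∈ Finset.range s, nr (ph (mm β h q (ζ p)) j - ph (mm β h q (gv p.2.1)) j)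
      + 3 * ∑ j ∈ Finset.range (s+1), |dotp p.1 (ph (mm β h q (gv p.2.1)) j) (gv p.2.1 s) / √p.1|) ?_ ?_
    · have := ((hphi.const_mul 3).add (hS.const_mul 6)).add (hG.const_mul 3)
      simpa using this
    · intro ε hε
      filter_upwards [hpos, hNpos, (FP_B β h q K n hn).eventually (goe_good ε hε), hR] with p h1 h2 h3 h4
      exact cmp_zeta h2 (ζ p) (gv p.2.1) n s hs p.2.2 ε hε.le h3 h4 (uz_one _ _ h1)


def Ev (β h q c : ℝ) (k N : ℕ) (W : Fin N → Fin N → ℝ) : Prop :=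
  ∀ u : Fin N → ℝ,
            c * (∑ i, u i ^ 2) ≤
              dotp N u (mulVec N (fun i j =>
                (if i = j then (1 - mTAP N β h q W k i ^ 2)⁻¹ else 0)
                  + β ^ 2 * (1 - q) * (if i = j then 1 else 0)
                  - 2 * β ^ 2 / N * (mTAP N β h q W k i * mTAP N β h q W k j)
                  - β * symmG N W i j) u)

theorem Ev_meas (β h q c : ℝ) (k N : ℕ) : MeasurableSet {W | Ev β h q c k N W} := by
  have e : {W | Ev β h q c k N W} = ⋂ t : ℕ, {W : Fin N → Fin N → ℝ | c * (∑ i, TopologicalSpace.denseSeq (Fin N → ℝ) t i ^ 2) ≤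
              dotp N (TopologicalSpace.denseSeq (Fin N → ℝ) t) (mulVec N (fun i j =>
                (if i = j then (1 - mTAP N β h q W k i ^ 2)⁻¹ else 0)
                  + β ^ 2 * (1 - q) * (if i = j then 1 else 0)
                  - 2 * β ^ 2 / N * (mTAP N β h q W k i * mTAP N β h q W k j)
                  - β * symmG N W i j) (TopologicalSpace.denseSeq (Fin N → ℝ) t))} := by
    ext W
    simp only [Set.mem_iInter, Set.mem_ofPred_eq]
    constructor
    · intro H t; exact H _
    · intro H u
      have hd := TopologicalSpace.denseRange_denseSeq (Fin N → ℝ)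
      have hc : IsClosed {u : Fin N → ℝ | c * (∑ i, u i ^ 2) ≤
              dotp N u (mulVec N (fun i j =>
                (if i = j then (1 - mTAP N β h q W k i ^ 2)⁻¹ else 0)
                  + β ^ 2 * (1 - q) * (if i = j then 1 else 0)
                  - 2 * β ^ 2 / N * (mTAP N β h q W k i * mTAP N β h q W k j)
                  - β * symmG N W i j) u)} := by
        refine isClosed_le (by fun_prop) ?_
        exact qf_cont N _
      have := hc.closure_subset_iff.2 (show Set.range (TopologicalSpace.denseSeq (Fin N → ℝ)) ⊆ _ by rintro _ ⟨t, rfl⟩; exact H t)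
      rw [hd.closure_range] at this
      exact this (Set.mem_univ u)
  rw [e]
  refine MeasurableSet.iInter fun t => measurableSet_le (by fun_prop) ?_
  have hm : ∀ i, Measurable (fun W => mTAP N β h q W k i) := fun i => measurable_pi_iff.1 (mTAP_meas β h q k) i
  have hs : ∀ i j, Measurable (fun W : Fin N → Fin N → ℝ => symmG N W i j) := fun i j => by unfold symmG; fun_prop
  unfold dotp mulVec
  refine Finset.measurable_sum _ fun i _ => Measurable.const_mul (Finset.measurable_sum _ fun j _ => Measurable.mul_const ?_ _) _
  refine Measurable.sub (Measurable.sub (Measurable.add ?_ measurable_const) ?_) ((hs i j).const_mul _)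
  · by_cases hij : i = j
    · simp only [if_pos hij]
      exact (measurable_const.sub ((hm i).pow_const 2)).inv
    · simp only [if_neg hij]; exact measurable_const
  · exact ((hm i).mul (hm j)).const_mul _

theorem Ev_symm (β h q c : ℝ) (hq : 0 < q) (k N : ℕ) (W W' : Fin N → Fin N → ℝ) (H : symmG N W = symmG N W') :
    Ev β h q c (k+1) N W ↔ Ev β h q c (k+1) N W' := by
  unfold Ev
  rw [mTAP_symm β h q hq W W' H k, H]

def Wx (N : ℕ) (x : Fin N × Fin N → ℝ) : Fin N → Fin N → ℝ := fun i j => if i = j then 0 else x (i,j) / √N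
def Wg {N : ℕ} (M : Fin N → Fin N → ℝ) : Fin N → Fin N → ℝ := fun i j => od M i j / √2

theorem symmG_Wg {N : ℕ} (M : Fin N → Fin N → ℝ) (hM : ∀ i j, M i j = M j i) : symmG N (Wg M) = od M := by
  funext i j
  simp only [symmG, Wg, od]
  by_cases hij : i = j
  · simp [hij]
  · rw [if_neg hij, if_neg (Ne.symm hij), hM j i, ← add_div, div_div, Real.mul_self_sqrt (by norm_num)]
    ring

theorem symmG_Wx (N : ℕ) (x : Fin N × Fin N → ℝ) : symmG N (Wx N x) = symmG N (Wg (Mx N x)) := by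
  rw [symmG_Wg _ (fun i j => by simp only [Mx]; rw [add_comm])]
  funext i j
  simp only [symmG, Wx, od, Mx]
  by_cases hij : i = j
  · simp [hij]
  · rw [if_neg hij, if_neg (Ne.symm hij), if_neg hij, ← add_div, div_div, Real.sqrt_mul (by norm_num), mul_comm]

theorem W_law (N : ℕ) {Ω : Type} [MeasurableSpace Ω] (P : Measure Ω) [IsProbabilityMeasure P] (W : Ω → Fin N → Fin N → ℝ)
    (hW : IsWGauss N P W) (A : Set (Fin N → Fin N → ℝ)) (hA : MeasurableSet A) :
    P {ω | W ω ∈ A} = gm (Fin N × Fin N) {x | Wx N x ∈ A} := by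
  classical
  obtain ⟨h0, hi, hg⟩ := hW
  let I := {p : Fin N × Fin N // p.1 ≠ p.2}
  have hae : ∀ p : I, AEMeasurable (fun ω => W ω p.1.1 p.1.2) P := by
    intro p
    by_contra hc
    have := hg p
    rw [Measure.map_of_not_aemeasurable hc] at this
    have h1 : (gaussianReal 0 (N : NNReal)⁻¹) Set.univ = 1 := measure_univ
    rw [← this] at h1
    simp at h1
  let ext : (I → ℝ) → Fin N → Fin N → ℝ := fun y i j => if hij : i = j then 0 else y ⟨(i,j), hij⟩
  have hext : Measurable ext := by
    refine measurable_pi_iff.2 fun i => measurable_pi_iff.2 fun j => ?_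
    simp only [ext]
    by_cases hij : i = j
    · simp [hij]
    · simp only [hij, dif_neg, not_false_eq_true]; fun_prop
  have l1 : P.map (fun ω (p : I) => W ω p.1.1 p.1.2) = Measure.pi (fun _ : I => gaussianReal 0 (N : NNReal)⁻¹) := by
    rw [(iIndepFun_iff_map_fun_eq_pi_map hae).1 hi]
    congr 1
    funext p; exact hg p
  have l2 : (gm (Fin N × Fin N)).map (fun x (p : I) => x p.1 / √N) = Measure.pi (fun _ : I => gaussianReal 0 (N : NNReal)⁻¹) := by
    have a1 := (mp_comp_inj (ι := I) (κ := Fin N × Fin N) (fun p => p.1) Subtype.val_injective)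
    have a2 := measurePreserving_pi (fun _ : I => gaussianReal 0 1) (fun _ : I => gaussianReal 0 (N : NNReal)⁻¹) (f := fun _ x => x / √N)
      (fun _ => ⟨by fun_prop, by
        rw [gaussianReal_map_div_const, zero_div]
        congr 1
        rw [one_div]
        congr 1
        ext
        simp⟩)
    exact (a2.comp a1).map_eq
  have hB : MeasurableSet (ext ⁻¹' A) := hext hA
  have e1 : {ω | W ω ∈ A} = (fun ω (p : I) => W ω p.1.1 p.1.2) ⁻¹' (ext ⁻¹' A) := by
    ext ω
    simp only [Set.mem_ofPred_eq, Set.mem_preimage]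
    have : ext (fun (p : I) => W ω p.1.1 p.1.2) = W ω := by
      funext i j
      simp only [ext]
      split_ifs with hij
      · rw [hij, h0]
      · rfl
    rw [this]
  have e2 : {x | Wx N x ∈ A} = (fun x (p : I) => x p.1 / √N) ⁻¹' (ext ⁻¹' A) := by
    ext x
    simp only [Set.mem_ofPred_eq, Set.mem_preimage]
    have : ext (fun (p : I) => x p.1 / √N) = Wx N x := by
      funext i j
      simp only [ext, Wx]
      split_ifs with hij <;> rfl
    rw [this]
  rw [e1, e2, ← Measure.map_apply_of_aemeasurable (aemeasurable_pi_lambda _ hae) hB, l1, ← l2, Measure.map_apply (by fun_prop) hB]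

theorem transfer (β h q c : ℝ) (hq : 0 < q) (k : ℕ)
    (Ω : ℕ → Type) [∀ N, MeasurableSpace (Ω N)] (P : ∀ N, Measure (Ω N))
    (hP : ∀ N, IsProbabilityMeasure (P N))
    (W : ∀ N, Ω N → Fin N → Fin N → ℝ) (hW : ∀ N, IsWGauss N (P N) (W N))
    (H : ∀ᶠ p in whp goe, Ev β h q c (k+1) p.1 (Wg p.2)) :
    Tendsto (fun N => (P N {ω | Ev β h q c (k+1) N (W N ω)}).toReal) atTop (nhds 1) := by
  rw [whp_iff] at H
  have hWg : ∀ N, Measurable (Wg : (Fin N → Fin N → ℝ) → _) := by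
    intro N
    refine measurable_pi_iff.2 fun i => measurable_pi_iff.2 fun j => ?_
    simp only [Wg, od]
    by_cases hij : i = j
    · simp [hij]
    · simp only [hij, if_false]; fun_prop
  have e : ∀ N, P N {ω | Ev β h q c (k+1) N (W N ω)} = goe N {M | Ev β h q c (k+1) N (Wg M)} := by
    intro N
    have := hP N
    have h1 := W_law N (P N) (W N) (hW N) {W | Ev β h q c (k+1) N W} (Ev_meas β h q c (k+1) N)
    simp only [Set.mem_ofPred_eq] at h1
    rw [h1]
    have h2 : MeasurableSet {M | Ev β h q c (k+1) N (Wg M)} := hWg N (Ev_meas β h q c (k+1) N)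
    rw [← (Mx_mp N).measure_preimage h2.nullMeasurableSet]
    congr 1
    ext x
    exact Ev_symm β h q c hq k N _ _ (symmG_Wx N x)
  simp_rw [e]
  have e2 : ∀ N, goe N {M | Ev β h q c (k+1) N (Wg M)} = 1 - goe N {M | ¬ Ev β h q c (k+1) N (Wg M)} := by
    intro N
    have h2 : MeasurableSet {M | Ev β h q c (k+1) N (Wg M)} := hWg N (Ev_meas β h q c (k+1) N)
    have := prob_compl_eq_one_sub (μ := goe N) h2.compl
    rw [compl_compl] at this
    exact this
  simp_rw [e2]
  have := (ENNReal.tendsto_toReal (ENNReal.one_ne_top)).comp (show Tendsto (fun N => 1 - goe N {M | ¬ Ev β h q c (k+1) N (Wg M)}) atTop (nhds 1) by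
    have := ENNReal.Tendsto.sub (tendsto_const_nhds (x := (1:ENNReal))) H (Or.inl (by simp))
    simpa using this)
  simpa [Function.comp_def] using this


def sf (β h x : ℝ) : ℝ := 1 - tf β h x ^ 2
def S0 (β h l x : ℝ) : ℝ := sf β h x + l * sf β h x ^ 2 + 2 * l ^ 2
def S1 (β h l x : ℝ) : ℝ := -2 * β * tf β h x * sf β h x * (1 + 2 * l * sf β h x)
def S2 (β h l x : ℝ) : ℝ := β ^ 2 * (4 * sf β h x - 6 * sf β h x ^ 2 + l * (16 * sf β h x ^ 2 - 20 * sf β h x ^ 3))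
def T1 (β h l x : ℝ) : ℝ := β * (3 * sf β h x ^ 2 - 2 * sf β h x + l * (5 * sf β h x ^ 3 - 4 * sf β h x ^ 2) + 2 * l ^ 2 * sf β h x)

theorem sf_BC (β h : ℝ) : BC (sf β h) := (BC.const 1).sub ((tf_BC β h).pow 2)
theorem sf_pos (β h x : ℝ) : 0 < sf β h x := by have := tf_sq β h x; unfold sf; linarith
theorem sf_le (β h x : ℝ) : sf β h x ≤ 1 := by unfold sf; nlinarith [sq_nonneg (tf β h x)]

theorem S0_BC (β h l : ℝ) : BC (S0 β h l) :=
  ((sf_BC β h).add ((BC.const l).mul ((sf_BC β h).pow 2))).add (BC.const _)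
theorem S1_BC (β h l : ℝ) : BC (S1 β h l) :=
  ((((BC.const (-2 * β))).mul (tf_BC β h)).mul (sf_BC β h)).mul ((BC.const 1).add ((BC.const (2*l)).mul (sf_BC β h)))
theorem poly_BC (β h c0 c1 c2 c3 : ℝ) : BC (fun x => c0 + c1 * sf β h x + c2 * sf β h x ^ 2 + c3 * sf β h x ^ 3) :=
  (((BC.const c0).add ((BC.const c1).mul (sf_BC β h))).add ((BC.const c2).mul ((sf_BC β h).pow 2))).add ((BC.const c3).mul ((sf_BC β h).pow 3))

theorem E1_poly (β h q c0 c1 c2 c3 : ℝ) (F : ℝ → ℝ) (hF : ∀ x, F x = c0 + c1 * sf β h x + c2 * sf β h x ^ 2 + c3 * sf β h x ^ 3) :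
    BC F ∧ E1 q F = c0 + c1 * E1 q (sf β h) + c2 * E1 q (fun x => sf β h x ^ 2) + c3 * E1 q (fun x => sf β h x ^ 3) := by
  have hF' : F = fun x => c0 + c1 * sf β h x + c2 * sf β h x ^ 2 + c3 * sf β h x ^ 3 := funext hF
  subst hF'
  refine ⟨poly_BC β h c0 c1 c2 c3, ?_⟩
  have hi : ∀ {G : ℝ → ℝ}, BC G → Integrable (fun z => G (√q * z)) (gaussianReal 0 1) := by
    rintro G ⟨h1, C, h2⟩; exact E1_int h1 C h2
  have i1 := (hi (sf_BC β h)).const_mul c1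
  have i2 := (hi ((sf_BC β h).pow 2)).const_mul c2
  have i3 := (hi ((sf_BC β h).pow 3)).const_mul c3
  have i0 : Integrable (fun _ : ℝ => c0) (gaussianReal 0 1) := integrable_const _
  unfold E1
  have e1 := integral_add ((i0.add i1).add i2) i3
  have e2 := integral_add (i0.add i1) i2
  have e3 := integral_add i0 i1
  simp only [Pi.add_apply] at e1 e2 e3
  rw [e1, e2, e3]
  simp only [integral_const_mul]
  simp

theorem S2_E (β h q l : ℝ) : BC (S2 β h l) ∧ E1 q (S2 β h l) = β^2 * (4 * E1 q (sf β h) - 6 * E1 q (fun x => sf β h x ^ 2) + l * (16 * E1 q (fun x => sf β h x ^ 2) - 20 * E1 q (fun x => sf β h x ^ 3))) := by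
  have := E1_poly β h q 0 (β^2 * 4) (β^2 * (-6 + l * 16)) (β^2 * l * (-20)) (S2 β h l) (fun x => by unfold S2; ring)
  exact ⟨this.1, this.2.trans (by ring)⟩
theorem T1_E (β h q l : ℝ) : BC (T1 β h l) ∧ E1 q (T1 β h l) = β * (3 * E1 q (fun x => sf β h x ^ 2) - 2 * E1 q (sf β h) + l * (5 * E1 q (fun x => sf β h x ^ 3) - 4 * E1 q (fun x => sf β h x ^ 2)) + 2 * l ^ 2 * E1 q (sf β h)) := by
  have := E1_poly β h q 0 (β * (-2 + 2 * l^2)) (β * (3 - l * 4)) (β * l * 5) (T1 β h l) (fun x => by unfold T1; ring)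
  exact ⟨this.1, this.2.trans (by ring)⟩
theorem S0_E (β h q l : ℝ) : E1 q (S0 β h l) = E1 q (sf β h) + l * E1 q (fun x => sf β h x ^ 2) + 2 * l ^ 2 := by
  have := E1_poly β h q (2 * l^2) 1 l 0 (S0 β h l) (fun x => by unfold S0; ring)
  exact this.2.trans (by ring)
theorem tS_E (β h q l : ℝ) : BC (fun x => tf β h x ^ 2 * S0 β h l x) ∧ E1 q (fun x => tf β h x ^ 2 * S0 β h l x) = E1 q (sf β h) - E1 q (fun x => sf β h x ^ 2) + l * (E1 q (fun x => sf β h x ^ 2) - E1 q (fun x => sf β h x ^ 3)) + 2 * l ^ 2 * (1 - E1 q (sf β h)) := by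
  have := E1_poly β h q (2 * l^2) (1 - 2 * l^2) (-1 + l) (-l) (fun x => tf β h x ^ 2 * S0 β h l x) (fun x => by
    have : tf β h x ^ 2 = 1 - sf β h x := by unfold sf; ring
    simp only [this]; unfold S0; ring)
  exact ⟨this.1, this.2.trans (by ring)⟩

theorem sf_deriv (β h x : ℝ) : HasDerivAt (sf β h) (-2 * β * tf β h x * sf β h x) x := by
  have := ((tf_deriv β h x).fun_pow 2).const_sub 1
  refine HasDerivAt.congr_deriv this ?_
  unfold sf; push_cast; ring

theorem S0_deriv (β h l x : ℝ) : HasDerivAt (S0 β h l) (S1 β h l x) x := by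
  have := ((sf_deriv β h x).fun_add (((sf_deriv β h x).fun_pow 2).const_mul l)).add_const (2 * l^2)
  refine HasDerivAt.congr_deriv this ?_
  unfold S1; push_cast; ring

theorem S1_deriv (β h l x : ℝ) : HasDerivAt (S1 β h l) (S2 β h l x) x := by
  have := ((((tf_deriv β h x).const_mul (-2*β)).fun_mul (sf_deriv β h x)).fun_mul (((sf_deriv β h x).const_mul (2*l)).const_add 1))
  refine HasDerivAt.congr_deriv this ?_
  have e : tf β h x ^ 2 = 1 - sf β h x := by unfold sf; ring
  have e' : β * (1 - tf β h x ^ 2) = β * sf β h x := rfl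
  rw [e']
  unfold S2
  linear_combination (4 * β^2 * sf β h x + 16 * l * β^2 * sf β h x ^ 2) * e

theorem tS_deriv (β h l x : ℝ) : HasDerivAt (fun x => tf β h x * S0 β h l x) (T1 β h l x) x := by
  have := (tf_deriv β h x).fun_mul (S0_deriv β h l x)
  refine HasDerivAt.congr_deriv this ?_
  have e : tf β h x ^ 2 = 1 - sf β h x := by unfold sf; ring
  have e' : β * (1 - tf β h x ^ 2) = β * sf β h x := rfl
  rw [e']
  unfold T1 S1 S0
  linear_combination (-2 * β * sf β h x * (1 + 2 * l * sf β h x)) * e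

theorem A_eq {β h q : ℝ} (hq : isFixedq β h q) : E1 q (sf β h) = 1 - q := by
  have h1 := q_eq hq
  have : E1 q (sf β h) = E1 q (fun _ => 1) - E1 q (fun x => tf β h x ^ 2) := by
    unfold E1 sf
    have i1 : Integrable (fun _ : ℝ => (1:ℝ)) (gaussianReal 0 1) := integrable_const _
    obtain ⟨a, C, b⟩ := (tf_BC β h).pow 2
    exact integral_sub i1 (E1_int a C b)
  rw [this, h1]; simp [E1]

theorem AB_lt {β h q : ℝ} (hq : isFixedq β h q) : E1 q (fun x => sf β h x ^ 2) < E1 q (sf β h) := by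
  have hp := E1_poly β h q 0 1 (-1) 0 (fun x => tf β h x ^ 2 * sf β h x) (fun x => by
    have : tf β h x ^ 2 = 1 - sf β h x := by unfold sf; ring
    simp only [this]; ring)
  have h2 : E1 q (fun x => tf β h x ^ 2 * sf β h x) = E1 q (sf β h) - E1 q (fun x => sf β h x ^ 2) := hp.2.trans (by ring)
  have h0 : 0 ≤ E1 q (fun x => tf β h x ^ 2 * sf β h x) := integral_nonneg fun z => mul_nonneg (sq_nonneg _) (sf_pos _ _ _).le
  rcases h0.lt_or_eq with h3 | h3
  · linarith
  · exfalso
    obtain ⟨a, C, b⟩ := hp.1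
    have := (integral_eq_zero_iff_of_nonneg (fun z => mul_nonneg (sq_nonneg (tf β h (√q * z))) (sf_pos β h (√q * z)).le) (E1_int a C b)).1 h3.symm
    have h4 : E1 q (fun x => tf β h x ^ 2) = 0 := by
      unfold E1
      rw [integral_congr_ae (g := fun _ => 0), integral_zero]
      filter_upwards [this] with z hz
      simp only [Pi.zero_apply] at hz
      rcases mul_eq_zero.1 hz with h5 | h5
      · exact h5
      · exact absurd h5 (sf_pos _ _ _).ne'
    rw [q_eq hq] at h4
    linarith [hq.1]

theorem consts {β h q : ℝ} (_hβ : 0 < β) (hq : isFixedq β h q) (hAT : ATcond β h q) :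
    ∃ l κ c : ℝ, 0 < l ∧ l ≤ 1/2 ∧ 0 < c ∧ -l + β^2 * E1 q (S0 β h l) ≤ β^2 * (1 - q) - c ∧
      2 * β^2 - 2 * κ + β^2 * E1 q (S2 β h l) + 2 * β * κ * E1 q (T1 β h l) + κ^2 * E1 q (fun x => tf β h x ^ 2 * S0 β h l x) ≤ 0 := by
  have hA := A_eq hq
  have hAB := AB_lt hq
  have hB : β^2 * E1 q (fun x => sf β h x ^ 2) < 1 := AT_eq hAT
  set A := E1 q (sf β h)
  set B := E1 q (fun x => sf β h x ^ 2) with hBd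
  set C := E1 q (fun x => sf β h x ^ 3) with hCd
  have hβ2 : 0 ≤ β^2 := sq_nonneg β
  have hp : β^2 * (3 * B - 2 * A) < 1 := by nlinarith
  let κ := (1 - β^2 * (3 * B - 2 * A)) / (A - B)
  have hAB' : 0 < A - B := by linarith
  have hκ : κ * (A - B) = 1 - β^2 * (3 * B - 2 * A) := div_mul_cancel₀ _ hAB'.ne'
  have hκ0 : 0 < κ := div_pos (by linarith) hAB'
  let Kf : ℝ → ℝ := fun l => 2 * β^2 - 2 * κ + β^2 * (β^2 * (4 * A - 6 * B + l * (16 * B - 20 * C))) + 2 * β * κ * (β * (3 * B - 2 * A + l * (5 * C - 4 * B) + 2 * l ^ 2 * A))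
    + κ^2 * (A - B + l * (B - C) + 2 * l ^ 2 * (1 - A))
  have hK0 : Kf 0 < 0 := by
    have : Kf 0 = - κ * (1 - β^2 * B) := by
      simp only [Kf]
      have : 1 - β^2 * B = (1 - β^2 * (3*B-2*A)) - 2 * β^2 * (A - B) := by ring
      rw [this]
      linear_combination (κ - 2 * β^2) * hκ
    rw [this]
    have := mul_pos hκ0 (show 0 < 1 - β^2 * B by linarith)
    linarith
  have hKc : Continuous Kf := by fun_prop
  have ev1 : ∀ᶠ l in nhdsWithin (0:ℝ) (Set.Ioi 0), Kf l < 0 :=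
    (hKc.tendsto 0).eventually (gt_mem_nhds hK0) |>.filter_mono nhdsWithin_le_nhds
  have ev2 : ∀ᶠ l in nhdsWithin (0:ℝ) (Set.Ioi 0), l < 1/2 :=
    (gt_mem_nhds (by norm_num : (0:ℝ) < 1/2)) |> fun h => Filter.Eventually.filter_mono nhdsWithin_le_nhds h
  have ev3 : ∀ᶠ l in nhdsWithin (0:ℝ) (Set.Ioi 0), 2 * β^2 * l < 1 - β^2 * B := by
    have : Continuous (fun l : ℝ => 2 * β^2 * l) := by fun_prop
    exact ((this.tendsto 0).eventually (gt_mem_nhds (by simp only [mul_zero]; linarith))).filter_mono nhdsWithin_le_nhds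
  obtain ⟨l, h1, h2, h3, h4⟩ := (ev1.and (ev2.and (ev3.and self_mem_nhdsWithin))).exists
  have h4' : 0 < l := h4
  refine ⟨l, κ, l * (1 - β^2 * B - 2 * β^2 * l), h4', h2.le, mul_pos h4' (by linarith), ?_, ?_⟩
  · rw [S0_E, ← hA]
    exact le_of_eq (by ring)
  · rw [(S2_E β h q l).2, (T1_E β h q l).2, (tS_E β h q l).2]
    exact h1.le


def Yq (β h κ : ℝ) {K : ℕ} (b v : Fin K → ℝ) (s : Fin K) : ℝ := β * v s + κ * b s * tf β h (lin b v)
def Qf (β h κ l : ℝ) {K : ℕ} (b : Fin K → ℝ) (s t : Fin K) (v : Fin K → ℝ) : ℝ := Yq β h κ b v s * (Yq β h κ b v t * S0 β h l (lin b v))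
def Lam (β h q κ l : ℝ) : ℝ := β^2 * E1 q (S2 β h l) + 2 * β * κ * E1 q (T1 β h l) + κ^2 * E1 q (fun x => tf β h x ^ 2 * S0 β h l x)
def ql (β h q κ l : ℝ) {K : ℕ} (b : Fin K → ℝ) (s t : Fin K) : ℝ := (if s = t then β^2 * E1 q (S0 β h l) else 0) + b s * b t * Lam β h q κ l

theorem Yq_nice (β h κ : ℝ) {K : ℕ} (b : Fin K → ℝ) (s : Fin K) : Nice (fun v => Yq β h κ b v s) :=
  ((Nice.const β).mul (Nice.coord s)).add ((Nice.const (κ * b s)).mul ((tf_BC β h).nice b))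

theorem Qf_nice (β h κ l : ℝ) {K : ℕ} (b : Fin K → ℝ) (s t : Fin K) : Nice (Qf β h κ l b s t) :=
  (Yq_nice β h κ b s).mul ((Yq_nice β h κ b t).mul ((S0_BC β h l).nice b))

theorem Qf_int {β h q κ l : ℝ} (hq : 0 ≤ q) {K : ℕ} (b : Fin K → ℝ) (hb : ∑ k, b k * b k = q) (s t : Fin K) :
    ∫ v, Qf β h κ l b s t v ∂(gm (Fin K)) = ql β h q κ l b s t := by
  have law : ∀ F : ℝ → ℝ, BC F → ∫ v, F (lin b v) ∂(gm (Fin K)) = E1 q F := fun F hF => one_law q hq b hb F hF.1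
  have hS := S0_BC β h l
  have hT : BC (fun x => tf β h x * S0 β h l x) := (tf_BC β h).mul hS
  have e : ∀ v, Qf β h κ l b s t v = β^2 * (v s * (v t * S0 β h l (lin b v)))
      + β * κ * b t * (v s * (tf β h (lin b v) * S0 β h l (lin b v)))
      + β * κ * b s * (v t * (tf β h (lin b v) * S0 β h l (lin b v)))
      + κ^2 * b s * b t * (tf β h (lin b v) ^ 2 * S0 β h l (lin b v)) := by
    intro v; unfold Qf Yq; ring
  have i1 := ((Nice.coord s).mul ((Nice.coord t).mul (hS.nice b))).int.const_mul (β^2)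
  have i2 := ((Nice.coord s).mul (hT.nice b)).int.const_mul (β * κ * b t)
  have i3 := ((Nice.coord t).mul (hT.nice b)).int.const_mul (β * κ * b s)
  have i4 := ((tS_E β h q l).1.nice b).int.const_mul (κ^2 * b s * b t)
  simp_rw [e]
  have e1 := integral_add ((i1.add i2).add i3) i4
  have e2 := integral_add (i1.add i2) i3
  have e3 := integral_add i1 i2
  simp only [Pi.add_apply] at e1 e2 e3
  rw [e1, e2, e3]
  simp only [integral_const_mul]
  rw [lin_ibp2 b s t (S0 β h l) (S1 β h l) (S2 β h l) (S0_deriv β h l) (S1_deriv β h l) hS (S1_BC β h l) (S2_E β h q l).1]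
  have j1 := fun k => lin_ibp b k (fun x => tf β h x * S0 β h l x) (T1 β h l) (tS_deriv β h l) hT (T1_E β h q l).1
  rw [j1 s, j1 t, law _ hS, law _ (S2_E β h q l).1, law _ (T1_E β h q l).1]
  have j2 := law _ (tS_E β h q l).1
  rw [j2]
  unfold ql Lam
  split_ifs <;> ring

theorem ql_sum (β h q κ l : ℝ) {K : ℕ} (a b : Fin K → ℝ) :
    ∑ s, ∑ t, a s * a t * ql β h q κ l b s t = β^2 * E1 q (S0 β h l) * (∑ s, a s ^ 2) + Lam β h q κ l * (∑ s, b s * a s) ^ 2 := by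
  have e : ∀ s t, a s * a t * ql β h q κ l b s t = (if s = t then a s * a t * (β^2 * E1 q (S0 β h l)) else 0) + Lam β h q κ l * ((b s * a s) * (b t * a t)) := by
    intro s t; unfold ql; split_ifs <;> ring
  simp only [e, Finset.sum_add_distrib, Finset.sum_ite_eq, Finset.mem_univ, if_true]
  congr 1
  · rw [Finset.mul_sum]; exact Finset.sum_congr rfl fun s _ => by ring
  · rw [sq, Finset.sum_mul_sum, Finset.mul_sum]
    exact Finset.sum_congr rfl fun s _ => by rw [Finset.mul_sum]

theorem S0_lip {β h l : ℝ} (hβ : 0 < β) (hl : 0 < l) (hl' : l ≤ 1/2) (x y : ℝ) : S0 β h l x ≤ S0 β h l y + 4 * β * |x - y| := by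
  have h1 := tf_lip β h hβ x y
  have h2 := tf_abs β h x
  have h3 := tf_abs β h y
  have e : sf β h x - sf β h y = (tf β h y - tf β h x) * (tf β h y + tf β h x) := by unfold sf; ring
  have e1 : |sf β h x - sf β h y| ≤ 2 * β * |x - y| := by
    rw [e, abs_mul, abs_sub_comm]
    have : |tf β h y + tf β h x| ≤ 2 := (abs_add_le _ _).trans (by linarith)
    have := mul_le_mul h1 this (abs_nonneg _) (by positivity)
    linarith
  have e2 : S0 β h l x - S0 β h l y = (sf β h x - sf β h y) * (1 + l * (sf β h x + sf β h y)) := by unfold S0; ring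
  have p1 := sf_pos β h x
  have p2 := sf_pos β h y
  have p3 := sf_le β h x
  have p4 := sf_le β h y
  have e3 : |1 + l * (sf β h x + sf β h y)| ≤ 2 := by
    rw [abs_of_nonneg (by positivity)]
    nlinarith
  have := mul_le_mul e1 e3 (abs_nonneg _) (by positivity)
  rw [← abs_mul, ← e2] at this
  linarith [le_abs_self (S0 β h l x - S0 β h l y)]

theorem S0_ge {β h l : ℝ} (hl : 0 < l) (hl' : l ≤ 1/2) (x u y : ℝ) :
    2 * u * y - u^2 * ((sf β h x)⁻¹ - l) ≤ y^2 * S0 β h l x := by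
  have p1 := sf_pos β h x
  have p3 := sf_le β h x
  have hS : 1 ≤ S0 β h l x * ((sf β h x)⁻¹ - l) := by
    have : S0 β h l x * ((sf β h x)⁻¹ - l) = 1 + l^2 * (2 * (sf β h x)⁻¹ - sf β h x ^ 2 - 2 * l) := by
      unfold S0; field_simp; ring
    rw [this]
    have h1 : 1 ≤ (sf β h x)⁻¹ := (one_le_inv₀ p1).2 p3
    nlinarith [sq_nonneg l, mul_nonneg (sq_nonneg l) (show 0 ≤ 2 * (sf β h x)⁻¹ - sf β h x ^ 2 - 2 * l by nlinarith)]
  have hp : 0 < (sf β h x)⁻¹ - l := by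
    have h1 : 1 ≤ (sf β h x)⁻¹ := (one_le_inv₀ p1).2 p3
    linarith
  set P := (sf β h x)⁻¹ - l
  have h5 : y^2 ≤ y^2 * (S0 β h l x * P) := le_mul_of_one_le_right (sq_nonneg y) hS
  have h6 : 0 ≤ (u * P - y)^2 := sq_nonneg _
  have : P * (2 * u * y - u^2 * P) ≤ P * (y^2 * S0 β h l x) := by nlinarith
  exact le_of_mul_le_mul_left this hp

theorem coef_sum_le {K : ℕ} (a f : Fin K → ℝ) (U : ℝ) (ha : ∀ s, |a s| ≤ U) : |∑ s, a s * f s| ≤ U * ∑ s, |f s| := by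
  refine (Finset.abs_sum_le_sum_abs _ _).trans ?_
  rw [Finset.mul_sum]
  exact Finset.sum_le_sum fun s _ => by rw [abs_mul]; exact mul_le_mul_of_nonneg_right (ha s) (abs_nonneg _)

/-- average of Q -/
def Qa (β h κ l : ℝ) {N K : ℕ} (b : Fin K → ℝ) (s t : Fin K) (x : Fin N × Fin K → ℝ) : ℝ := (∑ i, Qf β h κ l b s t (fun k => x (i, k))) / N
def Ra (β h q κ l : ℝ) {N K : ℕ} (b : Fin K → ℝ) (x : Fin N × Fin K → ℝ) : ℝ := ∑ s, ∑ t, |Qa β h κ l b s t x - ql β h q κ l b s t|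
def Ya (β h κ : ℝ) {N K : ℕ} (b : Fin K → ℝ) (x : Fin N × Fin K → ℝ) : ℝ := (∑ i, (∑ s, |Yq β h κ b (fun k => x (i, k)) s|) ^ 4) / N

theorem Ra_lim {β h q κ l : ℝ} (hq : 0 ≤ q) {K : ℕ} (b : Fin K → ℝ) (hb : ∑ k, b k * b k = q) :
    Tendsto (fun p : Σ N : ℕ, (Fin N × Fin K → ℝ) => Ra β h q κ l b p.2) (Fl K) (nhds 0) := by
  have : Tendsto (fun p : Σ N : ℕ, (Fin N × Fin K → ℝ) => Ra β h q κ l b p.2) (Fl K)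
      (nhds (∑ s : Fin K, ∑ t : Fin K, |ql β h q κ l b s t - ql β h q κ l b s t|)) := by
    refine tendsto_finsetSum _ fun s _ => tendsto_finsetSum _ fun t _ => ?_
    have := lln K (Qf_nice β h κ l b s t)
    rw [Qf_int hq b hb] at this
    exact (this.sub_const _).abs
  simpa using this

theorem Ya_lim (β h κ : ℝ) {K : ℕ} (b : Fin K → ℝ) : ∃ C, 0 < C ∧ ∀ᶠ p : Σ N : ℕ, (Fin N × Fin K → ℝ) in Fl K, Ya β h κ b p.2 ≤ C^2 := by
  have := lln K ((Nice.sum Finset.univ (fun s _ => (Yq_nice β h κ b s).abs)).pow 4)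
  set I := ∫ x : Fin K → ℝ, (∑ s, |Yq β h κ b x s|) ^ 4 ∂(gm (Fin K))
  refine ⟨|I| + 1, by positivity, ?_⟩
  filter_upwards [this.eventually (gt_mem_nhds (show I < |I| + 1 by linarith [le_abs_self I]))] with p hp
  refine hp.le.trans ?_
  nlinarith [abs_nonneg I]

set_option maxHeartbeats 2000000 in
theorem det_bound {β h q κ l c : ℝ} (hβ : 0 < β) (hq1 : q ≤ 1) (hl : 0 < l) (hl' : l ≤ 1/2)
    (hc1 : -l + β^2 * E1 q (S0 β h l) ≤ β^2 * (1 - q) - c) (hc2 : 2 * β^2 - 2 * κ + Lam β h q κ l ≤ 0)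
    {N K : ℕ} (hN : 0 < N) (b : Fin K → ℝ) (hb : ∑ k, b k * b k = q) (x : Fin N × Fin K → ℝ) (u w : Fin N → ℝ) (a : Fin K → ℝ)
    (ha : ∑ s, a s ^ 2 = nr u ^ 2) (ε C τ : ℝ) (hw : nr w ≤ ε * √N) (hC : 0 ≤ C) (hY : Ya β h κ b x ≤ C ^ 2)
    (X : ℝ) (hX : X = (∑ i, tf β h (lin b (fun k => x (i,k))) * u i) / √N) (hτ : |X - ∑ s, b s * a s| ≤ τ * nr u) :
    2 * β / √N * (∑ s, a s * ∑ i, x (i, s) * u i) + 2 * β^2 * X^2 ≤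
      ∑ i, u i ^ 2 * (sf β h (lin b (fun k => x (i,k)) + w i))⁻¹ + β^2 * (1 - q) * nr u ^ 2
        - (c - Ra β h q κ l b x - 4 * β * ε * C - (2 * |κ| + 4 * β^2) * τ) * nr u ^ 2 := by
  have hN' : (0:ℝ) < N := by exact_mod_cast hN
  have hsN : (0:ℝ) < √N := Real.sqrt_pos.2 hN'
  have hsq : √(N:ℝ) ^ 2 = N := Real.sq_sqrt hN'.le
  set z : Fin N → ℝ := fun i => lin b (fun k => x (i,k)) with hz
  set θ := ∑ s, b s * a s with hθ
  set U := nr u with hU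
  have hU0 : 0 ≤ U := nr_nonneg u
  have haU : ∀ s, |a s| ≤ U := fun s => by
    refine abs_le_of_sq_le_sq ?_ hU0
    rw [← ha]
    exact Finset.single_le_sum (f := fun s => a s ^ 2) (fun s _ => sq_nonneg _) (Finset.mem_univ s)
  let y : Fin N → ℝ := fun i => ∑ s, a s * Yq β h κ b (fun k => x (i,k)) s
  have ysum : ∑ i, u i * y i = β * (∑ s, a s * ∑ i, x (i, s) * u i) + κ * θ * (√N * X) := by
    have e0 : √N * X = ∑ i, tf β h (z i) * u i := by rw [hX]; exact mul_div_cancel₀ _ hsN.ne'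
    rw [e0]
    have : ∀ i, u i * y i = β * (∑ s, a s * (x (i,s) * u i)) + κ * θ * (tf β h (z i) * u i) := by
      intro i
      simp only [y, Yq, hθ, hz, Finset.mul_sum, Finset.sum_mul, ← Finset.sum_add_distrib]
      exact Finset.sum_congr rfl fun s _ => by ring
    simp only [this, Finset.sum_add_distrib, ← Finset.mul_sum]
    congr 2
    simp only [Finset.mul_sum]
    exact Finset.sum_comm
  -- step 1
  have s1 : 2 * (∑ i, u i * y i) / √N - ∑ i, u i ^ 2 * (sf β h (z i + w i))⁻¹ + l * U^2 ≤ (∑ i, y i ^ 2 * S0 β h l (z i + w i)) / N := by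
    have e1 : U^2 = ∑ i, u i ^ 2 := by rw [hU, nr_sq, dotp]; exact Finset.sum_congr rfl fun i _ => by ring
    have : 2 * (∑ i, u i * y i) / √N - ∑ i, u i ^ 2 * (sf β h (z i + w i))⁻¹ + l * U^2 =
        ∑ i, (2 * u i * (y i / √N) - u i ^2 * ((sf β h (z i + w i))⁻¹ - l)) := by
      rw [e1, Finset.mul_sum, Finset.mul_sum, Finset.sum_div, ← Finset.sum_sub_distrib, ← Finset.sum_add_distrib]
      exact Finset.sum_congr rfl fun i _ => by ring
    rw [this, Finset.sum_div]
    refine Finset.sum_le_sum fun i _ => (S0_ge hl hl' _ _ _).trans (le_of_eq ?_)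
    rw [div_pow, hsq]; ring
  -- step 2,3
  have s2 : (∑ i, y i ^ 2 * S0 β h l (z i + w i)) / N ≤ (∑ i, y i ^ 2 * S0 β h l (z i)) / N + 4 * β * ε * C * U^2 := by
    have h1 : ∑ i, y i ^ 2 * S0 β h l (z i + w i) ≤ ∑ i, y i ^ 2 * S0 β h l (z i) + 4 * β * ∑ i, y i ^ 2 * |w i| := by
      rw [Finset.mul_sum, ← Finset.sum_add_distrib]
      refine Finset.sum_le_sum fun i _ => ?_
      have := mul_le_mul_of_nonneg_left (S0_lip (h := h) hβ hl hl' (z i + w i) (z i)) (sq_nonneg (y i))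
      rw [add_sub_cancel_left] at this
      linarith
    have h2 : ∑ i, y i ^ 2 * |w i| ≤ (C * √N * U^2) * (ε * √N) := by
      have h3 := dotp_le (fun i => y i ^ 2) (fun i => |w i|)
      have h4 : nr (fun i => |w i|) = nr w := by simp only [nr, dotp, abs_mul_abs_self]
      have h5 : nr (fun i => y i ^ 2) ≤ C * √N * U^2 := by
        refine le_of_sq_le_sq ?_ (by positivity)
        rw [nr_sq]
        have h6 : ∀ i, y i ^ 4 ≤ U^4 * (∑ s, |Yq β h κ b (fun k => x (i, k)) s|) ^ 4 := by
          intro i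
          rw [← mul_pow]
          have := coef_sum_le a (Yq β h κ b (fun k => x (i, k))) U haU
          calc y i ^ 4 = |y i| ^ 4 := by rw [← abs_pow]; exact (abs_of_nonneg (by positivity)).symm
            _ ≤ _ := pow_le_pow_left₀ (abs_nonneg _) this 4
        calc dotp N (fun i => y i ^ 2) (fun i => y i ^ 2) = ∑ i, y i ^ 4 := Finset.sum_congr rfl fun i _ => by ring
          _ ≤ ∑ i, U^4 * (∑ s, |Yq β h κ b (fun k => x (i, k)) s|) ^ 4 := Finset.sum_le_sum fun i _ => h6 i
          _ = U^4 * (N * Ya β h κ b x) := by rw [← Finset.mul_sum, Ya, mul_div_cancel₀ _ hN'.ne']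
          _ ≤ U^4 * (N * C^2) := by gcongr
          _ = (C * √N * U^2)^2 := by rw [mul_pow, mul_pow, hsq]; ring
      calc ∑ i, y i ^ 2 * |w i| = dotp N (fun i => y i ^ 2) (fun i => |w i|) := rfl
        _ ≤ _ := h3
        _ ≤ _ := by rw [h4]; exact mul_le_mul h5 hw (nr_nonneg _) (by positivity)
    have h7 : 4 * β * ((C * √N * U^2) * (ε * √N)) = 4 * β * ε * C * U^2 * N := by
      linear_combination (4 * β * ε * C * U^2) * hsq
    have h8 := mul_le_mul_of_nonneg_left h2 (show 0 ≤ 4 * β by positivity)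
    rw [h7] at h8
    rw [div_add' _ _ _ hN'.ne']
    exact div_le_div_of_nonneg_right (by linarith) hN'.le
  -- step 4
  have s4 : (∑ i, y i ^ 2 * S0 β h l (z i)) / N = ∑ s, ∑ t, a s * a t * Qa β h κ l b s t x := by
    have : ∀ i, y i ^ 2 * S0 β h l (z i) = ∑ s, ∑ t, a s * a t * Qf β h κ l b s t (fun k => x (i,k)) := by
      intro i
      simp only [y]
      rw [sq, Finset.sum_mul_sum, Finset.sum_mul]
      refine Finset.sum_congr rfl fun s _ => ?_
      rw [Finset.sum_mul]
      refine Finset.sum_congr rfl fun t _ => ?_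
      unfold Qf; ring
    simp only [this, Qa]
    rw [Finset.sum_comm, Finset.sum_div]
    refine Finset.sum_congr rfl fun s _ => ?_
    rw [Finset.sum_comm, Finset.sum_div]
    refine Finset.sum_congr rfl fun t _ => ?_
    rw [← Finset.mul_sum, mul_div_assoc]
  have s5 : ∑ s, ∑ t, a s * a t * Qa β h κ l b s t x ≤ ∑ s, ∑ t, a s * a t * ql β h q κ l b s t + Ra β h q κ l b x * U^2 := by
    rw [Ra, Finset.sum_mul, ← Finset.sum_add_distrib]
    refine Finset.sum_le_sum fun s _ => ?_
    rw [Finset.sum_mul, ← Finset.sum_add_distrib]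
    refine Finset.sum_le_sum fun t _ => ?_
    have h1 : |a s * a t| ≤ U^2 := by
      rw [abs_mul, sq]; exact mul_le_mul (haU s) (haU t) (abs_nonneg _) hU0
    have h2 := le_abs_self (a s * a t * (Qa β h κ l b s t x - ql β h q κ l b s t))
    rw [abs_mul] at h2
    have h3 := mul_le_mul_of_nonneg_right h1 (abs_nonneg (Qa β h κ l b s t x - ql β h q κ l b s t))
    linarith
  rw [ql_sum, ha] at s5
  -- bounds on θ, X
  have hθU : |θ| ≤ U := by
    refine abs_le_of_sq_le_sq ?_ hU0
    have := Finset.sum_mul_sq_le_sq_mul_sq Finset.univ b a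
    rw [ha] at this
    have hb' : ∑ s, b s ^ 2 = q := by rw [← hb]; exact Finset.sum_congr rfl fun i _ => by ring
    rw [hb'] at this
    refine this.trans ?_
    exact mul_le_of_le_one_left (sq_nonneg _) hq1
  have hXU : |X| ≤ U := by
    rw [hX, abs_div, abs_of_pos hsN, div_le_iff₀ hsN]
    have := abs_dotp_le (fun i => tf β h (z i)) u
    have h1 := nr_bdd (fun i => tf β h (z i)) (fun i => tf_abs _ _ _)
    refine this.trans ?_
    rw [mul_comm]
    exact mul_le_mul_of_nonneg_left h1 hU0
  have hd1 : 2 * κ * θ * X ≥ 2 * κ * θ^2 - 2 * |κ| * τ * U^2 := by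
    have : |κ * θ * (X - θ)| ≤ |κ| * U * (τ * U) := by
      rw [abs_mul, abs_mul]
      exact mul_le_mul (mul_le_mul_of_nonneg_left hθU (abs_nonneg _)) hτ (abs_nonneg _) (by positivity)
    have h2 := (abs_le.1 this).1
    have e1 : 2 * κ * θ * X = 2 * κ * θ^2 + 2 * (κ * θ * (X - θ)) := by ring
    have e2 : 2 * |κ| * τ * U^2 = 2 * (|κ| * U * (τ * U)) := by ring
    rw [e1, e2]; linarith
  have hd2 : 2 * β^2 * X^2 ≤ 2 * β^2 * θ^2 + 4 * β^2 * τ * U^2 := by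
    have : |(X - θ) * (X + θ)| ≤ (τ * U) * (2 * U) := by
      rw [abs_mul]
      refine mul_le_mul hτ ?_ (abs_nonneg _) ((abs_nonneg _).trans hτ)
      exact (abs_add_le _ _).trans (by linarith)
    have := (abs_le.1 this).2
    have h3 := mul_le_mul_of_nonneg_left this (show 0 ≤ 2 * β^2 by positivity)
    have e1 : 2 * β^2 * X^2 = 2 * β^2 * θ^2 + 2 * β^2 * ((X - θ) * (X + θ)) := by ring
    have e2 : 4 * β^2 * τ * U^2 = 2 * β^2 * (τ * U * (2 * U)) := by ring
    rw [e1, e2]; linarith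
  have e6 : 2 * (∑ i, u i * y i) / √N = 2 * β / √N * (∑ s, a s * ∑ i, x (i, s) * u i) + 2 * κ * θ * X := by
    rw [ysum]; field_simp
  rw [e6, ] at s1
  have h7 := mul_le_mul_of_nonneg_right hc1 (sq_nonneg U)
  have h8 := mul_le_mul_of_nonneg_right hc2 (sq_nonneg θ)
  rw [s4] at s2
  rw [← hθ] at s5
  have e7 : ∀ i, lin b (fun k => x (i,k)) = z i := fun i => rfl
  simp only [e7]
  clear_value z θ U y
  clear hX ysum hY hsq s4 e6 hz hθ e7
  linarith


def Ta (β h q : ℝ) (r : ℕ) {N K : ℕ} (x : Fin N × Fin K → ℝ) : ℝ :=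
  ∑ s ∈ Finset.range (r+1), |dotp N (ph (mm β h q (gv x)) s) (mm β h q (gv x) (r+1)) / √N - ga β h q s| + |ga β h q r - √(de β h q r)|
    + nr (qs (mm β h q (gv x)) (r+1) (mm β h q (gv x) (r+1))) / √N

def Pa (β h q : ℝ) (n : ℕ) {N K : ℕ} (x : Fin N × Fin K → ℝ) : ℝ :=
  ∑ s ∈ Finset.range n, |dotp N (ph (mm β h q (gv x)) s) (gv x n) / √N|

theorem range_sum_le (n : ℕ) (a f : ℕ → ℝ) (U : ℝ) (ha : ∀ s < n, |a s| ≤ U) :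
    |∑ s ∈ Finset.range n, f s * a s| ≤ (∑ s ∈ Finset.range n, |f s|) * U := by
  refine (Finset.abs_sum_le_sum_abs _ _).trans ?_
  rw [Finset.sum_mul]
  exact Finset.sum_le_sum fun s hs => by
    rw [abs_mul]; exact mul_le_mul_of_nonneg_left (ha s (Finset.mem_range.1 hs)) (abs_nonneg _)

theorem ph_abs {N : ℕ} (m : ℕ → Fin N → ℝ) (s : ℕ) (u : Fin N → ℝ) : |dotp N (ph m s) u| ≤ nr u := by
  refine (abs_dotp_le _ _).trans ?_
  exact mul_le_of_le_one_left (nr_nonneg _) (nr_uz _ (ph_uz m s))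

theorem dot_split {N : ℕ} (m : ℕ → Fin N → ℝ) (n : ℕ) (v u : Fin N → ℝ) :
    dotp N v u = ∑ s ∈ Finset.range n, dotp N (ph m s) v * dotp N (ph m s) u + dotp N (qs m n v) u := by
  rw [qs_sum, dotp_sub_left, dotp_sum_left]
  simp only [dotp_smul_left]
  ring

set_option maxHeartbeats 1000000 in
theorem det2 {β h q κ l c : ℝ} (hβ : 0 < β) (hh : 0 < h) (hq : isFixedq β h q) (hAT : ATcond β h q) (hl : 0 < l) (hl' : l ≤ 1/2)
    (hc1 : -l + β^2 * E1 q (S0 β h l) ≤ β^2 * (1 - q) - c) (hc2 : 2 * β^2 - 2 * κ + Lam β h q κ l ≤ 0)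
    (r : ℕ) {N : ℕ} (hN : 0 < N) (x : Fin N × Fin (r+2) → ℝ) (u w : Fin N → ℝ)
    (ε C : ℝ) (hw : nr w ≤ ε * √N) (hC : 0 ≤ C) (hY : Ya β h κ (fun t : Fin (r+2) => cf β h q r t) x ≤ C ^ 2) :
    2 * β / √N * (∑ s ∈ Finset.range (r+1), dotp N (ph (mm β h q (gv x)) s) u * dotp N (gv x s) u
        + nr (qs (mm β h q (gv x)) (r+1) u) * dotp N (gv x (r+1)) (qs (mm β h q (gv x)) (r+1) u))
      + 2 * β^2 / N * (dotp N (mm β h q (gv x) (r+1)) u)^2 ≤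
      ∑ i, u i ^ 2 * (sf β h (zv β h q (gv x) r i + w i))⁻¹ + β^2 * (1 - q) * nr u ^ 2
        - (c - Ra β h q κ l (fun t : Fin (r+2) => cf β h q r t) x - 4 * β * ε * C - (2 * |κ| + 4 * β^2) * Ta β h q r x
            - 2 * β * Pa β h q (r+1) x) * nr u ^ 2 := by
  have hN' : (0:ℝ) < N := by exact_mod_cast hN
  have hsN : (0:ℝ) < √N := Real.sqrt_pos.2 hN'
  have hsq : √(N:ℝ) ^ 2 = N := Real.sq_sqrt hN'.le
  set m := mm β h q (gv x) with hm
  set n := r + 1 with hn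
  let a : ℕ → ℝ := fun s => if s < n then dotp N (ph m s) u else nr (qs m n u)
  have a1 : ∀ s < n, a s = dotp N (ph m s) u := fun s hs => if_pos hs
  have a2 : a n = nr (qs m n u) := if_neg (lt_irrefl _)
  have hzl : ∀ i, lin (fun t : Fin (r+2) => cf β h q r t) (fun t => x (i, t)) = zv β h q (gv x) r i := fun i => (zv_lin β h q N (r+2) r (by omega) x i).symm
  have hb : ∑ t : Fin (r+2), cf β h q r t * cf β h q r t = q := by
    have := cf_gram β h q hβ hh hq hAT (r+2) r r le_rfl (by omega)
    rwa [if_pos rfl] at this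
  have haa : ∑ s : Fin (r+2), a s ^ 2 = nr u ^ 2 := by
    rw [Fin.sum_univ_eq_sum_range (fun t => a t ^ 2) (r+2), Finset.sum_range_succ, ← hn, a2, qs_nr]
    have : ∑ s ∈ Finset.range n, a s ^ 2 = ∑ s ∈ Finset.range n, dotp N (ph m s) u ^ 2 :=
      Finset.sum_congr rfl fun s hs => by rw [a1 s (Finset.mem_range.1 hs)]
    rw [this]; ring
  have hXe : dotp N (m n) u / √N = (∑ i, tf β h (lin (fun t : Fin (r+2) => cf β h q r t) (fun t => x (i, t))) * u i) / √N := by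
    simp only [hzl]; rfl
  have hbnd : |dotp N (m n) u / √N - ∑ s : Fin (r+2), cf β h q r s * a s| ≤ Ta β h q r x * nr u := by
    rw [cf_sum β h q (r+2) r (by omega), dot_split m n (m n) u]
    have e : (∑ s ∈ Finset.range n, dotp N (ph m s) (m n) * dotp N (ph m s) u + dotp N (qs m n (m n)) u) / √N
        - (∑ j ∈ Finset.range r, ga β h q j * a j + √(de β h q r) * a r) =
        ∑ s ∈ Finset.range n, (dotp N (ph m s) (m n) / √N - ga β h q s) * dotp N (ph m s) u
         + (ga β h q r - √(de β h q r)) * dotp N (ph m r) u + dotp N (qs m n (m n)) u / √N := by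
      have e1 : ∑ j ∈ Finset.range r, ga β h q j * a j = ∑ j ∈ Finset.range n, ga β h q j * dotp N (ph m j) u - ga β h q r * dotp N (ph m r) u := by
        rw [hn, Finset.sum_range_succ, add_sub_cancel_right]
        exact Finset.sum_congr rfl fun s hs => by rw [a1 s (by have := Finset.mem_range.1 hs; omega)]
      rw [e1, a1 r (by omega)]
      simp only [sub_mul, Finset.sum_sub_distrib, add_div, Finset.sum_div]
      have : ∀ s, dotp N (ph m s) (m n) / √N * dotp N (ph m s) u = dotp N (ph m s) (m n) * dotp N (ph m s) u / √N := fun s => by ring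
      simp only [this]
      ring
    rw [e]
    have b1 := range_sum_le n (fun s => dotp N (ph m s) u) (fun s => dotp N (ph m s) (m n) / √N - ga β h q s) (nr u) (fun s _ => ph_abs m s u)
    have b2 : |(ga β h q r - √(de β h q r)) * dotp N (ph m r) u| ≤ |ga β h q r - √(de β h q r)| * nr u := by
      rw [abs_mul]; exact mul_le_mul_of_nonneg_left (ph_abs m r u) (abs_nonneg _)
    have b3 : |dotp N (qs m n (m n)) u / √N| ≤ nr (qs m n (m n)) / √N * nr u := by
      rw [abs_div, abs_of_pos hsN, div_mul_eq_mul_div]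
      exact div_le_div_of_nonneg_right (abs_dotp_le _ _) hsN.le
    refine (abs_add_three _ _ _).trans ?_
    unfold Ta
    rw [add_mul, add_mul]
    exact add_le_add (add_le_add b1 b2) b3
  have main := det_bound hβ hq.2.1.le hl hl' hc1 hc2 hN (fun t : Fin (r+2) => cf β h q r t) hb x u w (fun s => a s) haa ε C (Ta β h q r x) hw hC hY
    (dotp N (m n) u / √N) hXe hbnd
  simp only [hzl] at main
  have gs : ∑ s : Fin (r+2), a s * ∑ i, x (i, s) * u i = ∑ s ∈ Finset.range n, dotp N (ph m s) u * dotp N (gv x s) u + nr (qs m n u) * dotp N (gv x n) u := by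
    have e0 : ∀ s : Fin (r+2), a s * ∑ i, x (i, s) * u i = (fun t : ℕ => a t * dotp N (gv x t) u) s := by
      intro s
      have : gv x s = fun i => x (i, s) := by funext i; simp [gv]
      simp only [this]; rfl
    rw [Finset.sum_congr rfl fun s _ => e0 s, Fin.sum_univ_eq_sum_range (fun t => a t * dotp N (gv x t) u) (r+2), Finset.sum_range_succ, ← hn, a2]
    congr 1
    exact Finset.sum_congr rfl fun s hs => by rw [a1 s (Finset.mem_range.1 hs)]
  rw [gs] at main
  have e5 : 2 * β^2 * (dotp N (m n) u / √N)^2 = 2 * β^2 / N * (dotp N (m n) u)^2 := by rw [div_pow, hsq]; ring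
  rw [e5] at main
  -- difference
  have e6 : 2 * β / √N * (nr (qs m n u) * dotp N (gv x n) (qs m n u)) ≤ 2 * β / √N * (nr (qs m n u) * dotp N (gv x n) u) + 2 * β * Pa β h q n x * nr u ^ 2 := by
    have e7 := dot_split m n (gv x n) u
    rw [← qs_adj] at e7
    have b1 := range_sum_le n (fun s => dotp N (ph m s) u) (fun s => dotp N (ph m s) (gv x n) / √N) (nr u) (fun s _ => ph_abs m s u)
    have e8 : ∑ s ∈ Finset.range n, dotp N (ph m s) (gv x n) / √N * dotp N (ph m s) u = (∑ s ∈ Finset.range n, dotp N (ph m s) (gv x n) * dotp N (ph m s) u) / √N := by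
      rw [Finset.sum_div]; exact Finset.sum_congr rfl fun s _ => by ring
    rw [e8] at b1
    have b1' := (abs_le.1 b1).1
    have hP : 0 ≤ (∑ s ∈ Finset.range n, |dotp N (ph m s) (gv x n) / √N|) := Finset.sum_nonneg fun _ _ => abs_nonneg _
    have b3 := mul_le_mul (qs_nr_le m n u) le_rfl (mul_nonneg hP (nr_nonneg u)) (nr_nonneg u)
    have b4 := mul_le_mul_of_nonneg_left b1' (nr_nonneg (qs m n u))
    set S := ∑ s ∈ Finset.range n, dotp N (ph m s) (gv x n) * dotp N (ph m s) u
    have e9 : dotp N (gv x n) (qs m n u) = dotp N (gv x n) u - S := by linarith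
    rw [e9]
    unfold Pa
    rw [← hm]
    set PP := ∑ s ∈ Finset.range n, |dotp N (ph m s) (gv x n) / √N|
    have e10 : 2 * β / √N * (nr (qs m n u) * (dotp N (gv x n) u - S)) = 2 * β / √N * (nr (qs m n u) * dotp N (gv x n) u) - 2 * β * (nr (qs m n u) * (S / √N)) := by
      field_simp
    rw [e10]
    have h12 : -(nr (qs m n u) * (S / √N)) ≤ PP * nr u ^ 2 := by
      have e13 : PP * nr u ^ 2 = nr u * (PP * nr u) := by ring
      have e14 : nr (qs m n u) * -(PP * nr u) = -(nr (qs m n u) * (PP * nr u)) := by ring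
      rw [e13]; rw [e14] at b4; linarith
    have h13 := mul_le_mul_of_nonneg_left h12 (show 0 ≤ 2 * β by positivity)
    have e15 : 2 * β * PP * nr u ^ 2 = 2 * β * (PP * nr u ^ 2) := by ring
    rw [e15]; linarith
  have e11 : 2 * β / √N * (∑ s ∈ Finset.range n, dotp N (ph m s) u * dotp N (gv x s) u + nr (qs m n u) * dotp N (gv x n) (qs m n u)) =
     2 * β / √N * (∑ s ∈ Finset.range n, dotp N (ph m s) u * dotp N (gv x s) u) + 2 * β / √N * (nr (qs m n u) * dotp N (gv x n) (qs m n u)) := by ring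
  rw [e11]
  rw [mul_add] at main
  linarith


theorem whp_fl {β h q : ℝ} (hβ : 0 < β) (hh : 0 < h) (hq : isFixedq β h q) (hAT : ATcond β h q) :
    ∃ c : ℝ, 0 < c ∧ ∃ r₀ : ℕ, ∀ r, r₀ ≤ r → ∃ ε : ℝ, 0 < ε ∧
      ∀ᶠ p : Σ N : ℕ, (Fin N × Fin (r+2) → ℝ) in Fl (r+2), ∀ u w : Fin p.1 → ℝ, nr w ≤ ε * √p.1 →
        2 * β / √p.1 * (∑ s ∈ Finset.range (r+1), dotp p.1 (ph (mm β h q (gv p.2)) s) u * dotp p.1 (gv p.2 s) u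
          + nr (qs (mm β h q (gv p.2)) (r+1) u) * dotp p.1 (gv p.2 (r+1)) (qs (mm β h q (gv p.2)) (r+1) u))
        + 2 * β^2 / p.1 * (dotp p.1 (mm β h q (gv p.2) (r+1)) u)^2 ≤
        ∑ i, u i ^ 2 * (sf β h (zv β h q (gv p.2) r i + w i))⁻¹ + β^2 * (1 - q) * nr u ^ 2 - c * nr u ^ 2 := by
  obtain ⟨l, κ, c, hl, hl', hc, h1, h2⟩ := consts hβ hq hAT
  have h2' : 2 * β^2 - 2 * κ + Lam β h q κ l ≤ 0 := by unfold Lam; linarith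
  refine ⟨c/4, by positivity, ?_⟩
  set A := 2 * |κ| + 4 * β^2 with hA
  have hA0 : 0 < A := by positivity
  have hde : Tendsto (fun r => A * (2 * √(de β h q r) + √(de β h q (r+1)))) atTop (nhds 0) := by
    have t0 := (de_tendsto hβ hh hq hAT)
    have t1 := (Real.continuous_sqrt.tendsto 0).comp t0
    have t2 := t1.comp (tendsto_add_atTop_nat 1)
    have := ((t1.const_mul 2).add t2).const_mul A
    simpa [Function.comp_def] using this
  obtain ⟨r₀, hr₀⟩ := eventually_atTop.1 (hde.eventually (gt_mem_nhds (show 0 < c/8 by positivity)))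
  refine ⟨r₀, fun r hr => ?_⟩
  have hr1 := hr₀ r hr
  have hb : ∑ t : Fin (r+2), cf β h q r t * cf β h q r t = q := by
    have := cf_gram β h q hβ hh hq hAT (r+2) r r le_rfl (by omega)
    rwa [if_pos rfl] at this
  obtain ⟨C, hC, hY⟩ := Ya_lim (K := r+2) β h κ (fun t : Fin (r+2) => cf β h q r t)
  refine ⟨c / (64 * β * C), by positivity, ?_⟩
  have hR := Ra_lim (β := β) (h := h) (κ := κ) (l := l) hq.1.le (fun t : Fin (r+2) => cf β h q r t) hb
  have hT : Tendsto (fun p : Σ N : ℕ, (Fin N × Fin (r+2) → ℝ) => Ta β h q r p.2) (Fl (r+2))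
      (nhds (0 + |ga β h q r - √(de β h q r)| + √(de β h q (r+1)))) := by
    refine Tendsto.add (Tendsto.add ?_ tendsto_const_nhds) (GS hβ hh hq hAT (r+2) (r+1) (by omega)).1
    have : Tendsto (fun p : Σ N : ℕ, (Fin N × Fin (r+2) → ℝ) => ∑ s ∈ Finset.range (r+1), |dotp p.1 (ph (mm β h q (gv p.2)) s) (mm β h q (gv p.2) (r+1)) / √p.1 - ga β h q s|)
        (Fl (r+2)) (nhds (∑ s ∈ Finset.range (r+1), |ga β h q s - ga β h q s|)) := by
      refine tendsto_finsetSum _ fun s hs => ?_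
      have hs' := Finset.mem_range.1 hs
      exact (((GS hβ hh hq hAT (r+2) s (by omega)).2.1 (r+1) hs' (by omega)).sub_const _).abs
    simpa using this
  have hP : Tendsto (fun p : Σ N : ℕ, (Fin N × Fin (r+2) → ℝ) => Pa β h q (r+1) p.2) (Fl (r+2)) (nhds 0) := by
    have : Tendsto (fun p : Σ N : ℕ, (Fin N × Fin (r+2) → ℝ) => Pa β h q (r+1) p.2) (Fl (r+2)) (nhds (∑ s ∈ Finset.range (r+1), |(0:ℝ)|)) := by
      refine tendsto_finsetSum _ fun s hs => ?_
      have hs' := Finset.mem_range.1 hs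
      exact ((GS hβ hh hq hAT (r+2) s (by omega)).2.2 (r+1) (by omega) (by omega)).abs
    simpa using this
  have hTl : A * (0 + |ga β h q r - √(de β h q r)| + √(de β h q (r+1))) < c/8 := by
    refine lt_of_le_of_lt ?_ hr1
    refine mul_le_mul_of_nonneg_left ?_ hA0.le
    have hg : |ga β h q r| ≤ √(de β h q r) := Real.abs_le_sqrt (ga_sq_le hβ hh hq hAT r)
    have h3 := abs_sub (ga β h q r) (√(de β h q r))
    rw [abs_of_nonneg (Real.sqrt_nonneg (de β h q r))] at h3
    linarith
  filter_upwards [hY, hR.eventually (gt_mem_nhds (show 0 < c/8 by positivity)), (hT.const_mul A).eventually (gt_mem_nhds hTl),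
    (hP.const_mul (2*β)).eventually (gt_mem_nhds (show 2 * β * 0 < c/8 by linarith)), (whp_fst _).eventually (eventually_gt_atTop 0)] with p y1 y2 y3 y4 y5 u w hw
  refine (det2 hβ hh hq hAT hl hl' h1 h2' r y5 p.2 u w _ C hw hC.le y1).trans ?_
  have e : 4 * β * (c / (64 * β * C)) * C = c/16 := by field_simp; norm_num
  rw [e]
  have := mul_le_mul_of_nonneg_right (show c/4 ≤ c - Ra β h q κ l (fun t : Fin (r+2) => cf β h q r t) p.2 - c/16 - (2 * |κ| + 4 * β^2) * Ta β h q r p.2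
            - 2 * β * Pa β h q (r+1) p.2 by rw [← hA]; linarith) (sq_nonneg (nr u))
  linarith


def Rx (β h q c : ℝ) (r : ℕ) {N K : ℕ} (x : Fin N × Fin K → ℝ) (u w : Fin N → ℝ) : ℝ :=
  ∑ i, u i ^ 2 * (sf β h (zv β h q (gv x) r i + w i))⁻¹ + β^2 * (1 - q) * nr u ^ 2 - c * nr u ^ 2
    - 2 * β^2 / N * (dotp N (mm β h q (gv x) (r+1)) u)^2
    - 2 * β / √N * ∑ s ∈ Finset.range (r+1), dotp N (ph (mm β h q (gv x)) s) u * dotp N (gv x s) u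

theorem sf_cont (β h : ℝ) : Continuous (sf β h) := by
  have := tf_cont β h
  unfold sf; fun_prop

theorem dotp_left_cont {N : ℕ} (v : Fin N → ℝ) : Continuous (fun u : Fin N → ℝ => dotp N v u) := by
  unfold dotp; fun_prop

theorem Rx_cont (β h q c : ℝ) (r : ℕ) {N K : ℕ} (x : Fin N × Fin K → ℝ) :
    Continuous (fun p : (Fin N → ℝ) × (Fin N → ℝ) => Rx β h q c r x p.1 p.2) := by
  have h1 := sf_cont β h
  have h2 : Continuous (fun p : (Fin N → ℝ) × (Fin N → ℝ) => nr p.1) := nr_cont.comp continuous_fst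
  have h3 : ∀ v : Fin N → ℝ, Continuous (fun p : (Fin N → ℝ) × (Fin N → ℝ) => dotp N v p.1) := fun v => (dotp_left_cont v).comp continuous_fst
  unfold Rx
  refine Continuous.sub (Continuous.sub (Continuous.sub (Continuous.add ?_ ?_) ?_) ?_) ?_
  · refine continuous_finsetSum _ fun i _ => Continuous.mul (by fun_prop) (Continuous.inv₀ (by fun_prop) fun p => (sf_pos β h _).ne')
  · fun_prop
  · fun_prop
  · exact continuous_const.mul ((h3 _).pow 2)
  · exact continuous_const.mul (continuous_finsetSum _ fun s _ => (h3 _).mul (h3 _))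

theorem Rx_meas (β h q c : ℝ) (r N K : ℕ) (u w : Fin N → ℝ) :
    Measurable (fun x : Fin N × Fin K → ℝ => Rx β h q c r x u w) := by
  have h1 := (sf_cont β h).measurable
  have h3 : ∀ f : (Fin N × Fin K → ℝ) → Fin N → ℝ, Measurable f → Measurable (fun x => dotp N (f x) u) := by
    intro f hf; unfold dotp; fun_prop
  have hz : ∀ i, Measurable (fun x : Fin N × Fin K → ℝ => zv β h q (gv x) r i) := by
    intro i
    have hg : ∀ j, Measurable (fun x : Fin N × Fin K → ℝ => gv x j i) := fun j => measurable_pi_iff.1 (gv_meas j) i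
    simp only [zv, Pi.add_apply, Finset.sum_apply, Pi.smul_apply, smul_eq_mul]
    fun_prop
  have hm := fun s => h3 _ (ph_meas (X := Fin N × Fin K → ℝ) (fun x => mm β h q (gv x)) (mm_meas β h q N K) s).1
  have hm2 := h3 _ (mm_meas β h q N K (r+1))
  have hg2 := fun s => h3 _ (gv_meas (N := N) (K := K) s)
  unfold Rx
  fun_prop

theorem Rx_upd (β h q c : ℝ) (r : ℕ) {N K : ℕ} (s : Fin K) (hs : (s:ℕ) = r + 1) (x : Fin N × Fin K → ℝ) (y u w : Fin N → ℝ) :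
    Rx β h q c r (upd s x y) u w = Rx β h q c r x u w := by
  have e1 : zv β h q (gv (upd s x y)) r = zv β h q (gv x) r := zv_congr β h q _ _ r fun j hj => gv_upd_ne x y s j (by omega)
  have e2 : mm β h q (gv (upd s x y)) (r+1) = mm β h q (gv x) (r+1) := mm_upd β h q s x y _ (by omega)
  unfold Rx
  rw [e1, e2]
  congr 2
  refine Finset.sum_congr rfl fun j hj => ?_
  have hj' := Finset.mem_range.1 hj
  rw [gv_upd_ne x y s j (by omega), ph_congr _ _ j fun i hi => mm_upd β h q s x y i (by omega)]

theorem compare {β h q : ℝ} (hβ : 0 < β) (c ε : ℝ) (hε : 0 < ε) (r : ℕ)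
    (H : ∀ᶠ p : Σ N : ℕ, (Fin N × Fin (r+2) → ℝ) in Fl (r+2), ∀ u w : Fin p.1 → ℝ, nr w ≤ ε * √p.1 →
      β * (2 / √p.1 * nr (qs (mm β h q (gv p.2)) (r+1) u) * dotp p.1 (gv p.2 (r+1)) (qs (mm β h q (gv p.2)) (r+1) u)) ≤ Rx β h q c r p.2 u w) :
    ∀ᶠ p : Σ N : ℕ, YP (r+2) N in FP (r+2), ∀ u w : Fin p.1 → ℝ, nr w < ε * √p.1 →
      β * qf p.1 p.2.2 (qs (mm β h q (gv p.2.1)) (r+1) u) ≤ Rx β h q c r p.2.1 u w := by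
  rw [whp_iff] at H ⊢
  have h2 := ENNReal.Tendsto.const_mul (a := 2) H (Or.inr (by simp))
  rw [mul_zero] at h2
  refine tendsto_of_tendsto_of_tendsto_of_le_of_le' tendsto_const_nhds h2 (Eventually.of_forall fun _ => zero_le) ?_
  filter_upwards [eventually_gt_atTop 0] with N hN
  have hN' : (0:ℝ) < N := by exact_mod_cast hN
  have hsN : (0:ℝ) < √N := Real.sqrt_pos.2 hN'
  let S : Set ((Fin N → ℝ) × (Fin N → ℝ)) := {p | nr p.2 < ε * √N}
  have : Nonempty S := ⟨⟨(0, 0), by show nr (0 : Fin N → ℝ) < _; rw [nr_zero]; positivity⟩⟩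
  let d : ℕ → S := TopologicalSpace.denseSeq S
  have hd : DenseRange d := TopologicalSpace.denseRange_denseSeq S
  let Q : (Fin N × Fin (r+2) → ℝ) → (Fin N → ℝ) → (Fin N → ℝ) := fun x => qs (mm β h q (gv x)) (r+1)
  have Qm : ∀ u, Measurable (fun x => Q x u) := fun u =>
    (ph_meas (X := Fin N × Fin (r+2) → ℝ) (fun x => mm β h q (gv x)) (mm_meas β h q N (r+2)) (r+1)).2 (fun _ => u) measurable_const
  have Qc : ∀ x, Continuous (Q x) := fun x => by
    have : Q x = fun u => u - ∑ j ∈ Finset.range (r+1), dotp N (ph (mm β h q (gv x)) j) u • ph (mm β h q (gv x)) j := by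
      funext u; exact qs_sum _ _ _
    rw [this]
    refine continuous_id.sub (continuous_finsetSum _ fun j _ => (dotp_left_cont _).smul continuous_const)
  let f : (Fin N × Fin (r+2) → ℝ) → ℕ → ℝ := fun x t => Rx β h q c r x (d t).1.1 (d t).1.2 / β
  have fm : ∀ t, Measurable (fun x => f x t) := fun t => (Rx_meas β h q c r N (r+2) _ _).div_const _
  let BM : Set ((Fin N × Fin (r+2) → ℝ) × (Fin N → Fin N → ℝ)) := {y | ¬ ∀ t, qf N y.2 (Q y.1 (d t).1.1) ≤ f y.1 t}
  let BG : Set ((Fin N × Fin (r+2) → ℝ) × (Fin N → ℝ)) := {y | ¬ ∀ t, 2 / √N * nr (Q y.1 (d t).1.1) * dotp N y.2 (Q y.1 (d t).1.1) ≤ f y.1 t}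
  have BMm : MeasurableSet BM := by
    refine MeasurableSet.compl (s := {y : (Fin N × Fin (r+2) → ℝ) × (Fin N → Fin N → ℝ) | ∀ t, qf N y.2 (Q y.1 (d t).1.1) ≤ f y.1 t}) ?_
    rw [Set.ofPred_forall]
    refine MeasurableSet.iInter fun t => measurableSet_le ?_ ((fm t).comp measurable_fst)
    have : Measurable (fun y : (Fin N × Fin (r+2) → ℝ) × (Fin N → Fin N → ℝ) => Q y.1 (d t).1.1) := (Qm (d t).1.1).comp measurable_fst
    unfold qf dotp mulVec
    fun_prop
  have BGm : MeasurableSet BG := by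
    refine MeasurableSet.compl (s := {y : (Fin N × Fin (r+2) → ℝ) × (Fin N → ℝ) | ∀ t, 2 / √N * nr (Q y.1 (d t).1.1) * dotp N y.2 (Q y.1 (d t).1.1) ≤ f y.1 t}) ?_
    rw [Set.ofPred_forall]
    refine MeasurableSet.iInter fun t => measurableSet_le ?_ ((fm t).comp measurable_fst)
    have : Measurable (fun y : (Fin N × Fin (r+2) → ℝ) × (Fin N → ℝ) => Q y.1 (d t).1.1) := (Qm (d t).1.1).comp measurable_fst
    have hn := nr_cont (N := N) |>.measurable
    unfold dotp
    fun_prop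
  let s : Fin (r+2) := ⟨r+1, by omega⟩
  have s1 : muP (r+2) N {y | ¬ ∀ u w : Fin N → ℝ, nr w < ε * √N → β * qf N y.2 (qs (mm β h q (gv y.1)) (r+1) u) ≤ Rx β h q c r y.1 u w}
      ≤ ((gm (Fin N × Fin (r+2))).prod (goe N)) BM := by
    refine measure_mono ?_
    intro y hy hy2
    apply hy
    intro u w hw
    have hc : IsClosed {p : S | qf N y.2 (Q y.1 p.1.1) ≤ Rx β h q c r y.1 p.1.1 p.1.2 / β} := by
      refine isClosed_le ?_ ?_
      · exact (qf_cont N y.2).comp ((Qc y.1).comp (continuous_fst.comp continuous_subtype_val))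
      · exact ((Rx_cont β h q c r y.1).comp continuous_subtype_val).div_const _
    have hs : Set.range d ⊆ {p : S | qf N y.2 (Q y.1 p.1.1) ≤ Rx β h q c r y.1 p.1.1 p.1.2 / β} := by
      rintro _ ⟨t, rfl⟩; exact hy2 t
    have := hc.closure_subset_iff.2 hs
    rw [hd.closure_range] at this
    have h3 : qf N y.2 (Q y.1 u) ≤ Rx β h q c r y.1 u w / β := this (Set.mem_univ ⟨(u, w), hw⟩)
    rw [le_div_iff₀ hβ] at h3
    rw [mul_comm]; exact h3
  have s2 : ((gm (Fin N × Fin (r+2))).prod (goe N)) BM ≤ 2 * ((gm (Fin N × Fin (r+2))).prod (gm (Fin N))) BG := by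
    rw [Measure.prod_apply BMm, Measure.prod_apply BGm, ← lintegral_const_mul _ (measurable_measure_prodMk_left BGm)]
    refine lintegral_mono fun x => ?_
    exact goe_comp_seq N hN (fun t => Q x (d t).1.1) (f x)
  have s3 : ((gm (Fin N × Fin (r+2))).prod (gm (Fin N))) BG ≤ gm (Fin N × Fin (r+2)) {x | ¬ ∀ u w : Fin N → ℝ, nr w ≤ ε * √N →
      β * (2 / √N * nr (qs (mm β h q (gv x)) (r+1) u) * dotp N (gv x (r+1)) (qs (mm β h q (gv x)) (r+1) u)) ≤ Rx β h q c r x u w} := by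
    let BX : Set (Fin N × Fin (r+2) → ℝ) := {x | (x, gv x (r+1)) ∈ BG}
    have BXm : MeasurableSet BX := BGm.preimage (measurable_id.prodMk (gv_meas (r+1)))
    have e : (fun p : (Fin N × Fin (r+2) → ℝ) × (Fin N → ℝ) => upd s p.1 p.2) ⁻¹' BX = BG := by
      ext y
      obtain ⟨x, g⟩ := y
      have e1 : gv (upd s x g) (r+1) = g := gv_upd_self x g s
      have e2 : ∀ u, Q (upd s x g) u = Q x u := fun u => by
        have := qs_congr (mm β h q (gv (upd s x g))) (mm β h q (gv x)) (r+1) (fun j hj => mm_upd β h q s x g j hj.le)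
        exact congrFun this u
      have e3 : ∀ t, f (upd s x g) t = f x t := fun t => by
        show _ / β = _ / β
        rw [Rx_upd β h q c r s rfl]
      show (¬ ∀ t, 2 / √N * nr (Q (upd s x g) (d t).1.1) * dotp N (gv (upd s x g) (r+1)) (Q (upd s x g) (d t).1.1) ≤ f (upd s x g) t) ↔ _
      simp only [e1, e2, e3]
      rfl
    rw [← e, (mp_upd N (r+2) s).measure_preimage BXm.nullMeasurableSet]
    refine measure_mono ?_
    intro x hx h
    apply hx
    intro t
    have := h (d t).1.1 (d t).1.2 (le_of_lt (d t).2)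
    show _ ≤ _ / β
    rw [le_div_iff₀ hβ, mul_comm]
    exact this
  exact s1.trans (s2.trans (mul_le_mul_right s3 2))


theorem hess_form (β q : ℝ) {N : ℕ} (m : Fin N → ℝ) (G : Fin N → Fin N → ℝ) (u : Fin N → ℝ) :
    dotp N u (mulVec N (fun i j => (if i = j then (1 - m i ^ 2)⁻¹ else 0) + β ^ 2 * (1 - q) * (if i = j then 1 else 0)
                  - 2 * β ^ 2 / N * (m i * m j) - β * G i j) u) =
      ∑ i, u i ^ 2 * (1 - m i ^ 2)⁻¹ + β^2 * (1 - q) * nr u ^ 2 - 2 * β^2 / N * (dotp N m u)^2 - β * qf N G u := by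
  have e1 : ∀ i, mulVec N (fun i j => (if i = j then (1 - m i ^ 2)⁻¹ else 0) + β ^ 2 * (1 - q) * (if i = j then 1 else 0)
                  - 2 * β ^ 2 / N * (m i * m j) - β * G i j) u i =
      (1 - m i ^ 2)⁻¹ * u i + β^2 * (1 - q) * u i - 2 * β^2 / N * dotp N m u * m i - β * mulVec N G u i := by
    intro i
    simp only [mulVec, dotp, sub_mul, add_mul, Finset.sum_sub_distrib, Finset.sum_add_distrib, ite_mul, zero_mul, mul_ite, mul_one, mul_zero,
      Finset.sum_ite_eq, Finset.mem_univ, if_true, Finset.mul_sum, Finset.sum_mul]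
    congr 1
    · congr 1
      exact Finset.sum_congr rfl fun j _ => by ring
    · exact Finset.sum_congr rfl fun j _ => by ring
  have e2 : nr u ^ 2 = ∑ i, u i * u i := by rw [nr_sq]; rfl
  have e3 : ∀ v : Fin N → ℝ, dotp N u v = ∑ i, u i * v i := fun v => rfl
  have e4 : (dotp N m u)^2 = ∑ i, dotp N m u * m i * u i := by
    rw [sq]
    conv_lhs => rw [show dotp N m u * dotp N m u = dotp N m u * ∑ i, m i * u i from rfl, Finset.mul_sum]
    exact Finset.sum_congr rfl fun j _ => by ring
  rw [e3, e4, e2, qf, e3]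
  simp only [e1, Finset.mul_sum]
  rw [← Finset.sum_add_distrib, ← Finset.sum_sub_distrib, ← Finset.sum_sub_distrib]
  exact Finset.sum_congr rfl fun j _ => by ring

def Er (β h q : ℝ) (n : ℕ) {N K : ℕ} (x : Fin N × Fin K → ℝ) : ℝ :=
  ∑ s ∈ Finset.range n, ∑ j ∈ Finset.range (s+1), |dotp N (ph (mm β h q (gv x)) j) (gv x s)| / √N

theorem Er_lim {β h q : ℝ} (hβ : 0 < β) (hh : 0 < h) (hq : isFixedq β h q) (hAT : ATcond β h q) (K n : ℕ) (hn : n ≤ K) :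
    Tendsto (fun p : Σ N : ℕ, (Fin N × Fin K → ℝ) => Er β h q n p.2) (Fl K) (nhds 0) := by
  have : Tendsto (fun p : Σ N : ℕ, (Fin N × Fin K → ℝ) => Er β h q n p.2) (Fl K)
      (nhds (∑ s ∈ Finset.range n, ∑ j ∈ Finset.range (s+1), |(0:ℝ)|)) := by
    refine tendsto_finsetSum _ fun s hs => tendsto_finsetSum _ fun j hj => ?_
    have hs' := Finset.mem_range.1 hs
    have hj' := Finset.mem_range.1 hj
    have := ((GS hβ hh hq hAT K j (by omega)).2.2 s (by omega) (by omega)).abs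
    simpa only [abs_div, abs_of_nonneg (Real.sqrt_nonneg _)] using this
  simpa using this

theorem final_det {β h q c c' ε η E : ℝ} (hβ : 0 < β) (hq : q < 1) (r : ℕ) {N : ℕ} (hN : 0 < N) (y : YP (r+2) N) (ζ : ℕ → Fin N → ℝ)
    (hη0 : 0 ≤ η) (hη : ∀ i, |Bp β h q (r+1) y i i| ≤ η)
    (hw : nr (zv β h q ζ r - zv β h q (gv y.1) r) ≤ ε * √N) (hE : Er β h q (r+1) y.1 ≤ E)
    (u : Fin N → ℝ)
    (H : β * qf N y.2 (qs (mm β h q (gv y.1)) (r+1) u) ≤ Rx β h q c r y.1 u (zv β h q ζ r - zv β h q (gv y.1) r))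
    (hc : c' ≤ c - 4 * β^3 * ε - β * η - 4 * β * E) :
    c' * nr u ^ 2 ≤ ∑ i, u i ^ 2 * (1 - mm β h q ζ (r+1) i ^ 2)⁻¹ + β^2 * (1 - q) * nr u ^ 2
      - 2 * β^2 / N * (dotp N (mm β h q ζ (r+1)) u)^2 - β * qf N (od (Bp β h q (r+1) y)) u := by
  have hN' : (0:ℝ) < N := by exact_mod_cast hN
  have hsN : (0:ℝ) < √N := Real.sqrt_pos.2 hN'
  have hsq : √(N:ℝ) * √N = N := Real.mul_self_sqrt hN'.le
  have hU := nr_nonneg u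
  -- 1: diagonal
  have h1 : qf N (od (Bp β h q (r+1) y)) u ≤ qf N (Bp β h q (r+1) y) u + η * nr u ^ 2 := by
    have a1 := od_diff (Bp β h q (r+1) y) η hη0 hη u
    have a2 := dotp_le u (mulVec N (od (Bp β h q (r+1) y)) u - mulVec N (Bp β h q (r+1) y) u)
    rw [dotp_sub_right] at a2
    have a3 := mul_le_mul_of_nonneg_left a1 hU
    unfold qf
    have : nr u * (η * nr u) = η * nr u ^ 2 := by ring
    linarith
  -- 2: Bm
  have h2 : qf N (Bp β h q (r+1) y) u ≤ 2 / √N * (∑ s ∈ Finset.range (r+1), dotp N (ph (mm β h q (gv y.1)) s) u * dotp N (gv y.1 s) u)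
      + qf N y.2 (qs (mm β h q (gv y.1)) (r+1) u) + 4 * E * nr u ^ 2 := by
    have a1 := (abs_le.1 (Bm_qf (mm β h q (gv y.1)) (gv y.1) (r+1) y.2 u)).2
    have a2 : 4 * Er β h q (r+1) y.1 * nr u ^ 2 ≤ 4 * E * nr u ^ 2 := mul_le_mul_of_nonneg_right (by linarith) (sq_nonneg _)
    unfold Er at a2
    unfold Bp
    linarith
  -- 3: m difference
  have h3 : 2 * β^2 / N * (dotp N (mm β h q ζ (r+1)) u)^2 ≤ 2 * β^2 / N * (dotp N (mm β h q (gv y.1) (r+1)) u)^2 + 4 * β^3 * ε * nr u ^ 2 := by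
    set m1 := mm β h q ζ (r+1)
    set m2 := mm β h q (gv y.1) (r+1)
    have b1 : nr m1 ≤ √N := nr_bdd _ (mm_abs β h q hq ζ (r+1))
    have b2 : nr m2 ≤ √N := nr_bdd _ (mm_abs β h q hq (gv y.1) (r+1))
    have b3 : nr (m1 - m2) ≤ β * (ε * √N) := (mm_diff β h q hβ ζ (gv y.1) r).trans (mul_le_mul_of_nonneg_left hw hβ.le)
    have b4 : |dotp N (m1 - m2) u| ≤ β * (ε * √N) * nr u := (abs_dotp_le _ _).trans (mul_le_mul_of_nonneg_right b3 hU)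
    have b5 : |dotp N m1 u + dotp N m2 u| ≤ 2 * √N * nr u := by
      refine (abs_add_le _ _).trans ?_
      have c1 := (abs_dotp_le m1 u).trans (mul_le_mul_of_nonneg_right b1 hU)
      have c2 := (abs_dotp_le m2 u).trans (mul_le_mul_of_nonneg_right b2 hU)
      linarith
    have b6 := mul_le_mul b4 b5 (abs_nonneg _) ((abs_nonneg _).trans b4)
    rw [← abs_mul, dotp_sub_left] at b6
    have b7 := (le_abs_self _).trans b6
    have b8 : (dotp N m1 u)^2 ≤ (dotp N m2 u)^2 + 2 * β * ε * N * nr u ^ 2 := by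
      have c1 : (dotp N m1 u - dotp N m2 u) * (dotp N m1 u + dotp N m2 u) = (dotp N m1 u)^2 - (dotp N m2 u)^2 := by ring
      have c2 : β * (ε * √N) * nr u * (2 * √N * nr u) = 2 * β * ε * N * nr u ^ 2 := by
        linear_combination (2 * β * ε * nr u ^ 2) * hsq
      rw [c1, c2] at b7; linarith
    have b9 := mul_le_mul_of_nonneg_left b8 (show 0 ≤ 2 * β^2 / N by positivity)
    have b10 : 2 * β^2 / N * ((dotp N m2 u)^2 + 2 * β * ε * N * nr u ^ 2) = 2 * β^2 / N * (dotp N m2 u)^2 + 4 * β^3 * ε * nr u ^ 2 := by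
      field_simp; ring
    rw [b10] at b9
    exact b9
  have h4 : ∀ i, (1 - mm β h q ζ (r+1) i ^ 2) = sf β h (zv β h q (gv y.1) r i + (zv β h q ζ r - zv β h q (gv y.1) r) i) := by
    intro i
    rw [Pi.sub_apply, add_sub_cancel]; rfl
  simp only [h4]
  unfold Rx at H
  have h5 := mul_le_mul_of_nonneg_right hc (sq_nonneg (nr u))
  have h6 := mul_le_mul_of_nonneg_left (h1.trans (add_le_add_left h2 _)) hβ.le
  set SS := ∑ s ∈ Finset.range (r+1), dotp N (ph (mm β h q (gv y.1)) s) u * dotp N (gv y.1 s) u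
  have e7 : 2 * β / √N * SS = β * (2 / √N * SS) := by ring
  rw [e7] at H
  linarith

theorem final_whp {β h q : ℝ} (hβ : 0 < β) (hh : 0 < h) (hq : isFixedq β h q) (hAT : ATcond β h q) :
    ∃ c : ℝ, 0 < c ∧ ∃ r₀ : ℕ, ∀ r, r₀ ≤ r → ∀ᶠ p in whp goe, Ev β h q c (r+2) p.1 (Wg p.2) := by
  obtain ⟨c, hc, r₀, H⟩ := whp_fl hβ hh hq hAT
  refine ⟨c/4, by positivity, r₀, fun r hr => ?_⟩
  obtain ⟨ε, hε, H1⟩ := H r hr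
  have H2 := compare (β := β) (h := h) (q := q) hβ c ε hε r (by
    filter_upwards [H1] with p hp u w hw
    have := hp u w hw
    unfold Rx
    rw [mul_add] at this
    have e : β * (2 / √p.1 * nr (qs (mm β h q (gv p.2)) (r+1) u) * dotp p.1 (gv p.2 (r+1)) (qs (mm β h q (gv p.2)) (r+1) u)) =
      2 * β / √p.1 * (nr (qs (mm β h q (gv p.2)) (r+1) u) * dotp p.1 (gv p.2 (r+1)) (qs (mm β h q (gv p.2)) (r+1) u)) := by ring
    rw [e]
    linarith)
  refine whp_map_back (muP (r+2)) goe (fun N => Bp β h q (r+1)) (fun N => Bp_mp β h q (r+2) (r+1) N (by omega))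
    (fun p => Ev β h q (c/4) (r+2) p.1 (Wg p.2)) ?_ ?_
  · intro N
    have hWg : Measurable (Wg : (Fin N → Fin N → ℝ) → _) := by
      refine measurable_pi_iff.2 fun i => measurable_pi_iff.2 fun j => ?_
      simp only [Wg, od]
      by_cases hij : i = j
      · simp [hij]
      · simp only [hij, if_false]; fun_prop
    exact hWg (Ev_meas β h q (c/4) (r+2) N)
  · have hη : 0 < c / (8 * β) := by positivity
    have hg := (FP_B β h q (r+2) (r+1) (by omega)).eventually (goe_good (c / (8 * β)) hη)
    let ζ : ∀ p : Σ N : ℕ, YP (r+2) N, ℕ → Fin p.1 → ℝ := fun p => rz β h q (Wg (Bp β h q (r+1) p.2))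
    have hR : ∀ᶠ p in FP (r+2), Rel β h q (od (Bp β h q (r+1) p.2)) (ζ p) := by
      filter_upwards [hg] with p hp
      have := rz_Rel β h q hq.1 (Wg (Bp β h q (r+1) p.2))
      rwa [symmG_Wg _ hp.1] at this
    have hz := zv_lim (l := FP (r+2)) β h q (fun p => p.1) ζ (fun p => gv p.2.1) r
      (fun j hj => (cmp_all hβ hh hq hAT (r+2) (r+1) (by omega) ζ hR j (by omega)).1)
    have hEr := (Er_lim hβ hh hq hAT (r+2) (r+1) (by omega)).comp (FP_fst (r+2))
    set ε' := min ε (c / (16 * β^3)) with hε'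
    have hε'0 : 0 < ε' := lt_min hε (by positivity)
    filter_upwards [H2, hg, hz.eventually (gt_mem_nhds hε'0), hEr.eventually (gt_mem_nhds (show 0 < c / (16 * β) by positivity)),
      (whp_fst _).eventually (eventually_gt_atTop 0)] with p y1 y2 y3 y4 y5 u
    have hN' : (0:ℝ) < p.1 := by exact_mod_cast y5
    have hsN : (0:ℝ) < √p.1 := Real.sqrt_pos.2 hN'
    rw [div_lt_iff₀ hsN] at y3
    have y3' := y3.trans_le (mul_le_mul_of_nonneg_right (min_le_left ε (c / (16 * β^3))) hsN.le)
    rw [hess_form, symmG_Wg _ y2.1, mTAP_eq β h q hq.1]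
    have e0 : ∑ i, u i ^ 2 = nr u ^ 2 := by rw [nr_sq, dotp]; exact Finset.sum_congr rfl fun i _ => by ring
    rw [e0]
    refine final_det (c := c) (ε := ε') (η := c / (8 * β)) (E := c / (16 * β)) hβ hq.2.1 r y5 p.2 (ζ p) hη.le y2.2.2 y3.le y4.le u (y1 u _ y3') ?_
    have z1 : 4 * β^3 * ε' ≤ 4 * β^3 * (c / (16 * β^3)) := mul_le_mul_of_nonneg_left (min_le_right _ _) (by positivity)
    have z2 : 4 * β^3 * (c / (16 * β^3)) = c/4 := by field_simp; norm_num
    have z3 : β * (c / (8 * β)) = c/8 := by field_simp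
    have z4 : 4 * β * (c / (16 * β)) = c/4 := by field_simp; norm_num
    rw [z3, z4]
    linarith

theorem TAP_main
    (β h q : ℝ) (hβ : 0 < β) (hh : 0 < h)
    (hq : isFixedq β h q) (hAT : ATcond β h q)
    (Ω : ℕ → Type) [∀ N, MeasurableSpace (Ω N)] (P : ∀ N, Measure (Ω N))
    (hP : ∀ N, IsProbabilityMeasure (P N))
    (W : ∀ N, Ω N → Fin N → Fin N → ℝ) (hW : ∀ N, IsWGauss N (P N) (W N)) :
    ∃ c : ℝ, 0 < c ∧ ∃ k₀ : ℕ, ∀ k, k₀ ≤ k →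
      Tendsto (fun N => (P N {ω | Ev β h q c k N (W N ω)}).toReal) atTop (nhds 1) := by
  obtain ⟨c, hc, r₀, H⟩ := final_whp hβ hh hq hAT
  refine ⟨c, hc, r₀ + 2, fun k hk => ?_⟩
  obtain ⟨r, rfl⟩ : ∃ r, k = r + 2 := ⟨k - 2, by omega⟩
  exact transfer β h q c hq.1 (r+1) Ω P hP W hW (H r (by omega))

/-- Assume `(β,h)` satisfy the AT condition. Then there exists
`c = c_{β,h} > 0`, independent of `N`, such that for `k` large enough, with probability
tending to one as `N → ∞`, `D_{m^{(k)}} + β²(1-q) - (2β²/N) m^{(k)} ⊗ m^{(k)} - β G ≥ c`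
as quadratic forms, where `G = (W + Wᵀ)/√2` and `m^{(k)}` is Bolthausen's iterative TAP
solution at step `k`. -/
theorem TAP_Hessian_lower_bound
    (β h q : ℝ) (hβ : 0 < β) (hh : 0 < h)
    (hq : isFixedq β h q) (hAT : ATcond β h q)
    (Ω : ℕ → Type) [∀ N, MeasurableSpace (Ω N)] (P : ∀ N, Measure (Ω N))
    (hP : ∀ N, IsProbabilityMeasure (P N))
    (W : ∀ N, Ω N → Fin N → Fin N → ℝ) (hW : ∀ N, IsWGauss N (P N) (W N)) :
    ∃ c : ℝ, 0 < c ∧ ∃ k₀ : ℕ, ∀ k, k₀ ≤ k →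
      Tendsto (fun N => ((P N) {ω |
          ∀ u : Fin N → ℝ,
            c * (∑ i, u i ^ 2) ≤
              dotp N u (mulVec N (fun i j =>
                (if i = j then (1 - mTAP N β h q (W N ω) k i ^ 2)⁻¹ else 0)
                  + β ^ 2 * (1 - q) * (if i = j then 1 else 0)
                  - 2 * β ^ 2 / N * (mTAP N β h q (W N ω) k i * mTAP N β h q (W N ω) k j)
                  - β * symmG N (W N ω) i j) u)}).toReal)
        atTop (nhds 1) := by
  exact TAP_main β h q hβ hh hq hAT Ω P hP W hW

end SK
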